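/- Let H < 1/6, T > 0, ρ_1 ∈ ℝ ∖ {0}, ρ_2 ∈ ℝ, let B^H be a one-dimensional fractional Brownian motion with Hurst parameter H having continuous paths and W a standard one-dimensional Brownian motion independent of B^H, on a complete probability space. Suppose b : [0,T] × ℝ → ℝ has the decomposition b = b̃ + b̂, where b̃ is measurable and bounded and b̂ is measurable, Lipschitz continuous in the spatial variable uniformly in time and of linear growth uniformly in time. For s ∈ [0,T) and x ∈ ℝ let X^{s,x} be the unique strong solution of X^{s,x}_t = x + ∫_s^t b(u, X^{s,x}_u) du + ρ_1(B^H_t − B^H_s) + ρ_2(W_t − W_s), s ≤ t ≤ T. Then for every compact interval K ⊂ ℝ and every r ∈ ℕ there exists a constant C_{r,H,T}(K) < ∞ such that for all s ∈ [0,T) and all x, y ∈ K: E[ sup_{t ∈ [s,T]} |X^{s,x}_t − X^{s,y}_t|^{2^r} ] ≤ C_{r,H,T}(K) |x − y|^{2^r}. -/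

import Mathlib

open MeasureTheory ProbabilityTheory Real Set
open scoped ENNReal NNReal BigOperators

noncomputable section

/-- A one-dimensional centered Gaussian process with the fractional Brownian motion
covariance structure with Hurst parameter `H`.  For `H = 1/2` this is a standard
one-dimensional Brownian motion. -/
structure IsFBM {Ω : Type*} [MeasurableSpace Ω] (μ : Measure Ω) (H : ℝ) (B : ℝ → Ω → ℝ) :
    Prop where
  meas : ∀ t, Measurable (B t)
  gaussian : ∀ (n : ℕ) (t : Fin n → ℝ) (c : Fin n → ℝ),
    ∃ v : ℝ≥0, μ.map (fun ω => ∑ i, c i * B (t i) ω) = gaussianReal 0 v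
  cov : ∀ s t : ℝ, 0 ≤ s → 0 ≤ t →
    ∫ ω, B t ω * B s ω ∂μ = (t ^ (2 * H) + s ^ (2 * H) - |t - s| ^ (2 * H)) / 2

/-- The `μ`-augmentation of the σ-algebra generated by `(B_s, W_s)_{0 ≤ s ≤ t}`. -/
def augPairFiltration {Ω : Type*} [MeasurableSpace Ω] (μ : Measure Ω)
    (B W : ℝ → Ω → ℝ) (t : ℝ) : MeasurableSpace Ω :=
  (⨆ s ∈ Set.Icc (0 : ℝ) t,
      MeasurableSpace.comap (B s) inferInstance ⊔ MeasurableSpace.comap (W s) inferInstance) ⊔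
    MeasurableSpace.generateFrom {A : Set Ω | μ A = 0}

lemma sp_min_psd {ι : Type*} [Fintype ι] (c τ : ι → ℝ) (hτ : ∀ i, 0 ≤ τ i) :
    0 ≤ ∑ i, ∑ j, c i * c j * min (τ i) (τ j) := by
  have h1 : ∀ i j, min (τ i) (τ j) =
      ∫ x, (Ioc 0 (τ i)).indicator (1 : ℝ → ℝ) x * (Ioc 0 (τ j)).indicator (1 : ℝ → ℝ) x := by
    intro i j
    have : (fun x => (Ioc 0 (τ i)).indicator (1 : ℝ → ℝ) x * (Ioc 0 (τ j)).indicator (1 : ℝ → ℝ) x)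
        = (Ioc 0 (min (τ i) (τ j))).indicator (1 : ℝ → ℝ) := by
      ext x; simp only [Set.indicator_apply, Set.mem_Ioc, le_min_iff, Pi.one_apply]; grind
    rw [this, integral_indicator_one measurableSet_Ioc]
    rw [Measure.real, Real.volume_Ioc, sub_zero, ENNReal.toReal_ofReal (le_min (hτ i) (hτ j))]
  have hi : ∀ i j, Integrable (fun x =>
      (Ioc 0 (τ i)).indicator (1 : ℝ → ℝ) x * (Ioc 0 (τ j)).indicator (1 : ℝ → ℝ) x) := by
    intro i j
    have : (fun x => (Ioc 0 (τ i)).indicator (1 : ℝ → ℝ) x * (Ioc 0 (τ j)).indicator (1 : ℝ → ℝ) x)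
        = (Ioc 0 (τ i) ∩ Ioc 0 (τ j)).indicator (1 : ℝ → ℝ) := by
      ext x; simp [Set.indicator_apply, Set.mem_inter_iff]; try grind
    rw [this]
    refine (integrable_indicator_iff (measurableSet_Ioc.inter measurableSet_Ioc)).2 ?_
    refine integrableOn_const ?_
    exact ((measure_mono inter_subset_left).trans_lt measure_Ioc_lt_top).ne
  have : ∑ i, ∑ j, c i * c j * min (τ i) (τ j) =
      ∫ x, (∑ i, c i * (Ioc 0 (τ i)).indicator (1 : ℝ → ℝ) x) ^ 2 := by
    simp_rw [h1, ← integral_const_mul]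
    simp_rw [pow_two, Finset.sum_mul_sum]
    rw [integral_finsetSum]
    · refine Finset.sum_congr rfl fun i _ => ?_
      rw [integral_finsetSum]
      · refine Finset.sum_congr rfl fun j _ => ?_
        congr 1; ext x; ring
      · intro j _; exact ((hi i j).const_mul (c i * c j)).congr (Filter.Eventually.of_forall fun x => by ring)
    · intro i _
      refine integrable_finsetSum _ fun j _ => ?_
      exact ((hi i j).const_mul (c i * c j)).congr (Filter.Eventually.of_forall fun x => by ring)
  rw [this]
  exact integral_nonneg fun x => sq_nonneg _

lemma sp_ou_form {ι : Type*} [Fintype ι] (l : ℝ) (hl : 0 ≤ l) (a r : ι → ℝ) (s u : ℝ)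
    (hr : ∀ i, r i ≤ s) (hsu : s ≤ u) :
    1 - exp (-(2 * l * (u - s))) ≤
      1 + 2 * ∑ i, a i * exp (-(l * (u - r i))) +
        ∑ i, ∑ j, a i * a j * exp (-(l * |r i - r j|)) := by
  have key := sp_min_psd (fun i => a i * exp (-(l * (s - r i))))
    (fun i => exp (2 * l * (s - r i)) - 1)
    (fun i => by
      have : 0 ≤ 2 * l * (s - r i) := by have := hr i; have := mul_nonneg hl (sub_nonneg.2 this); nlinarith
      have := Real.add_one_le_exp (2 * l * (s - r i)); linarith)
  set q := ∑ i, a i * exp (-(l * (s - r i))) with hq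
  have e1 : ∑ i, ∑ j, (a i * exp (-(l * (s - r i)))) * (a j * exp (-(l * (s - r j)))) *
      min (exp (2 * l * (s - r i)) - 1) (exp (2 * l * (s - r j)) - 1) =
      ∑ i, ∑ j, a i * a j * exp (-(l * |r i - r j|)) - q ^ 2 := by
    rw [hq, pow_two, Finset.sum_mul_sum, ← Finset.sum_sub_distrib]
    refine Finset.sum_congr rfl fun i _ => ?_
    rw [← Finset.sum_sub_distrib]
    refine Finset.sum_congr rfl fun j _ => ?_
    rcases le_total (r i) (r j) with h | h
    · have h2 : min (exp (2 * l * (s - r i)) - 1) (exp (2 * l * (s - r j)) - 1)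
          = exp (2 * l * (s - r j)) - 1 := by
        apply min_eq_right
        have : exp (2 * l * (s - r j)) ≤ exp (2 * l * (s - r i)) := by
          apply Real.exp_le_exp.2; nlinarith
        linarith
      rw [h2, abs_of_nonpos (by linarith)]
      have : exp (-(l * -(r i - r j))) =
          exp (-(l * (s - r i))) * exp (-(l * (s - r j))) * exp (2 * l * (s - r j)) := by
        rw [← Real.exp_add, ← Real.exp_add]; congr 1; ring
      rw [this]; ring
    · have h2 : min (exp (2 * l * (s - r i)) - 1) (exp (2 * l * (s - r j)) - 1)
          = exp (2 * l * (s - r i)) - 1 := by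
        apply min_eq_left
        have : exp (2 * l * (s - r i)) ≤ exp (2 * l * (s - r j)) := by
          apply Real.exp_le_exp.2; nlinarith
        linarith
      rw [h2, abs_of_nonneg (by linarith)]
      have : exp (-(l * (r i - r j))) =
          exp (-(l * (s - r i))) * exp (-(l * (s - r j))) * exp (2 * l * (s - r i)) := by
        rw [← Real.exp_add, ← Real.exp_add]; congr 1; ring
      rw [this]; ring
  rw [e1] at key
  have e2 : ∑ i, a i * exp (-(l * (u - r i))) = exp (-(l * (u - s))) * q := by
    rw [hq, Finset.mul_sum]
    refine Finset.sum_congr rfl fun i _ => ?_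
    have : exp (-(l * (u - r i))) = exp (-(l * (u - s))) * exp (-(l * (s - r i))) := by
      rw [← Real.exp_add]; congr 1; ring
    rw [this]; ring
  have e3 : exp (-(2 * l * (u - s))) = exp (-(l * (u - s))) ^ 2 := by
    rw [pow_two, ← Real.exp_add]; congr 1; ring
  rw [e2, e3]
  nlinarith [sq_nonneg (q + exp (-(l * (u - s))))]

/-- the quadratic variance expression for a general variogram `k` -/
def sp_E {ι : Type*} [Fintype ι] (k : ℝ → ℝ) (c r : ι → ℝ) (u : ℝ) : ℝ :=
  k u - ∑ j, c j * (k u + k (r j) - k (u - r j)) +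
    ∑ i, ∑ j, c i * c j * ((k (r i) + k (r j) - k (r i - r j)) / 2)

lemma sp_E_ou {ι : Type*} [Fintype ι] (l : ℝ) (hl : 0 ≤ l) (c r : ι → ℝ) (s u : ℝ)
    (hr0 : ∀ i, 0 ≤ r i) (hr : ∀ i, r i ≤ s) (hs : 0 ≤ s) (hsu : s ≤ u) :
    (1 - exp (-(l * |2 * (u - s)|))) / 2 ≤ sp_E (fun t => 1 - exp (-(l * |t|))) c r u := by
  have h := sp_ou_form (ι := Option ι) l hl (fun o => o.elim (∑ j, c j - 1) (fun j => - c j))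
    (fun o => o.elim 0 r) s u (by rintro (_ | i) <;> simp [hs, hr]) hsu
  simp only [Fintype.sum_option, Option.elim] at h
  rw [abs_of_nonneg (by linarith), show l * (2 * (u - s)) = 2 * l * (u - s) by ring]
  have : sp_E (fun t => 1 - exp (-(l * |t|))) c r u * 2 = 1 + 2 * ((∑ j, c j - 1) * rexp (-(l * (u - 0))) + ∑ i, -c i * rexp (-(l * (u - r i)))) +
        ((∑ j, c j - 1) * (∑ j, c j - 1) * rexp (-(l * |(0:ℝ) - 0|)) +
            ∑ j, (∑ j, c j - 1) * -c j * rexp (-(l * |0 - r j|)) +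
          ∑ i,
            (-c i * (∑ j, c j - 1) * rexp (-(l * |r i - 0|)) +
              ∑ j, -c i * -c j * rexp (-(l * |r i - r j|)))) := by
    unfold sp_E
    have a1 : ∀ j, |u - r j| = u - r j := fun j => abs_of_nonneg (by linarith [hr j])
    have a2 : ∀ j, |r j| = r j := fun j => abs_of_nonneg (hr0 j)
    have a3 : |u| = u := abs_of_nonneg (by linarith)
    simp only [a1, a2, a3, sub_zero, zero_sub, abs_neg, abs_zero, mul_zero, neg_zero, Real.exp_zero]
    set S := ∑ j, c j with hS
    have b1 : ∑ j, c j * (1 - rexp (-(l * u)) + (1 - rexp (-(l * r j))) - (1 - rexp (-(l * (u - r j)))))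
       = S - S * rexp (-(l*u)) - ∑ j, c j * rexp (-(l * r j)) + ∑ j, c j * rexp (-(l * (u - r j))) := by
      rw [hS, Finset.sum_mul, ← Finset.sum_sub_distrib, ← Finset.sum_sub_distrib, ← Finset.sum_add_distrib]
      exact Finset.sum_congr rfl fun j _ => by ring
    have b2 : ∑ i, ∑ j, c i * c j * ((1 - rexp (-(l * r i)) + (1 - rexp (-(l * r j))) -
        (1 - rexp (-(l * |r i - r j|)))) / 2) = S * S / 2 - S * (∑ j, c j * rexp (-(l * r j)))
        + (∑ i, ∑ j, c i * c j * rexp (-(l * |r i - r j|))) / 2 := by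
      have : ∀ i j, c i * c j * ((1 - rexp (-(l * r i)) + (1 - rexp (-(l * r j))) -
        (1 - rexp (-(l * |r i - r j|)))) / 2) = c i * c j / 2 - (c i * rexp (-(l * r i))) * c j / 2
         - c i * (c j * rexp (-(l * r j))) / 2 + c i * c j * rexp (-(l * |r i - r j|)) / 2 := by
        intros; ring
      simp_rw [this, Finset.sum_add_distrib, Finset.sum_sub_distrib, ← Finset.sum_div, ← Finset.sum_mul_sum]
      rw [← hS]; ring
    have b3 : ∑ j, (S - 1) * -c j * rexp (-(l * r j)) = -(S-1) * ∑ j, c j * rexp (-(l * r j)) := by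
      rw [Finset.mul_sum]; exact Finset.sum_congr rfl fun j _ => by ring
    have b4 : ∑ i, (-c i * (S - 1) * rexp (-(l * r i)) + ∑ j, -c i * -c j * rexp (-(l * |r i - r j|)))
        = -(S-1) * (∑ j, c j * rexp (-(l * r j))) + ∑ i, ∑ j, c i * c j * rexp (-(l * |r i - r j|)) := by
      rw [Finset.sum_add_distrib, Finset.mul_sum]
      congr 1
      · exact Finset.sum_congr rfl fun j _ => by ring
      · exact Finset.sum_congr rfl fun j _ => Finset.sum_congr rfl fun j _ => by ring
    have b5 : ∑ i, -c i * rexp (-(l * (u - r i))) = - ∑ i, c i * rexp (-(l * (u - r i))) := by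
      rw [← Finset.sum_neg_distrib]; exact Finset.sum_congr rfl fun j _ => by ring
    rw [b1, b2, b3, b4, b5]
    ring
  rw [← this] at h
  linarith

lemma sp_ker_integrable (H : ℝ) (hH0 : 0 < H) (hH : H < 1 / 2) (t : ℝ) :
    IntegrableOn (fun l : ℝ => (1 - exp (-(l * |t|))) * l ^ (-1 - 2 * H)) (Ioi 0) := by
  have hm : Measurable (fun l : ℝ => (1 - exp (-(l * |t|))) * l ^ (-1 - 2 * H)) := by fun_prop
  rw [← Ioc_union_Ioi_eq_Ioi (zero_le_one' ℝ)]
  refine IntegrableOn.union ?_ ?_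
  · have h1 : IntegrableOn (fun l : ℝ => |t| * l ^ (- 2 * H)) (Ioc 0 1) := by
      have := (intervalIntegral.intervalIntegrable_rpow' (a := 0) (b := 1) (r := -2 * H) (by linarith))
      rw [intervalIntegrable_iff_integrableOn_Ioc_of_le zero_le_one] at this
      exact this.const_mul _
    refine Integrable.mono' h1 hm.aestronglyMeasurable ?_
    refine (ae_restrict_iff' measurableSet_Ioc).2 (Filter.Eventually.of_forall fun l hl => ?_)
    have hl0 : 0 < l := hl.1
    have e1 : exp (-(l * |t|)) ≤ 1 := Real.exp_le_one_iff.2 (by have := mul_nonneg hl0.le (abs_nonneg t); linarith)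
    have e2 := Real.add_one_le_exp (-(l * |t|))
    have e3 : l ^ (-2 * H) = l * l ^ (-1 - 2 * H) := by
      rw [← Real.rpow_one_add' hl0.le (by linarith)]; congr 1; ring
    have e4 : 0 ≤ l ^ (-1 - 2 * H) := Real.rpow_nonneg hl0.le _
    rw [Real.norm_eq_abs, abs_of_nonneg (mul_nonneg (by linarith) e4), e3]
    calc (1 - exp (-(l * |t|))) * l ^ (-1 - 2 * H) ≤ (l * |t|) * l ^ (-1 - 2 * H) :=
          mul_le_mul_of_nonneg_right (by linarith) e4
      _ = _ := by ring
  · have h1 : IntegrableOn (fun l : ℝ => l ^ (-1 - 2 * H)) (Ioi 1) :=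
      integrableOn_Ioi_rpow_of_lt (by linarith) one_pos
    refine Integrable.mono' h1 hm.aestronglyMeasurable ?_
    refine (ae_restrict_iff' measurableSet_Ioi).2 (Filter.Eventually.of_forall fun l hl => ?_)
    have hl0 : 0 < l := lt_trans one_pos hl
    have e1 : exp (-(l * |t|)) ≤ 1 := Real.exp_le_one_iff.2 (by have := mul_nonneg hl0.le (abs_nonneg t); linarith)
    have e2 := Real.exp_pos (-(l * |t|))
    have e4 : 0 ≤ l ^ (-1 - 2 * H) := Real.rpow_nonneg hl0.le _
    rw [Real.norm_eq_abs, abs_of_nonneg (mul_nonneg (by linarith) e4)]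
    calc (1 - exp (-(l * |t|))) * l ^ (-1 - 2 * H) ≤ 1 * l ^ (-1 - 2 * H) :=
          mul_le_mul_of_nonneg_right (by linarith) e4
      _ = _ := by ring

def sp_cH (H : ℝ) : ℝ := ∫ l in Ioi (0:ℝ), (1 - exp (-(l * |(1:ℝ)|))) * l ^ (-1 - 2 * H)

lemma sp_cH_pos (H : ℝ) (hH0 : 0 < H) (hH : H < 1 / 2) : 0 < sp_cH H := by
  unfold sp_cH
  rw [setIntegral_pos_iff_support_of_nonneg_ae]
  · refine lt_of_lt_of_le (?_ : 0 < volume (Ioi (0:ℝ))) (measure_mono ?_)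
    · simp
    · intro l hl
      have hl' : 0 < l := hl
      refine ⟨?_, hl⟩
      simp only [Function.mem_support, abs_one, mul_one]
      have : exp (-l) < 1 := by rw [← Real.exp_zero]; exact Real.exp_lt_exp.2 (by linarith)
      have := Real.rpow_pos_of_pos hl' (-1 - 2 * H)
      exact (mul_pos (by linarith) this).ne'
  · refine (ae_restrict_iff' measurableSet_Ioi).2 (Filter.Eventually.of_forall fun l hl => ?_)
    have hl' : 0 < l := hl
    have : exp (-l) < 1 := by rw [← Real.exp_zero]; exact Real.exp_lt_exp.2 (by linarith)
    have := Real.rpow_pos_of_pos hl' (-1 - 2 * H)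
    simp only [Pi.zero_apply, abs_one, mul_one]
    exact mul_nonneg (by linarith) this.le
  · exact sp_ker_integrable H hH0 hH 1

lemma sp_ker_integral (H : ℝ) (hH0 : 0 < H) (t : ℝ) :
    ∫ l in Ioi (0:ℝ), (1 - exp (-(l * |t|))) * l ^ (-1 - 2 * H) = |t| ^ (2 * H) * sp_cH H := by
  by_cases ht : t = 0
  · subst ht
    simp [Real.zero_rpow (show 2 * H ≠ 0 by linarith)]
  have ht' : 0 < |t| := abs_pos.2 ht
  have h := integral_comp_mul_left_Ioi (fun l : ℝ => (1 - exp (-(l * |(1:ℝ)|))) * l ^ (-1 - 2 * H)) 0 ht'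
  rw [mul_zero] at h
  unfold sp_cH
  have h2 : ∫ l in Ioi (0:ℝ), (1 - exp (-(l * |t|))) * l ^ (-1 - 2 * H) =
      |t| ^ (1 + 2 * H) * ∫ l in Ioi (0:ℝ), (1 - exp (-((|t| * l) * |(1:ℝ)|))) * (|t| * l) ^ (-1 - 2 * H) := by
    rw [← integral_const_mul]
    refine setIntegral_congr_fun measurableSet_Ioi fun l hl => ?_
    have hl' : 0 < l := hl
    simp only [abs_one, mul_one]
    rw [Real.mul_rpow ht'.le hl'.le, mul_comm l |t|]
    have : |t| ^ (1 + 2 * H) * |t| ^ (-1 - 2 * H) = 1 := by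
      rw [← Real.rpow_add ht']; simp
    linear_combination (-(1 - exp (-(|t| * l))) * l ^ (-1 - 2 * H)) * this
  rw [h2, h, smul_eq_mul, ← mul_assoc]
  congr 1
  rw [Real.rpow_add ht', Real.rpow_one]
  field_simp

lemma sp_E_mul {ι : Type*} [Fintype ι] (k : ℝ → ℝ) (a : ℝ) (c r : ι → ℝ) (u : ℝ) :
    sp_E (fun t => k t * a) c r u = sp_E k c r u * a := by
  unfold sp_E
  rw [add_mul, sub_mul, Finset.sum_mul, Finset.sum_mul]
  congr 1
  · congr 1
    exact Finset.sum_congr rfl fun j _ => by ring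
  · refine Finset.sum_congr rfl fun i _ => ?_
    rw [Finset.sum_mul]
    exact Finset.sum_congr rfl fun j _ => by ring

lemma sp_E_int {ι : Type*} [Fintype ι] {α : Type*} [MeasurableSpace α] (ν : Measure α)
    (k : α → ℝ → ℝ) (hk : ∀ t, Integrable (fun l => k l t) ν) (c r : ι → ℝ) (u : ℝ) :
    Integrable (fun l => sp_E (k l) c r u) ν ∧
    ∫ l, sp_E (k l) c r u ∂ν = sp_E (fun t => ∫ l, k l t ∂ν) c r u := by
  unfold sp_E
  have i1 : ∀ j ∈ Finset.univ, Integrable (fun l => c j * (k l u + k l (r j) - k l (u - r j))) ν := fun j _ =>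
    (((hk _).add (hk _)).sub (hk _)).const_mul _
  have i2 : ∀ i, ∀ j ∈ Finset.univ, Integrable (fun l => c i * c j * ((k l (r i) + k l (r j) - k l (r i - r j)) / 2)) ν :=
    fun i j _ => ((((hk _).add (hk _)).sub (hk _)).div_const _).const_mul _
  have i3 : Integrable (fun l => ∑ j, c j * (k l u + k l (r j) - k l (u - r j))) ν :=
    integrable_finsetSum _ i1
  have i4 : ∀ i ∈ Finset.univ, Integrable (fun l => ∑ j, c i * c j * ((k l (r i) + k l (r j) - k l (r i - r j)) / 2)) ν :=
    fun i _ => integrable_finsetSum _ (i2 i)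
  have i5 := integrable_finsetSum _ i4
  refine ⟨((hk u).sub i3).add i5, ?_⟩
  have i6 : ∀ t t', Integrable (fun l => k l t + k l t') ν := fun t t' => (hk t).add (hk t')
  have i7 : Integrable (fun l => k l u - ∑ j, c j * (k l u + k l (r j) - k l (u - r j))) ν := (hk u).sub i3
  rw [integral_add i7 i5, integral_sub (hk u) i3, integral_finsetSum _ i1,
    integral_finsetSum _ i4]
  congr 1
  · congr 1
    refine Finset.sum_congr rfl fun j _ => ?_
    rw [integral_const_mul, integral_sub (i6 _ _) (hk _), integral_add (hk _) (hk _)]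
  · refine Finset.sum_congr rfl fun i _ => ?_
    rw [integral_finsetSum _ (i2 i)]
    refine Finset.sum_congr rfl fun j _ => ?_
    rw [integral_const_mul, integral_div, integral_sub (i6 _ _) (hk _), integral_add (hk _) (hk _)]

/-- Local nondeterminism, deterministic form. -/
lemma sp_E_rpow {ι : Type*} [Fintype ι] (H : ℝ) (hH0 : 0 < H) (hH : H < 1 / 2)
    (c r : ι → ℝ) (s u : ℝ)
    (hr0 : ∀ i, 0 ≤ r i) (hr : ∀ i, r i ≤ s) (hs : 0 ≤ s) (hsu : s ≤ u) :
    (2 * (u - s)) ^ (2 * H) / 2 ≤ sp_E (fun t => |t| ^ (2 * H)) c r u := by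
  have hc := sp_cH_pos H hH0 hH
  obtain ⟨hi, he⟩ := sp_E_int (volume.restrict (Ioi (0:ℝ)))
    (fun l t => (1 - exp (-(l * |t|))) * l ^ (-1 - 2 * H)) (fun t => sp_ker_integrable H hH0 hH t) c r u
  simp_rw [sp_ker_integral H hH0] at he
  rw [sp_E_mul] at he
  have hmono : ∫ l in Ioi (0:ℝ), ((1 - exp (-(l * |2 * (u - s)|))) * l ^ (-1 - 2 * H)) / 2 ≤
      ∫ l in Ioi (0:ℝ), sp_E (fun t => (1 - exp (-(l * |t|))) * l ^ (-1 - 2 * H)) c r u := by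
    refine setIntegral_mono_on ((sp_ker_integrable H hH0 hH _).div_const 2) hi measurableSet_Ioi ?_
    intro l hl
    have hl' : 0 < l := hl
    rw [sp_E_mul]
    have := mul_le_mul_of_nonneg_right (sp_E_ou l hl'.le c r s u hr0 hr hs hsu)
      (Real.rpow_nonneg hl'.le (-1 - 2 * H))
    linarith
  rw [he, integral_div, sp_ker_integral H hH0, abs_of_nonneg (by linarith)] at hmono
  have : (2 * (u - s)) ^ (2 * H) / 2 * sp_cH H ≤ sp_E (fun t => |t| ^ (2 * H)) c r u * sp_cH H := by linarith
  exact le_of_mul_le_mul_right this hc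

theorem sp_gauss_second {Ω : Type*} [MeasurableSpace Ω] {μ : Measure Ω} {f : Ω → ℝ}
    (hf : AEMeasurable f μ) {v : ℝ≥0} (h : μ.map f = gaussianReal 0 v) :
    ∫ ω, f ω ^ 2 ∂μ = v ∧ ∫ ω, f ω ∂μ = 0 := by
  constructor
  · have h1 : ∫ ω, f ω ^ 2 ∂μ = ∫ x, x ^ 2 ∂(μ.map f) := by
      rw [integral_map hf (by fun_prop)]
    rw [h1, h]
    have := variance_fun_id_gaussianReal (μ := 0) (v := v)
    rw [variance_eq_integral (by fun_prop)] at this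
    simpa using this
  · have h1 : ∫ ω, f ω ∂μ = ∫ x, x ∂(μ.map f) := by
      rw [integral_map hf (by fun_prop)]
    rw [h1, h]; simp

theorem sp_gauss_memLp {Ω : Type*} [MeasurableSpace Ω] {μ : Measure Ω} {f : Ω → ℝ}
    (hf : AEMeasurable f μ) {v : ℝ≥0} (h : μ.map f = gaussianReal 0 v) (p : ℝ≥0) :
    MemLp f p μ := by
  have h1 : MemLp (id : ℝ → ℝ) p (μ.map f) := by
    rw [h]; exact memLp_id_gaussianReal p
  exact (memLp_map_measure_iff (by fun_prop) hf).1 h1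

theorem sp_gauss_closed {Ω : Type*} [MeasurableSpace Ω] (μ : Measure Ω) [IsProbabilityMeasure μ] :
    IsClosed {f : Lp ℝ 2 μ | ∃ v : ℝ≥0, μ.map f = gaussianReal 0 v} := by
  rw [← isSeqClosed_iff_isClosed]
  intro f g hf hg
  choose v hv using hf
  have hm : ∀ f : Lp ℝ 2 μ, AEMeasurable f μ := fun f => (Lp.aestronglyMeasurable f).aemeasurable
  have hn : ∀ f : Lp ℝ 2 μ, ‖f‖ ^ 2 = ∫ ω, f ω ^ 2 ∂μ := by
    intro f
    rw [← real_inner_self_eq_norm_sq, L2.inner_def]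
    congr 1; ext ω; simp [sq]
  have hvn : ∀ n, (v n : ℝ) = ‖f n‖ ^ 2 := fun n => by
    rw [hn, (sp_gauss_second (hm _) (hv n)).1]
  have hvlim : Filter.Tendsto (fun n => (v n : ℝ)) Filter.atTop (nhds (‖g‖ ^ 2)) := by
    simp_rw [hvn]
    exact (hg.norm).pow 2
  refine ⟨‖g‖₊ ^ 2, ?_⟩
  obtain ⟨φ, hφ, hae⟩ := (tendstoInMeasure_of_tendsto_Lp hg).exists_seq_tendsto_ae
  have : IsProbabilityMeasure (μ.map g) := Measure.isProbabilityMeasure_map (hm g)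
  apply Measure.ext_of_charFun
  ext t
  have e1 : ∀ f : Lp ℝ 2 μ, charFun (μ.map f) t = ∫ ω, Complex.exp (t * f ω * Complex.I) ∂μ := by
    intro f
    rw [charFun_apply_real, integral_map (hm f)]
    fun_prop
  rw [charFun_gaussianReal]
  have l1 : Filter.Tendsto (fun n => charFun (μ.map (f (φ n))) t) Filter.atTop
      (nhds (charFun (μ.map g) t)) := by
    simp_rw [e1]
    apply tendsto_integral_of_dominated_convergence (fun _ => (1 : ℝ))
    · intro n
      have := hm (f (φ n))
      have : AEMeasurable (fun ω => Complex.exp (t * f (φ n) ω * Complex.I)) μ := by fun_prop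
      exact this.aestronglyMeasurable
    · simp
    · intro n
      filter_upwards with ω
      rw [show (t * f (φ n) ω * Complex.I : ℂ) = ((t * f (φ n) ω : ℝ) : ℂ) * Complex.I by push_cast; ring]
      rw [Complex.norm_exp_ofReal_mul_I]
    · filter_upwards [hae] with ω hω
      have : Continuous fun x : ℝ => Complex.exp (t * x * Complex.I) := by fun_prop
      exact (this.tendsto _).comp hω
  have l2 : Filter.Tendsto (fun n => charFun (μ.map (f (φ n))) t) Filter.atTop
      (nhds (Complex.exp (t * (0:ℝ) * Complex.I - (‖g‖ ^ 2 : ℝ) * t ^ 2 / 2))) := by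
    simp_rw [hv, charFun_gaussianReal]
    have : Continuous fun x : ℝ => Complex.exp (t * (0:ℝ) * Complex.I - x * t ^ 2 / 2) := by fun_prop
    have h3 := (this.tendsto (‖g‖^2)).comp (hvlim.comp hφ.tendsto_atTop)
    exact h3
  rw [tendsto_nhds_unique l1 l2]
  simp

theorem sp_fbm_single {Ω : Type*} [MeasurableSpace Ω] {μ : Measure Ω} {H : ℝ} {B : ℝ → Ω → ℝ}
    (hB : IsFBM μ H B) (t : ℝ) : ∃ v : ℝ≥0, μ.map (B t) = gaussianReal 0 v := by
  obtain ⟨v, hv⟩ := hB.gaussian 1 (fun _ => t) (fun _ => 1)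
  refine ⟨v, ?_⟩
  rw [← hv]; simp

theorem sp_fbm_memLp {Ω : Type*} [MeasurableSpace Ω] {μ : Measure Ω} {H : ℝ} {B : ℝ → Ω → ℝ}
    (hB : IsFBM μ H B) (t : ℝ) : MemLp (B t) 2 μ := by
  obtain ⟨v, hv⟩ := sp_fbm_single hB t
  exact sp_gauss_memLp (hB.meas t).aemeasurable hv 2

theorem sp_closure_meas {Ω : Type*} {m m0 : MeasurableSpace Ω} (hm : m ≤ m0) {μ : Measure Ω}
    (S : Set (Lp ℝ 2 μ)) (h : ∀ f ∈ S, AEStronglyMeasurable[m] f μ) :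
    ∀ f ∈ (Submodule.span ℝ S).topologicalClosure, ∃ Y : Ω → ℝ, Measurable[m] Y ∧ f =ᵐ[μ] Y := by
  intro f hf
  have h1 : Submodule.span ℝ S ≤ lpMeas ℝ ℝ m 2 μ := by
    rw [Submodule.span_le]
    intro f hf
    exact mem_lpMeas_iff_aestronglyMeasurable.2 (h f hf)
  have : closure (Submodule.span ℝ S : Set (Lp ℝ 2 μ)) ⊆
      {f : Lp ℝ 2 μ | AEStronglyMeasurable[m] f μ} := by
    apply closure_minimal _ (isClosed_aestronglyMeasurable hm)
    intro g hg
    exact mem_lpMeas_iff_aestronglyMeasurable.1 (h1 hg)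
  obtain ⟨Y, h1, h2⟩ := this hf
  exact ⟨Y, h1.measurable, h2⟩

theorem sp_dec_B {Ω : Type*} [MeasurableSpace Ω] {μ : Measure Ω} [IsProbabilityMeasure μ]
    {H : ℝ} (hH0 : 0 < H) (hH : H < 1 / 2) {B : ℝ → Ω → ℝ} (hB : IsFBM μ H B)
    {s u : ℝ} (hs : 0 ≤ s) (hsu : s ≤ u) :
    ∃ (Y R : Ω → ℝ) (v : ℝ≥0),
      Measurable[MeasurableSpace.comap (fun ω (r : Icc (0:ℝ) s) => B r ω) inferInstance] Y ∧
      Measurable R ∧ (∀ ω, B u ω = Y ω + R ω) ∧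
      IndepFun R (fun ω (r : Icc (0:ℝ) s) => B r ω) μ ∧
      μ.map R = gaussianReal 0 v ∧ (2 * (u - s)) ^ (2 * H) / 2 ≤ v := by
  let bt : ℝ → Lp ℝ 2 μ := fun t => (sp_fbm_memLp hB t).toLp
  have hbt : ∀ t, bt t =ᵐ[μ] B t := fun t => MemLp.coeFn_toLp _
  have hmeas : Measurable (fun ω (r : Icc (0:ℝ) s) => B r ω) :=
    measurable_pi_lambda _ fun r => hB.meas r
  have hm := hmeas.comap_le
  let V0 := Submodule.span ℝ (Set.image bt (Icc 0 s))
  let V := V0.topologicalClosure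
  let G := (Submodule.span ℝ (range bt)).topologicalClosure
  have hVG : V ≤ G := Submodule.topologicalClosure_mono (Submodule.span_mono (image_subset_range _ _))
  have hbG : ∀ t, bt t ∈ G := fun t =>
    Submodule.le_topologicalClosure _ (Submodule.subset_span (mem_range_self t))
  have hbV : ∀ t ∈ Icc 0 s, bt t ∈ V := fun t ht =>
    Submodule.le_topologicalClosure _ (Submodule.subset_span (mem_image_of_mem _ ht))
  -- Gaussianity of G
  have hG : ∀ f ∈ G, ∃ v : ℝ≥0, μ.map f = gaussianReal 0 v := by
    intro f hf
    have : closure (Submodule.span ℝ (range bt) : Set (Lp ℝ 2 μ)) ⊆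
        {f : Lp ℝ 2 μ | ∃ v : ℝ≥0, μ.map f = gaussianReal 0 v} := by
      apply closure_minimal _ (sp_gauss_closed μ)
      intro g hg
      obtain ⟨n, c, b, rfl⟩ := Submodule.mem_span_set'.1 hg
      choose t ht using fun i => (b i).2
      obtain ⟨v, hv⟩ := hB.gaussian n t c
      refine ⟨v, ?_⟩
      rw [← hv]
      apply Measure.map_congr
      have h1 := Lp.coeFn_finsetSum (s := Finset.univ) (fun i => c i • (b i : Lp ℝ 2 μ))
      have h2 : ∀ i, (c i • (b i : Lp ℝ 2 μ) : Lp ℝ 2 μ) =ᵐ[μ] fun ω => c i * B (t i) ω := by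
        intro i
        filter_upwards [Lp.coeFn_smul (c i) (b i : Lp ℝ 2 μ), hbt (t i)] with ω h1 h2
        rw [h1, Pi.smul_apply, ← ht i, h2, smul_eq_mul]
      filter_upwards [h1, ae_all_iff.2 h2] with ω h1 h2
      rw [h1]; simp [h2]
    exact this hf
  have hVm := sp_closure_meas hm (μ := μ) (Set.image bt (Icc 0 s)) (by
    rintro _ ⟨r, hr, rfl⟩
    refine ⟨B r, ?_, hbt r⟩
    apply Measurable.stronglyMeasurable
    have h1 : B r = (fun f : Icc (0:ℝ) s → ℝ => f ⟨r, hr⟩) ∘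
      (fun ω (r : Icc (0:ℝ) s) => B r ω) := rfl
    rw [h1]
    exact (measurable_pi_apply _).comp (comap_measurable _))
  have hinn : ∀ a b, 0 ≤ a → 0 ≤ b → inner ℝ (bt a) (bt b) =
      (a ^ (2 * H) + b ^ (2 * H) - |a - b| ^ (2 * H)) / 2 := by
    intro a b ha hb
    rw [← hB.cov b a hb ha, L2.inner_def]
    apply integral_congr_ae
    filter_upwards [hbt a, hbt b] with ω h1 h2
    simp [h1, h2, mul_comm]
  have hu : 0 ≤ u := hs.trans hsu
  have hlow : ∀ w ∈ V, (2 * (u - s)) ^ (2 * H) / 2 ≤ ‖bt u - w‖ ^ 2 := by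
    intro f hf
    have : closure (V0 : Set (Lp ℝ 2 μ)) ⊆ {w : Lp ℝ 2 μ | (2 * (u - s)) ^ (2 * H) / 2 ≤ ‖bt u - w‖ ^ 2} := by
      apply closure_minimal _ (isClosed_le (by fun_prop) (by fun_prop))
      intro g hg
      obtain ⟨n, c, b, rfl⟩ := Submodule.mem_span_set'.1 hg
      choose t ht1 ht using fun i => (b i).2
      have := sp_E_rpow H hH0 hH c t s u (fun i => (ht1 i).1) (fun i => (ht1 i).2) hs hsu
      refine this.trans (le_of_eq ?_)
      simp_rw [← ht]
      rw [norm_sub_sq_real, ← real_inner_self_eq_norm_sq, ← real_inner_self_eq_norm_sq]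
      simp_rw [sum_inner, inner_sum, inner_smul_left, inner_smul_right]
      rw [hinn u u hu hu]
      simp_rw [hinn u _ hu (ht1 _).1, hinn _ _ (ht1 _).1 (ht1 _).1]
      simp only [sp_E, abs_of_nonneg hu, sub_self, abs_zero, abs_of_nonneg (ht1 _).1]
      rw [zero_rpow (by positivity)]
      simp only [Finset.mul_sum, conj_trivial]
      congr 1
      · congr 1
        · ring
        · refine Finset.sum_congr rfl fun i _ => by ring
      · refine Finset.sum_congr rfl fun i _ => Finset.sum_congr rfl fun j _ => by ring
    exact this hf
  let y : Lp ℝ 2 μ := V.starProjection (bt u)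
  have hyV : y ∈ V := Submodule.starProjection_apply_mem V _
  obtain ⟨Y, hYm', hY⟩ := hVm y hyV
  have hYM : Measurable Y := hYm'.mono hm le_rfl
  have hRG : bt u - y ∈ G := G.sub_mem (hbG u) (hVG hyV)
  have hRae : (fun ω => B u ω - Y ω) =ᵐ[μ] (bt u - y : Lp ℝ 2 μ) := by
    filter_upwards [Lp.coeFn_sub (bt u) y, hbt u, hY] with ω h1 h2 h3
    rw [h1, Pi.sub_apply, h2, h3]
  have hRm : Measurable (fun ω => B u ω - Y ω) := (hB.meas u).sub hYM
  obtain ⟨v, hv⟩ := hG _ hRG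
  have hv' : μ.map (fun ω => B u ω - Y ω) = gaussianReal 0 v := by
    rw [← hv]; exact Measure.map_congr hRae
  refine ⟨Y, fun ω => B u ω - Y ω, v, hYm', hRm, fun ω => by ring, ?_, hv', ?_⟩
  · have key := IsGaussianProcess.indepFun_of_covariance_eq_zero (P := μ)
      (X := fun (_ : Unit) ω => B u ω - Y ω) (Y := fun (r : Icc (0:ℝ) s) => B r) ?_ ?_ ?_ ?_
    · exact key.comp (φ := fun f : Unit → ℝ => f ()) (ψ := id) (measurable_pi_apply (X := fun _ : Unit => ℝ) ()) measurable_id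
    · have hel : ∀ i : Unit ⊕ Icc (0:ℝ) s, ∃ g ∈ G, Sum.elim (fun (_ : Unit) ω => B u ω - Y ω)
          (fun (r : Icc (0:ℝ) s) => B r) i =ᵐ[μ] (g : Lp ℝ 2 μ) := by
        rintro (i | i)
        · exact ⟨_, hRG, hRae⟩
        · exact ⟨_, hbG i, (hbt i).symm⟩
      choose g hgG hg using hel
      refine ⟨fun I => ⟨isGaussian_of_map_eq_gaussianReal fun L => ?_⟩⟩
      let c : I → ℝ := fun i => L (Pi.single i 1)
      have hgg : ∑ i : I, c i • g i ∈ G := G.sum_mem fun i _ => G.smul_mem _ (hgG i)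
      obtain ⟨v, hv⟩ := hG _ hgg
      refine ⟨0, v, ?_⟩
      have hmm : ∀ i, Measurable (Sum.elim (fun (_ : Unit) ω => B u ω - Y ω)
          (fun (r : Icc (0:ℝ) s) => B r) i) := by
        rintro (i | i)
        · exact hRm
        · exact hB.meas i
      have hrm : Measurable (fun ω => I.restrict fun x => Sum.elim (fun (_ : Unit) ω => B u ω - Y ω)
          (fun (r : Icc (0:ℝ) s) => B r) x ω) := measurable_pi_lambda _ fun i => hmm i
      rw [← hv, Measure.map_map L.continuous.measurable hrm]
      apply Measure.map_congr
      have h1 := Lp.coeFn_finsetSum (s := Finset.univ) (fun i : I => c i • g i)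
      have h2 : ∀ i : I, (c i • g i : Lp ℝ 2 μ) =ᵐ[μ] fun ω => c i * g i ω := by
        intro i
        filter_upwards [Lp.coeFn_smul (c i) (g i)] with ω h1
        rw [h1, Pi.smul_apply, smul_eq_mul]
      filter_upwards [h1, ae_all_iff.2 h2, ae_all_iff.2 fun i : I => hg i] with ω h1 h2 h3
      rw [h1]
      simp only [Finset.sum_apply, h2, Function.comp]
      simp_rw [← h3]
      have h4 := LinearMap.pi_apply_eq_sum_univ L.toLinearMap
        (I.restrict fun x => Sum.elim (fun (_ : Unit) ω => B u ω - Y ω)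
          (fun (r : Icc (0:ℝ) s) => B r) x ω)
      refine h4.trans (Finset.sum_congr rfl fun i _ => ?_)
      rw [smul_eq_mul, mul_comm]
      congr 1
      refine congrArg L ?_
      ext j
      simp [Pi.single_apply, eq_comm]
    · exact fun _ => hRm.aemeasurable
    · exact fun r => (hB.meas r).aemeasurable
    · intro _ r
      have hR2 : MemLp (fun ω => B u ω - Y ω) 2 μ := sp_gauss_memLp hRm.aemeasurable hv' 2
      rw [covariance_eq_sub hR2 (sp_fbm_memLp hB _)]
      rw [(sp_gauss_second hRm.aemeasurable hv').2, zero_mul, sub_zero]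
      have : inner ℝ (bt u - y) (bt r) = 0 := Submodule.starProjection_inner_eq_zero _ _ (hbV _ r.2)
      refine Eq.trans ?_ this
      rw [L2.inner_def]
      apply integral_congr_ae
      filter_upwards [hRae, hbt r] with ω h1 h2
      rw [← h1, h2]
      simp [mul_comm]
  · refine (hlow y hyV).trans (le_of_eq ?_)
    rw [← (sp_gauss_second hRm.aemeasurable hv').1, ← real_inner_self_eq_norm_sq, L2.inner_def]
    apply integral_congr_ae
    filter_upwards [hRae] with ω h1
    rw [← h1]
    simp [sq]

/-- The enlarged filtration: the past of `B`, all of `W`, and all null sets. -/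
def sp_F {Ω : Type*} [MeasurableSpace Ω] (μ : Measure Ω) (B W : ℝ → Ω → ℝ) (s : ℝ) :
    MeasurableSpace Ω :=
  eventuallyMeasurableSpace
    (MeasurableSpace.comap (fun ω => ((fun r : Icc (0:ℝ) s => B r ω), (fun t : ℝ => W t ω)))
      inferInstance) (ae μ)

theorem sp_F0_meas {Ω : Type*} [MeasurableSpace Ω] {B W : ℝ → Ω → ℝ} (hB : ∀ t, Measurable (B t))
    (hW : ∀ t, Measurable (W t)) (s : ℝ) :
    Measurable (fun ω => ((fun r : Icc (0:ℝ) s => B r ω), (fun t : ℝ => W t ω))) :=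
  Measurable.prodMk (measurable_pi_lambda _ fun r => hB _) (measurable_pi_lambda _ fun r => hW r)

theorem sp_F_le {Ω : Type*} [MeasurableSpace Ω] {μ : Measure Ω} (hμc : μ.IsComplete)
    {B W : ℝ → Ω → ℝ} (hB : ∀ t, Measurable (B t))
    (hW : ∀ t, Measurable (W t)) (s : ℝ) : sp_F μ B W s ≤ ‹MeasurableSpace Ω› := by
  rintro A ⟨A', hA', h⟩
  have h1 : MeasurableSet A' := (sp_F0_meas hB hW s).comap_le _ hA'
  exact (NullMeasurableSet.congr h1.nullMeasurableSet h.symm).measurable_of_complete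

theorem sp_F_null {Ω : Type*} [MeasurableSpace Ω] {μ : Measure Ω}
    {B W : ℝ → Ω → ℝ} (s : ℝ) {A : Set Ω} (hA : μ A = 0) : MeasurableSet[sp_F μ B W s] A :=
  ⟨∅, @MeasurableSet.empty _ (_), ae_eq_empty.2 hA⟩

theorem sp_F_B {Ω : Type*} [MeasurableSpace Ω] {μ : Measure Ω}
    {B W : ℝ → Ω → ℝ} (s : ℝ) {r : ℝ} (hr : r ∈ Icc 0 s) : Measurable[sp_F μ B W s] (B r) := by
  have h1 : B r = (fun p : (Icc (0:ℝ) s → ℝ) × (ℝ → ℝ) => p.1 ⟨r, hr⟩) ∘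
      (fun ω => ((fun r : Icc (0:ℝ) s => B r ω), (fun t : ℝ => W t ω))) := rfl
  have h2 : Measurable (fun p : (Icc (0:ℝ) s → ℝ) × (ℝ → ℝ) => p.1 ⟨r, hr⟩) :=
    (measurable_pi_apply _).comp measurable_fst
  have h3 := h2.comp (comap_measurable
    (fun ω => ((fun r : Icc (0:ℝ) s => B r ω), (fun t : ℝ => W t ω))))
  exact h3.mono le_eventuallyMeasurableSpace le_rfl

theorem sp_F_W {Ω : Type*} [MeasurableSpace Ω] {μ : Measure Ω}
    {B W : ℝ → Ω → ℝ} (s r : ℝ) : Measurable[sp_F μ B W s] (W r) := by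
  have h2 : Measurable (fun p : (Icc (0:ℝ) s → ℝ) × (ℝ → ℝ) => p.2 r) :=
    (measurable_pi_apply _).comp measurable_snd
  have h3 := h2.comp (comap_measurable
    (fun ω => ((fun r : Icc (0:ℝ) s => B r ω), (fun t : ℝ => W t ω))))
  exact h3.mono le_eventuallyMeasurableSpace le_rfl

theorem sp_F_mono {Ω : Type*} [MeasurableSpace Ω] {μ : Measure Ω}
    {B W : ℝ → Ω → ℝ} {s t : ℝ} (hst : s ≤ t) : sp_F μ B W s ≤ sp_F μ B W t := by
  rintro A ⟨A', hA', h⟩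
  refine ⟨A', ?_, h⟩
  revert hA'
  have : MeasurableSpace.comap (fun ω => ((fun r : Icc (0:ℝ) s => B r ω), (fun t : ℝ => W t ω)))
      inferInstance ≤ MeasurableSpace.comap
        (fun ω => ((fun r : Icc (0:ℝ) t => B r ω), (fun t : ℝ => W t ω))) inferInstance := by
    have h1 : (fun ω => ((fun r : Icc (0:ℝ) s => B r ω), (fun t : ℝ => W t ω))) =
      (fun p : (Icc (0:ℝ) t → ℝ) × (ℝ → ℝ) =>
        ((fun r : Icc (0:ℝ) s => p.1 ⟨r, r.2.1, r.2.2.trans hst⟩), p.2)) ∘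
        (fun ω => ((fun r : Icc (0:ℝ) t => B r ω), (fun t : ℝ => W t ω))) := rfl
    rw [h1, ← MeasurableSpace.comap_comp]
    apply MeasurableSpace.comap_mono
    apply Measurable.comap_le
    refine Measurable.prodMk (measurable_pi_lambda _ fun r => ?_) measurable_snd
    exact (measurable_pi_apply _).comp measurable_fst
  exact this A'

theorem sp_aug_le {Ω : Type*} [MeasurableSpace Ω] {μ : Measure Ω}
    {B W : ℝ → Ω → ℝ} (t : ℝ) : augPairFiltration μ B W t ≤ sp_F μ B W t := by
  refine sup_le (iSup₂_le fun s hs => sup_le ?_ ?_) (MeasurableSpace.generateFrom_le ?_)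
  · exact (sp_F_B t hs).comap_le
  · exact (sp_F_W t s).comap_le
  · intro A hA; exact sp_F_null t hA

theorem sp_indep3 {Ω α β γ : Type*} [MeasurableSpace Ω] [MeasurableSpace α] [MeasurableSpace β]
    [MeasurableSpace γ] {μ : Measure Ω} [IsProbabilityMeasure μ]
    {R : Ω → α} {P : Ω → β} {Q : Ω → γ} (hR : Measurable R) (hP : Measurable P) (hQ : Measurable Q)
    (h1 : IndepFun R P μ) (h2 : IndepFun (fun ω => (R ω, P ω)) Q μ) :
    IndepFun R (fun ω => (P ω, Q ω)) μ := by
  have h3 : IndepFun P Q μ := h2.comp measurable_snd measurable_id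
  rw [indepFun_iff_map_prod_eq_prod_map_map hR.aemeasurable (hP.prodMk hQ).aemeasurable]
  rw [(indepFun_iff_map_prod_eq_prod_map_map hP.aemeasurable hQ.aemeasurable).1 h3]
  have h4 := (indepFun_iff_map_prod_eq_prod_map_map (hR.prodMk hP).aemeasurable hQ.aemeasurable).1 h2
  rw [(indepFun_iff_map_prod_eq_prod_map_map hR.aemeasurable hP.aemeasurable).1 h1] at h4
  have i1 : IsProbabilityMeasure (μ.map R) := Measure.isProbabilityMeasure_map hR.aemeasurable
  have i2 : IsProbabilityMeasure (μ.map P) := Measure.isProbabilityMeasure_map hP.aemeasurable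
  have i3 : IsProbabilityMeasure (μ.map Q) := Measure.isProbabilityMeasure_map hQ.aemeasurable
  rw [← Measure.prodAssoc_prod, ← h4, Measure.map_map (by fun_prop) (by fun_prop)]
  rfl

/-- Decomposition of `Z = ρ₁ B + ρ₂ W` at time `u` given the past at `s`. -/
theorem sp_dec {Ω : Type*} [MeasurableSpace Ω] {μ : Measure Ω} [IsProbabilityMeasure μ]
    {H : ℝ} (hH0 : 0 < H) (hH : H < 1 / 2) {B W : ℝ → Ω → ℝ} (hB : IsFBM μ H B)
    (hW : ∀ t, Measurable (W t))
    (hindep : IndepFun (fun ω => fun t : ℝ => B t ω) (fun ω => fun t : ℝ => W t ω) μ)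
    (ρ₁ ρ₂ : ℝ)
    {s u : ℝ} (hs : 0 ≤ s) (hsu : s ≤ u) :
    ∃ (Y R : Ω → ℝ) (v : ℝ≥0), Measurable[sp_F μ B W s] Y ∧
      Measurable R ∧ (∀ ω, ρ₁ * B u ω + ρ₂ * W u ω = Y ω + R ω) ∧
      Indep (MeasurableSpace.comap R inferInstance) (sp_F μ B W s) μ ∧
      μ.map R = gaussianReal 0 v ∧ ρ₁ ^ 2 / 2 * (u - s) ^ (2 * H) ≤ v := by
  obtain ⟨Y, R, v, hY, hR, hYR, hind, hlaw, hv⟩ := sp_dec_B hH0 hH hB hs hsu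
  have hPm : Measurable (fun ω (r : Icc (0:ℝ) s) => B r ω) :=
    measurable_pi_lambda _ fun r => hB.meas r
  have hWm : Measurable (fun ω (r : ℝ) => W r ω) := measurable_pi_lambda _ fun r => hW r
  -- Y as a function of the path
  obtain ⟨g, hg, hgY⟩ := hY.exists_eq_measurable_comp
  have hRP : IndepFun (fun ω => (R ω, fun (r : Icc (0:ℝ) s) => B r ω))
      (fun ω => fun t : ℝ => W t ω) μ := by
    have h1 : (fun ω => (R ω, fun (r : Icc (0:ℝ) s) => B r ω)) =
        (fun p : ℝ → ℝ => (p u - g (fun (r : Icc (0:ℝ) s) => p r), fun (r : Icc (0:ℝ) s) => p r)) ∘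
        (fun ω => fun t : ℝ => B t ω) := by
      ext ω
      · have := congrFun hgY ω
        simp only [Function.comp] at this ⊢
        rw [← this, hYR]; ring
      · rfl
    rw [h1]
    refine hindep.comp ?_ measurable_id
    have h2 : Measurable (fun (p : ℝ → ℝ) (r : Icc (0:ℝ) s) => p r) :=
      measurable_pi_lambda _ fun r => measurable_pi_apply _
    exact ((measurable_pi_apply u).sub (hg.comp h2)).prodMk h2
  have hI := sp_indep3 hR hPm hWm hind hRP
  refine ⟨fun ω => ρ₁ * Y ω + ρ₂ * W u ω, fun ω => ρ₁ * R ω, Real.toNNReal (ρ₁ ^ 2) * v, ?_, ?_, ?_,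
    ?_, ?_, ?_⟩
  · refine Measurable.add (Measurable.const_mul ?_ _) ((sp_F_W s u).const_mul _)
    refine hY.mono ?_ le_rfl
    refine le_trans ?_ le_eventuallyMeasurableSpace
    have h1 : (fun ω (r : Icc (0:ℝ) s) => B r ω) = Prod.fst ∘
      (fun ω => ((fun r : Icc (0:ℝ) s => B r ω), (fun t : ℝ => W t ω))) := rfl
    conv_lhs => rw [h1, ← MeasurableSpace.comap_comp]
    exact MeasurableSpace.comap_mono measurable_fst.comap_le
  · exact hR.const_mul _
  · intro ω; rw [hYR]; ring
  · rw [Indep_iff]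
    rintro t1 t2 ⟨A, hA, rfl⟩ ⟨t2', ht2', h⟩
    have h3 : μ ((fun ω => ρ₁ * R ω) ⁻¹' A ∩ t2) = μ ((fun ω => ρ₁ * R ω) ⁻¹' A ∩ t2') :=
      measure_congr (Filter.EventuallyEq.inter (Filter.EventuallyEq.refl _ _) h)
    rw [h3, measure_congr h]
    have h4 : IndepFun (fun ω => ρ₁ * R ω)
        (fun ω => ((fun r : Icc (0:ℝ) s => B r ω), (fun t : ℝ => W t ω))) μ :=
      hI.comp (φ := fun x => ρ₁ * x) (measurable_const_mul _) measurable_id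
    exact (Indep_iff _ _ _).1 h4 _ _ ⟨A, hA, rfl⟩ ht2'
  · have h5 : (fun ω => ρ₁ * R ω) = (fun x => ρ₁ * x) ∘ R := rfl
    rw [h5, ← Measure.map_map (measurable_const_mul _) hR, hlaw, gaussianReal_map_const_mul]
    congr 1
    · simp
    · congr 1
      ext; simp [sq_nonneg]
  · have h6 : (u - s) ^ (2 * H) ≤ (2 * (u - s)) ^ (2 * H) := by
      apply rpow_le_rpow <;> linarith
    push_cast
    rw [Real.coe_toNNReal _ (sq_nonneg _)]
    have := mul_le_mul_of_nonneg_left (show (u-s)^(2*H)/2 ≤ v by linarith) (sq_nonneg ρ₁)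
    linarith

theorem sp_exp_gauss (v : ℝ≥0) (t : ℝ) :
    Integrable (fun r => exp (t * r)) (gaussianReal 0 v) ∧
    ∫ r, exp (t * r) ∂(gaussianReal 0 v) = exp (v * t ^ 2 / 2) := by
  refine ⟨integrable_exp_mul_gaussianReal t, ?_⟩
  have := congrFun (mgf_id_gaussianReal (μ := 0) (v := v)) t
  simpa [mgf] using this

theorem sp_shift {v : ℝ≥0} (hv : v ≠ 0) {f : ℝ → ℝ} (hf : Measurable f) (a : ℝ) :
    ∫ r, f (a + r) ∂(gaussianReal 0 v) =
      ∫ r, f r * exp (a / v * r - a ^ 2 / (2 * v)) ∂(gaussianReal 0 v) := by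
  have h1 : ∫ r, f (a + r) ∂(gaussianReal 0 v) = ∫ r, f r ∂((gaussianReal 0 v).map (a + ·)) := by
    rw [integral_map (by fun_prop) hf.aestronglyMeasurable]
  rw [h1, gaussianReal_map_const_add, integral_gaussianReal_eq_integral_smul hv,
    integral_gaussianReal_eq_integral_smul hv]
  congr 1
  ext x
  simp only [gaussianPDFReal, smul_eq_mul, zero_add, sub_zero]
  have hv' : (v : ℝ) ≠ 0 := by exact_mod_cast hv
  have : exp (-(x - a) ^ 2 / (2 * v)) = exp (-x ^ 2 / (2 * v)) * exp (a / v * x - a ^ 2 / (2 * v)) := by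
    rw [← exp_add]; congr 1; field_simp; ring
  rw [this]; ring

theorem sp_smooth1_aux {v : ℝ≥0} (hv : v ≠ 0) {f : ℝ → ℝ} (hf : Measurable f) {M : ℝ}
    (hM : ∀ x, |f x| ≤ M) (a : ℝ) :
    |∫ r, f (a + r) ∂(gaussianReal 0 v) - ∫ r, f r ∂(gaussianReal 0 v)| ≤ 2 * M * (|a| / √v) := by
  have hM0 : 0 ≤ M := (abs_nonneg _).trans (hM 0)
  have hv' : (0 : ℝ) < v := by positivity
  have hfi : ∀ b, Integrable (fun r => f (b + r)) (gaussianReal 0 v) := fun b =>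
    Integrable.of_bound (Measurable.aestronglyMeasurable (by fun_prop)) M (by filter_upwards with r; exact hM _)
  have hb : ∀ b, |∫ r, f (b + r) ∂(gaussianReal 0 v)| ≤ M := fun b => by
    have := norm_integral_le_of_norm_le_const (μ := gaussianReal 0 v) (f := fun r => f (b + r))
      (C := M) (by filter_upwards with r; exact hM _)
    simpa using this
  have hb0 := hb 0
  simp only [zero_add] at hb0
  by_cases hd : √v ≤ |a|
  · have : 1 ≤ |a| / √v := by rw [one_le_div (by positivity)]; exact hd
    calc _ ≤ |∫ r, f (a + r) ∂(gaussianReal 0 v)| + |∫ r, f r ∂(gaussianReal 0 v)| := abs_sub _ _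
      _ ≤ 2 * M := by linarith [hb a]
      _ ≤ _ := by nlinarith
  push Not at hd
  by_cases ha : a = 0
  · simp [ha]
  set d := |a| / √v with hd0
  have hdpos : 0 < d := by positivity
  have hd1 : d < 1 := by rw [hd0, div_lt_one (by positivity)]; exact hd
  have hd2 : a ^ 2 / v = d ^ 2 := by rw [hd0, div_pow, sq_abs, sq_sqrt hv'.le]
  set e : ℝ → ℝ := fun r => exp (a / v * r - a ^ 2 / (2 * v)) with he
  have he1 : ∀ r, e r = exp (a / v * r) * exp (- (a ^ 2 / (2 * v))) := fun r => by
    rw [he, ← exp_add]; rfl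
  have he2 : ∀ r, e r ^ 2 = exp (2 * a / v * r) * exp (- (a ^ 2 / v)) := fun r => by
    rw [he1, mul_pow, ← exp_nat_mul, ← exp_nat_mul]; congr 2
    · push_cast; ring
    · push_cast; field_simp
  have i1 : Integrable e (gaussianReal 0 v) := by
    rw [show e = _ from funext he1]; exact (sp_exp_gauss v (a/v)).1.mul_const _
  have i2 : Integrable (fun r => e r ^ 2) (gaussianReal 0 v) := by
    rw [show (fun r => e r ^ 2) = _ from funext he2]; exact (sp_exp_gauss v _).1.mul_const _
  have v1 : ∫ r, e r ∂(gaussianReal 0 v) = 1 := by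
    simp_rw [he1]; rw [integral_mul_const, (sp_exp_gauss v _).2, ← exp_add, exp_eq_one_iff]
    field_simp; ring
  have v2 : ∫ r, e r ^ 2 ∂(gaussianReal 0 v) = exp (d ^ 2) := by
    simp_rw [he2]; rw [integral_mul_const, (sp_exp_gauss v _).2, ← exp_add, ← hd2]
    congr 1
    field_simp; ring
  have key : ∫ r, f (a + r) ∂(gaussianReal 0 v) - ∫ r, f r ∂(gaussianReal 0 v) =
      ∫ r, f r * (e r - 1) ∂(gaussianReal 0 v) := by
    rw [sp_shift hv hf]
    have hfi0 := hfi 0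
    simp only [zero_add] at hfi0
    have i3 : Integrable (fun r => f r * e r) (gaussianReal 0 v) :=
      i1.bdd_mul (c := M) hf.aestronglyMeasurable (by filter_upwards with r; exact hM r)
    rw [← integral_sub i3 hfi0]
    congr 1; ext r; ring
  rw [key]
  have i4 : Integrable (fun r => M * ((d ^ 2 + (e r ^ 2 - 2 * e r + 1)) / (2 * d))) (gaussianReal 0 v) :=
    (((integrable_const _).add ((i2.sub (i1.const_mul 2)).add (integrable_const _))).div_const _).const_mul _
  have hpt : ∀ r, ‖f r * (e r - 1)‖ ≤ M * ((d ^ 2 + (e r ^ 2 - 2 * e r + 1)) / (2 * d)) := by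
    intro r
    rw [norm_mul]
    apply mul_le_mul (hM r) _ (norm_nonneg _) hM0
    rw [le_div_iff₀ (by positivity), Real.norm_eq_abs]
    nlinarith [sq_nonneg (d - |e r - 1|), sq_abs (e r - 1)]
  refine (norm_integral_le_of_norm_le i4 (Filter.Eventually.of_forall hpt)).trans ?_
  rw [integral_const_mul, integral_div, integral_add (integrable_const _) (by fun_prop),
    integral_add (by fun_prop) (integrable_const _), integral_sub i2 (i1.const_mul 2),
    integral_const_mul, v1, v2]
  simp only [integral_const, probReal_univ, one_smul]
  have hexp : exp (d ^ 2) ≤ 1 + 2 * d ^ 2 := by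
    have h0 : |d ^ 2| ≤ 1 := by rw [abs_of_nonneg (by positivity)]; nlinarith
    have := Real.abs_exp_sub_one_le h0
    rw [abs_of_nonneg (by positivity : (0:ℝ) ≤ d^2)] at this
    linarith [le_abs_self (exp (d^2) - 1)]
  have : (d ^ 2 + (exp (d ^ 2) - 2 * 1 + 1)) / (2 * d) ≤ 2 * d := by
    rw [div_le_iff₀ (by positivity)]; nlinarith
  calc _ ≤ M * (2 * d) := mul_le_mul_of_nonneg_left this hM0
    _ = _ := by ring

/-- First order Gaussian smoothing. -/
theorem sp_smooth1 {v : ℝ≥0} (hv : v ≠ 0) {f : ℝ → ℝ} (hf : Measurable f) {M : ℝ}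
    (hM : ∀ x, |f x| ≤ M) (a b : ℝ) :
    |∫ r, f (a + r) ∂(gaussianReal 0 v) - ∫ r, f (b + r) ∂(gaussianReal 0 v)|
      ≤ 2 * M * (|a - b| / √v) := by
  have := sp_smooth1_aux hv (f := fun x => f (b + x)) (by fun_prop) (fun x => hM _) (a - b)
  simpa [← add_assoc] using this

/-- Second order Gaussian smoothing. -/
theorem sp_smooth2 {v : ℝ≥0} (hv : v ≠ 0) {f : ℝ → ℝ} (hf : Measurable f) {M : ℝ}
    (hM : ∀ x, |f x| ≤ M) (a0 b0 a1 b1 : ℝ) :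
    |(∫ r, f (a1 + r) ∂(gaussianReal 0 v) - ∫ r, f (b1 + r) ∂(gaussianReal 0 v)) -
      (∫ r, f (a0 + r) ∂(gaussianReal 0 v) - ∫ r, f (b0 + r) ∂(gaussianReal 0 v))|
      ≤ 2 * M * (|(a1 - b1) - (a0 - b0)| / √v) + 8 * M * (|a0 - b0| * |b1 - b0| / v) := by
  set w : ℝ≥0 := v / 2
  have hw : w ≠ 0 := by simp [w, hv]
  have hww : w + w = v := by simp [w]
  set Q : ℝ → ℝ := fun x => ∫ r, f (x + r) ∂(gaussianReal 0 w) with hQ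
  have hfi : ∀ (v : ℝ≥0) b, Integrable (fun r => f (b + r)) (gaussianReal 0 v) := fun v b =>
    Integrable.of_bound (Measurable.aestronglyMeasurable (by fun_prop)) M (by filter_upwards with r; exact hM _)
  have hQm : Measurable Q := by
    have : StronglyMeasurable (fun p : ℝ × ℝ => f (p.1 + p.2)) :=
      (hf.comp (measurable_fst.add measurable_snd)).stronglyMeasurable
    exact this.integral_prod_right.measurable
  have hQb : ∀ x, |Q x| ≤ M := fun b => by
    have := norm_integral_le_of_norm_le_const (μ := gaussianReal 0 w) (f := fun r => f (b + r))
      (C := M) (by filter_upwards with r; exact hM _)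
    simpa using this
  have hP : ∀ a, ∫ r, f (a + r) ∂(gaussianReal 0 v) = ∫ r, Q (a + r) ∂(gaussianReal 0 w) := by
    intro a
    have h1 : gaussianReal 0 v = (gaussianReal 0 w) ∗ (gaussianReal 0 w) := by
      rw [gaussianReal_conv_gaussianReal, hww, add_zero]
    conv_lhs => rw [h1]
    rw [Measure.conv, integral_map (by fun_prop) (Measurable.aestronglyMeasurable (by fun_prop)),
      integral_prod]
    · simp only [hQ]
      congr 1; ext x; congr 1; ext y; rw [add_assoc]
    · exact Integrable.of_bound (Measurable.aestronglyMeasurable (by fun_prop)) M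
        (by filter_upwards with r; exact hM _)
  have hL : ∀ a b, |Q a - Q b| ≤ 2 * M * (|a - b| / √w) := fun a b => sp_smooth1 hw hf hM a b
  set δ := a0 - b0 with hδ
  have hM0 : 0 ≤ M := (abs_nonneg _).trans (hM 0)
  have e1 := sp_smooth1 hv hf hM a1 (b1 + δ)
  have e2 := sp_smooth1 hw (f := fun x => Q (x + δ) - Q x) (by fun_prop)
    (M := 2 * M * (|δ| / √w)) (fun x => by simpa using hL (x + δ) x) b1 b0
  have hQi : ∀ b, Integrable (fun r => Q (b + r)) (gaussianReal 0 w) := fun b =>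
    Integrable.of_bound (Measurable.aestronglyMeasurable (by fun_prop)) M (by filter_upwards with r; exact hQb _)
  have hQi' : ∀ b, ∫ r, (Q (b + r + δ) - Q (b + r)) ∂(gaussianReal 0 w) =
      ∫ r, f (b + δ + r) ∂(gaussianReal 0 v) - ∫ r, f (b + r) ∂(gaussianReal 0 v) := by
    intro b
    rw [hP, hP, ← integral_sub (hQi _) (hQi _)]
    congr 1; ext r; congr 2; ring
  simp only [hQi'] at e2
  have ha0 : b0 + δ = a0 := by rw [hδ]; ring
  rw [ha0] at e2
  have e3 : 2 * (2 * M * (|δ| / √w)) * (|b1 - b0| / √w) = 8 * M * (|δ| * |b1 - b0| / v) := by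
    have hw2 : √(w:ℝ) * √w = v / 2 := by
      rw [mul_self_sqrt (by positivity)]; simp [w]
    have hv' : (0 : ℝ) < v := by positivity
    have hsw : 0 < √(w:ℝ) := by positivity
    calc _ = 4 * M * |δ| * |b1 - b0| / (√(w:ℝ) * √w) := by field_simp; ring
      _ = _ := by rw [hw2]; field_simp; ring
  rw [e3] at e2
  have e4 : a1 - (b1 + δ) = a1 - b1 - δ := by ring
  rw [e4] at e1
  calc _ = |(∫ r, f (a1 + r) ∂(gaussianReal 0 v) - ∫ r, f (b1 + δ + r) ∂(gaussianReal 0 v)) +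
      ((∫ r, f (b1 + δ + r) ∂(gaussianReal 0 v) - ∫ r, f (b1 + r) ∂(gaussianReal 0 v)) -
      (∫ r, f (a0 + r) ∂(gaussianReal 0 v) - ∫ r, f (b0 + r) ∂(gaussianReal 0 v)))| := by
        congr 1; ring
    _ ≤ _ := (abs_add_le _ _).trans (add_le_add e1 e2)

/-- The noise assumptions used by the stochastic sewing argument. -/
structure SPNoise {Ω : Type*} [m0 : MeasurableSpace Ω] (μ : Measure Ω) (F : ℝ → MeasurableSpace Ω)
    (Z : ℝ → Ω → ℝ) (H κ : ℝ) : Prop where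
  le : ∀ s, F s ≤ m0
  mono : ∀ s t, s ≤ t → F s ≤ F t
  meas : ∀ t, Measurable (Z t)
  adapt : ∀ t, 0 ≤ t → Measurable[F t] (Z t)
  cont : ∀ ω, Continuous fun t => Z t ω
  kpos : 0 < κ
  Hpos : 0 < H
  Hlt : H < 1 / 6
  dec : ∀ s u, 0 ≤ s → s < u → ∃ (Y R : Ω → ℝ) (v : ℝ≥0), Measurable[F s] Y ∧
      Measurable R ∧ (∀ ω, Z u ω = Y ω + R ω) ∧
      Indep (MeasurableSpace.comap R inferInstance) (F s) μ ∧
      μ.map R = gaussianReal 0 v ∧ κ ^ 2 * (u - s) ^ (2 * H) ≤ v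

theorem sp_freeze {Ω β : Type*} [MeasurableSpace Ω] [MeasurableSpace β] {μ : Measure Ω}
    [IsProbabilityMeasure μ] {R : Ω → ℝ} {Q : Ω → β} (hR : Measurable R) (hQ : Measurable Q)
    (h : IndepFun R Q μ) {G : β → ℝ → ℝ} (hG : Measurable (fun p : β × ℝ => G p.1 p.2)) {M : ℝ}
    (hM : ∀ q r, |G q r| ≤ M) :
    ∫ ω, G (Q ω) (R ω) ∂μ = ∫ ω, (∫ r, G (Q ω) r ∂(μ.map R)) ∂μ := by
  have h1 := (indepFun_iff_map_prod_eq_prod_map_map hQ.aemeasurable hR.aemeasurable).1 h.symm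
  have i1 : IsProbabilityMeasure (μ.map R) := Measure.isProbabilityMeasure_map hR.aemeasurable
  have i2 : IsProbabilityMeasure (μ.map Q) := Measure.isProbabilityMeasure_map hQ.aemeasurable
  have h2 : ∫ ω, G (Q ω) (R ω) ∂μ =
      ∫ p, G p.1 p.2 ∂(μ.map (fun ω => (Q ω, R ω))) := by
    rw [integral_map (hQ.prodMk hR).aemeasurable hG.aestronglyMeasurable]
  rw [h2, h1, integral_prod]
  · rw [integral_map hQ.aemeasurable]
    exact (hG.stronglyMeasurable.integral_prod_right (ν := μ.map R)).aestronglyMeasurable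
  · exact Integrable.of_bound hG.aestronglyMeasurable M (by filter_upwards with p; exact hM _ _)

theorem sp_cond_set {Ω : Type*} [MeasurableSpace Ω] {μ : Measure Ω} [IsProbabilityMeasure μ]
    {F : ℝ → MeasurableSpace Ω} {Z : ℝ → Ω → ℝ} {H κ : ℝ} (hN : SPNoise μ F Z H κ)
    {f : ℝ → ℝ} (hf : Measurable f) {M : ℝ} (hM : ∀ x, |f x| ≤ M)
    {s u : ℝ} (hs : 0 ≤ s) (hsu : s < u) {A : Set Ω} (hA : MeasurableSet[F s] A)
    {a0 b0 a1 b1 : Ω → ℝ} (ha0 : Measurable[F s] a0) (hb0 : Measurable[F s] b0)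
    (ha1 : Measurable[F s] a1) (hb1 : Measurable[F s] b1)
    (hi1 : Integrable (fun ω => |(a1 ω - b1 ω) - (a0 ω - b0 ω)|) μ)
    (hi2 : Integrable (fun ω => |a0 ω - b0 ω| * |b1 ω - b0 ω|) μ) :
    |∫ ω in A, ((f (Z u ω + a1 ω) - f (Z u ω + b1 ω)) - (f (Z u ω + a0 ω) - f (Z u ω + b0 ω))) ∂μ|
      ≤ ∫ ω in A, (2 * M * κ⁻¹ * (u - s) ^ (-H) * |(a1 ω - b1 ω) - (a0 ω - b0 ω)| +
        8 * M * (κ ^ 2)⁻¹ * (u - s) ^ (-(2 * H)) * (|a0 ω - b0 ω| * |b1 ω - b0 ω|)) ∂μ := by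
  obtain ⟨Y, R, v, hY, hR, hZ, hind, hlaw, hv⟩ := hN.dec s u hs hsu
  have hus : 0 < u - s := by linarith
  have hκ := hN.kpos
  have hvpos : (0:ℝ) < v := lt_of_lt_of_le (by positivity) hv
  have hv0 : v ≠ 0 := by rintro rfl; simp at hvpos
  have hM0 : 0 ≤ M := (abs_nonneg _).trans (hM 0)
  have hle := hN.le s
  have hAm : MeasurableSet A := hle _ hA
  let Q : Ω → (ℝ × ℝ) × (ℝ × ℝ) × ℝ := fun ω =>
    ((Y ω + a1 ω, Y ω + b1 ω), (Y ω + a0 ω, Y ω + b0 ω), A.indicator (fun _ => 1) ω)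
  have hQ : Measurable[F s] Q := by
    refine ((hY.add ha1).prodMk (hY.add hb1)).prodMk
      (((hY.add ha0).prodMk (hY.add hb0)).prodMk (measurable_const.indicator hA))
  have hQm : Measurable Q := hQ.mono hle le_rfl
  have hRQ : IndepFun R Q μ := indep_of_indep_of_le_right hind hQ.comap_le
  let G : (ℝ × ℝ) × (ℝ × ℝ) × ℝ → ℝ → ℝ := fun q r => if q.2.2 = 1 then
    ((f (q.1.1 + r) - f (q.1.2 + r)) - (f (q.2.1.1 + r) - f (q.2.1.2 + r))) else 0
  have hG : Measurable (fun p : ((ℝ × ℝ) × (ℝ × ℝ) × ℝ) × ℝ => G p.1 p.2) := by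
    refine Measurable.ite ?_ (by fun_prop) measurable_const
    exact measurableSet_eq_fun (by fun_prop) measurable_const
  have hGb : ∀ q r, |G q r| ≤ 4 * M := by
    intro q r
    simp only [G]
    split_ifs
    · have e1 := abs_le.1 (hM (q.1.1 + r)); have e2 := abs_le.1 (hM (q.1.2 + r))
      have e3 := abs_le.1 (hM (q.2.1.1 + r)); have e4 := abs_le.1 (hM (q.2.1.2 + r))
      rw [abs_le]; constructor <;> linarith
    · simpa using hM0
  have key := sp_freeze hR hQm hRQ hG hGb
  rw [hlaw] at key
  have lhs : ∫ ω in A, ((f (Z u ω + a1 ω) - f (Z u ω + b1 ω)) -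
      (f (Z u ω + a0 ω) - f (Z u ω + b0 ω))) ∂μ = ∫ ω, G (Q ω) (R ω) ∂μ := by
    rw [← integral_indicator hAm]
    congr 1; ext ω
    by_cases hω : ω ∈ A
    · simp only [G, Q, hω, indicator_of_mem, if_true, hZ]
      congr 3 <;> ring_nf
    · simp [G, Q, hω]
  rw [lhs, key, ← integral_indicator hAm]
  have hfi : ∀ b, Integrable (fun r => f (b + r)) (gaussianReal 0 v) := fun b =>
    Integrable.of_bound (Measurable.aestronglyMeasurable (by fun_prop)) M
      (by filter_upwards with r; exact hM _)
  refine (abs_integral_le_integral_abs).trans (integral_mono_of_nonneg ?_ ?_ ?_)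
  · filter_upwards with ω; exact abs_nonneg _
  · exact (((hi1.const_mul _).add (hi2.const_mul _)).indicator hAm)
  · filter_upwards with ω
    by_cases hω : ω ∈ A
    · simp only [G, Q, hω, indicator_of_mem, if_true]
      have h1 := sp_smooth2 hv0 hf hM (Y ω + a0 ω) (Y ω + b0 ω) (Y ω + a1 ω) (Y ω + b1 ω)
      have hfi2 : ∀ b c, Integrable (fun r => f (b + r) - f (c + r)) (gaussianReal 0 v) :=
        fun b c => (hfi b).sub (hfi c)
      rw [integral_sub (hfi2 _ _) (hfi2 _ _), integral_sub (hfi _) (hfi _),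
        integral_sub (hfi _) (hfi _)]
      refine h1.trans ?_
      have hs1 : κ * (u - s) ^ H ≤ √v := by
        apply Real.le_sqrt_of_sq_le
        rw [mul_pow, ← rpow_natCast ((u - s) ^ H), ← rpow_mul hus.le]
        refine le_trans (le_of_eq ?_) hv
        push_cast
        rw [mul_comm H 2]
      have e2 : (Y ω + a1 ω - (Y ω + b1 ω)) - (Y ω + a0 ω - (Y ω + b0 ω)) =
        (a1 ω - b1 ω) - (a0 ω - b0 ω) := by ring
      have e3 : (Y ω + a0 ω - (Y ω + b0 ω)) = a0 ω - b0 ω := by ring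
      have e4 : (Y ω + b1 ω - (Y ω + b0 ω)) = b1 ω - b0 ω := by ring
      rw [e2, e3, e4]
      have hp1 : 0 < κ * (u - s) ^ H := by positivity
      have hp2 : 0 < κ ^ 2 * (u - s) ^ (2 * H) := by positivity
      refine add_le_add ?_ ?_
      · calc _ ≤ 2 * M * (|(a1 ω - b1 ω) - (a0 ω - b0 ω)| / (κ * (u - s) ^ H)) := by gcongr
          _ = _ := by rw [rpow_neg hus.le, div_eq_mul_inv, mul_inv]; ring
      · calc _ ≤ 8 * M * (|a0 ω - b0 ω| * |b1 ω - b0 ω| / (κ ^ 2 * (u - s) ^ (2 * H))) := by gcongr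
          _ = _ := by rw [rpow_neg hus.le, div_eq_mul_inv, mul_inv]; ring
    · simp [G, Q, hω]

theorem sp_condExp_le {Ω : Type*} {m m0 : MeasurableSpace Ω} {μ : Measure Ω}
    [IsProbabilityMeasure μ] (hm : m ≤ m0) {U β : Ω → ℝ} (hU : Integrable U μ)
    (hβ : Integrable β μ) (hβm : Measurable[m] β)
    (h : ∀ A, MeasurableSet[m] A → |∫ ω in A, U ω ∂μ| ≤ ∫ ω in A, β ω ∂μ) :
    ∀ᵐ ω ∂μ, |(μ[U|m]) ω| ≤ β ω := by
  have hβs : StronglyMeasurable[m] β := hβm.stronglyMeasurable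
  have h1 : (μ[U|m]) ≤ᵐ[μ.trim hm] β := by
    refine ae_le_of_forall_setIntegral_le (integrable_condExp.trim hm stronglyMeasurable_condExp)
      (hβ.trim hm hβs) fun A hA _ => ?_
    rw [← setIntegral_trim hm stronglyMeasurable_condExp hA, ← setIntegral_trim hm hβs hA,
      setIntegral_condExp hm hU hA]
    exact (le_abs_self _).trans (h A hA)
  have h2 : (-β) ≤ᵐ[μ.trim hm] (μ[U|m]) := by
    refine ae_le_of_forall_setIntegral_le (hβ.neg.trim hm hβs.neg)
      (integrable_condExp.trim hm stronglyMeasurable_condExp) fun A hA _ => ?_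
    rw [← setIntegral_trim hm stronglyMeasurable_condExp hA, ← setIntegral_trim hm hβs.neg hA,
      setIntegral_condExp hm hU hA]
    simp only [Pi.neg_apply, integral_neg]
    linarith [neg_abs_le (∫ ω in A, U ω ∂μ), h A hA]
  filter_upwards [ae_le_of_ae_le_trim h1, ae_le_of_ae_le_trim h2] with ω h1 h2
  exact abs_le.2 ⟨h2, h1⟩

/-- Time integral of the difference of a function along two frozen shifts of the noise. -/
def sp_U {Ω : Type*} (f : ℝ → ℝ → ℝ) (Z : ℝ → Ω → ℝ) (m t : ℝ) (a b : Ω → ℝ) (ω : Ω) : ℝ :=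
  ∫ u in Ioc m t, (f u (Z u ω + a ω) - f u (Z u ω + b ω))

theorem sp_clamp {Ω : Type*} [MeasurableSpace Ω] {Z : ℝ → Ω → ℝ} {m t : ℝ} (hmt : m ≤ t)
    (hc : ∀ ω, Continuous fun u => Z u ω) (hZ : ∀ u ∈ Icc m t, Measurable (Z u)) :
    Measurable (fun p : ℝ × Ω => Z (max m (min p.1 t)) p.2) := by
  refine measurable_uncurry_of_continuous_of_measurable
    (u := fun u ω => Z (max m (min u t)) ω) (fun ω => ?_) (fun u => ?_)
  · exact (hc ω).comp (by fun_prop)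
  · exact hZ _ ⟨le_max_left _ _, max_le hmt (min_le_right _ _)⟩

theorem sp_U_meas {Ω : Type*} [MeasurableSpace Ω] {f : ℝ → ℝ → ℝ}
    (hf : Measurable fun p : ℝ × ℝ => f p.1 p.2) {Z : ℝ → Ω → ℝ} {m t : ℝ} (hmt : m ≤ t)
    (hc : ∀ ω, Continuous fun u => Z u ω) (hZ : ∀ u ∈ Icc m t, Measurable (Z u)) {a b : Ω → ℝ}
    (ha : Measurable a) (hb : Measurable b) : Measurable (sp_U f Z m t a b) := by
  have h1 := sp_clamp hmt hc hZ
  have h2 : Measurable (fun p : ℝ × Ω => f p.1 (Z (max m (min p.1 t)) p.2 + a p.2) -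
      f p.1 (Z (max m (min p.1 t)) p.2 + b p.2)) := by
    refine Measurable.sub ?_ ?_
    · exact hf.comp (measurable_fst.prodMk (h1.add (ha.comp measurable_snd)))
    · exact hf.comp (measurable_fst.prodMk (h1.add (hb.comp measurable_snd)))
  have h3 := (h2.stronglyMeasurable.integral_prod_left' (μ := volume.restrict (Ioc m t))).measurable
  convert h3 using 1
  ext ω
  refine setIntegral_congr_fun measurableSet_Ioc fun u hu => ?_
  have : max m (min u t) = u := by rw [min_eq_left hu.2, max_eq_right hu.1.le]
  simp only [this]

theorem sp_U_bound {Ω : Type*} {f : ℝ → ℝ → ℝ} {M : ℝ} (hM : ∀ u x, |f u x| ≤ M)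
    {Z : ℝ → Ω → ℝ} {m t : ℝ} (hmt : m ≤ t) (a b : Ω → ℝ) (ω : Ω) :
    |sp_U f Z m t a b ω| ≤ 2 * M * (t - m) := by
  have := norm_setIntegral_le_of_norm_le_const (μ := volume) (s := Ioc m t) (C := 2 * M)
    (f := fun u => f u (Z u ω + a ω) - f u (Z u ω + b ω)) (by simp) (fun u _ => by
      have e1 := abs_le.1 (hM u (Z u ω + a ω)); have e2 := abs_le.1 (hM u (Z u ω + b ω))
      rw [norm_eq_abs, abs_le]; constructor <;> linarith)
  simpa [sp_U, Real.volume_real_Ioc_of_le hmt] using this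

theorem sp_rpow_int {m t c : ℝ} (hmt : m ≤ t) (hc0 : 0 ≤ c) (hc : c ≤ 1 / 2) :
    IntegrableOn (fun u => (u - m) ^ (-c)) (Ioc m t) ∧
    ∫ u in Ioc m t, (u - m) ^ (-c) ≤ 2 * (t - m) ^ (1 - c) := by
  have h1 : IntervalIntegrable (fun u : ℝ => u ^ (-c)) volume 0 (t - m) :=
    intervalIntegral.intervalIntegrable_rpow' (by linarith)
  have h2 := (IntervalIntegrable.comp_sub_right_iff (c := m) (f := fun u : ℝ => u ^ (-c))
    (a := 0) (b := t - m)).2 h1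
  rw [zero_add, sub_add_cancel] at h2
  refine ⟨(intervalIntegrable_iff_integrableOn_Ioc_of_le hmt).1 h2, ?_⟩
  rw [← intervalIntegral.integral_of_le hmt,
    intervalIntegral.integral_comp_sub_right (fun u : ℝ => u ^ (-c)) m,
    integral_rpow (Or.inl (by linarith)), sub_self, zero_rpow (by linarith), sub_zero,
    div_le_iff₀ (by linarith), show -c + 1 = 1 - c by ring]
  have : 0 ≤ (t - m) ^ (1 - c) := rpow_nonneg (by linarith) _
  nlinarith

theorem sp_meas_aux {Ω : Type*} {_ : MeasurableSpace Ω} {a0 b0 a1 b1 : Ω → ℝ} (ha0 : Measurable a0)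
    (hb0 : Measurable b0) (ha1 : Measurable a1) (hb1 : Measurable b1) (c d : ℝ) :
    Measurable fun ω => c * |(a1 ω - b1 ω) - (a0 ω - b0 ω)| +
      d * (|a0 ω - b0 ω| * |b1 ω - b0 ω|) := by
  fun_prop

theorem sp_cond2 {Ω : Type*} [MeasurableSpace Ω] {μ : Measure Ω} [IsProbabilityMeasure μ]
    {F : ℝ → MeasurableSpace Ω} {Z : ℝ → Ω → ℝ} {H κ : ℝ} (hN : SPNoise μ F Z H κ)
    {f : ℝ → ℝ → ℝ} (hf : Measurable fun p : ℝ × ℝ => f p.1 p.2) {M : ℝ}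
    (hM : ∀ u x, |f u x| ≤ M)
    {m t : ℝ} (hm : 0 ≤ m) (hmt : m ≤ t)
    {a0 b0 a1 b1 : Ω → ℝ} (ha0 : Measurable[F m] a0) (hb0 : Measurable[F m] b0)
    (ha1 : Measurable[F m] a1) (hb1 : Measurable[F m] b1)
    (hi1 : Integrable (fun ω => |(a1 ω - b1 ω) - (a0 ω - b0 ω)|) μ)
    (hi2 : Integrable (fun ω => |a0 ω - b0 ω| * |b1 ω - b0 ω|) μ) :
    ∀ᵐ ω ∂μ, |(μ[fun ω => sp_U f Z m t a1 b1 ω - sp_U f Z m t a0 b0 ω|F m]) ω| ≤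
      4 * M * κ⁻¹ * (t - m) ^ (1 - H) * |(a1 ω - b1 ω) - (a0 ω - b0 ω)| +
        16 * M * (κ ^ 2)⁻¹ * (t - m) ^ (1 - 2 * H) * (|a0 ω - b0 ω| * |b1 ω - b0 ω|) := by
  have hle := hN.le m
  have hM0 : 0 ≤ M := (abs_nonneg _).trans (hM 0 0)
  have hκ := hN.kpos
  have hH1 := hN.Hpos
  have hH2 := hN.Hlt
  have ma0 := ha0.mono hle le_rfl
  have mb0 := hb0.mono hle le_rfl
  have ma1 := ha1.mono hle le_rfl
  have mb1 := hb1.mono hle le_rfl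
  have hUm : ∀ {a b : Ω → ℝ}, Measurable a → Measurable b → Measurable (sp_U f Z m t a b) :=
    fun ha hb => sp_U_meas hf hmt hN.cont (fun u _ => hN.meas u) ha hb
  have hUi : ∀ {a b : Ω → ℝ}, Measurable a → Measurable b → Integrable (sp_U f Z m t a b) μ :=
    fun {a b} ha hb => Integrable.of_bound (hUm ha hb).aestronglyMeasurable (2 * M * (t - m))
      (by filter_upwards with ω; exact sp_U_bound hM hmt a b ω)
  refine sp_condExp_le hle ((hUi ma1 mb1).sub (hUi ma0 mb0))
    ((hi1.const_mul _).add (hi2.const_mul _)) ?_ fun A hA => ?_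
  · exact sp_meas_aux ha0 hb0 ha1 hb1 _ _
  have hAm := hle _ hA
  set g : ℝ → Ω → ℝ := fun u ω => (f u (Z u ω + a1 ω) - f u (Z u ω + b1 ω)) -
    (f u (Z u ω + a0 ω) - f u (Z u ω + b0 ω)) with hg
  have hZj : Measurable (fun p : Ω × ℝ => Z p.2 p.1) :=
    (measurable_uncurry_of_continuous_of_measurable hN.cont hN.meas).comp measurable_swap
  have hcomp : ∀ a : Ω → ℝ, Measurable a →
      Measurable (fun p : Ω × ℝ => f p.2 (Z p.2 p.1 + a p.1)) := fun a ha =>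
    hf.comp (measurable_snd.prodMk (hZj.add (ha.comp measurable_fst)))
  have hgj : Measurable (fun p : Ω × ℝ => g p.2 p.1) :=
    ((hcomp _ ma1).sub (hcomp _ mb1)).sub ((hcomp _ ma0).sub (hcomp _ mb0))
  have hgb : ∀ u ω, |g u ω| ≤ 4 * M := by
    intro u ω
    have e1 := abs_le.1 (hM u (Z u ω + a1 ω)); have e2 := abs_le.1 (hM u (Z u ω + b1 ω))
    have e3 := abs_le.1 (hM u (Z u ω + a0 ω)); have e4 := abs_le.1 (hM u (Z u ω + b0 ω))
    rw [hg, abs_le]; constructor <;> linarith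
  have hgi : Integrable (fun p : Ω × ℝ => g p.2 p.1)
      ((μ.restrict A).prod (volume.restrict (Ioc m t))) :=
    Integrable.of_bound hgj.aestronglyMeasurable (4 * M)
      (by filter_upwards with p; exact hgb _ _)
  have hfib : ∀ (a : Ω → ℝ) (ω : Ω),
      Integrable (fun u => f u (Z u ω + a ω)) (volume.restrict (Ioc m t)) := by
    intro a ω
    refine Integrable.of_bound (Measurable.aestronglyMeasurable ?_) M
      (by filter_upwards with u; exact hM _ _)
    exact hf.comp (measurable_id.prodMk ((hN.cont ω).measurable.add_const _))
  have e1 : ∫ ω in A, (sp_U f Z m t a1 b1 ω - sp_U f Z m t a0 b0 ω) ∂μ =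
      ∫ u in Ioc m t, ∫ ω in A, g u ω ∂μ := by
    rw [← integral_integral_swap hgi]
    congr 1; ext ω
    exact (integral_sub ((hfib a1 ω).sub (hfib b1 ω)) ((hfib a0 ω).sub (hfib b0 ω))).symm
  rw [e1]
  set I1 := ∫ ω in A, |(a1 ω - b1 ω) - (a0 ω - b0 ω)| ∂μ with hI1
  set I2 := ∫ ω in A, |a0 ω - b0 ω| * |b1 ω - b0 ω| ∂μ with hI2
  have hI1n : 0 ≤ I1 := integral_nonneg fun ω => abs_nonneg _
  have hI2n : 0 ≤ I2 := integral_nonneg fun ω => mul_nonneg (abs_nonneg _) (abs_nonneg _)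
  obtain ⟨r1, r2⟩ := sp_rpow_int (c := H) hmt hH1.le (by linarith)
  obtain ⟨r3, r4⟩ := sp_rpow_int (c := 2 * H) hmt (by linarith) (by linarith)
  rw [integral_add (hi1.integrableOn.const_mul _) (hi2.integrableOn.const_mul _),
    integral_const_mul, integral_const_mul, ← hI1, ← hI2]
  have hb1 : ∀ u ∈ Ioc m t, |∫ ω in A, g u ω ∂μ| ≤ 2 * M * κ⁻¹ * I1 * (u - m) ^ (-H) +
      8 * M * (κ ^ 2)⁻¹ * I2 * (u - m) ^ (-(2 * H)) := by
    intro u hu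
    have := sp_cond_set hN (f := f u) (hf.comp measurable_prodMk_left) (hM u) hm hu.1 hA
      ha0 hb0 ha1 hb1 hi1 hi2
    refine this.trans (le_of_eq ?_)
    rw [integral_add (hi1.integrableOn.const_mul _) (hi2.integrableOn.const_mul _),
      integral_const_mul, integral_const_mul, ← hI1, ← hI2]
    ring
  refine abs_integral_le_integral_abs.trans ?_
  calc ∫ u in Ioc m t, |∫ ω in A, g u ω ∂μ|
      ≤ ∫ u in Ioc m t, (2 * M * κ⁻¹ * I1 * (u - m) ^ (-H) +
      8 * M * (κ ^ 2)⁻¹ * I2 * (u - m) ^ (-(2 * H))) := by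
        refine integral_mono_of_nonneg (by filter_upwards with u; exact abs_nonneg _)
          ((r1.const_mul _).add (r3.const_mul _)) ?_
        filter_upwards [ae_restrict_mem measurableSet_Ioc] with u hu
        exact hb1 u hu
    _ = 2 * M * κ⁻¹ * I1 * (∫ u in Ioc m t, (u - m) ^ (-H)) +
      8 * M * (κ ^ 2)⁻¹ * I2 * ∫ u in Ioc m t, (u - m) ^ (-(2 * H)) := by
        rw [integral_add (r1.const_mul _) (r3.const_mul _), integral_const_mul, integral_const_mul]
    _ ≤ 2 * M * κ⁻¹ * I1 * (2 * (t - m) ^ (1 - H)) +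
      8 * M * (κ ^ 2)⁻¹ * I2 * (2 * (t - m) ^ (1 - 2 * H)) := by gcongr
    _ = _ := by ring

theorem sp_cond1 {Ω : Type*} [MeasurableSpace Ω] {μ : Measure Ω} [IsProbabilityMeasure μ]
    {F : ℝ → MeasurableSpace Ω} {Z : ℝ → Ω → ℝ} {H κ : ℝ} (hN : SPNoise μ F Z H κ)
    {f : ℝ → ℝ → ℝ} (hf : Measurable fun p : ℝ × ℝ => f p.1 p.2) {M : ℝ}
    (hM : ∀ u x, |f u x| ≤ M)
    {m t : ℝ} (hm : 0 ≤ m) (hmt : m ≤ t)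
    {a b : Ω → ℝ} (ha : Measurable[F m] a) (hb : Measurable[F m] b)
    (hi : Integrable (fun ω => |a ω - b ω|) μ) :
    ∀ᵐ ω ∂μ, |(μ[sp_U f Z m t a b|F m]) ω| ≤
      4 * M * κ⁻¹ * (t - m) ^ (1 - H) * |a ω - b ω| := by
  have := sp_cond2 hN hf hM hm hmt (a0 := fun _ => 0) (b0 := fun _ => 0)
    measurable_const measurable_const ha hb (by simpa using hi) (by simp)
  have e : (fun ω => sp_U f Z m t a b ω - sp_U f Z m t (fun _ => 0) (fun _ => 0) ω) =
      sp_U f Z m t a b := by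
    ext ω; simp [sp_U]
  rw [e] at this
  simpa using this

theorem sp_taylor (x d m : ℝ) (hx : |x| ≤ m) (hd : |d| ≤ m) (n : ℕ) :
    |(x + d) ^ (n + 2) - x ^ (n + 2) - (n + 2) * x ^ (n + 1) * d| ≤ 4 ^ (n + 2) * m ^ n * d ^ 2 := by
  have hm : 0 ≤ m := (abs_nonneg _).trans hx
  induction n with
  | zero =>
    have : (x + d) ^ (0 + 2) - x ^ (0 + 2) - ((0 : ℕ) + 2) * x ^ (0 + 1) * d = d ^ 2 := by
      push_cast; ring
    rw [this, abs_of_nonneg (sq_nonneg d)]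
    norm_num
    nlinarith [sq_nonneg d]
  | succ n ih =>
    have e : (x + d) ^ (n + 1 + 2) - x ^ (n + 1 + 2) - ((n + 1 : ℕ) + 2) * x ^ (n + 1 + 1) * d =
      (x + d) * ((x + d) ^ (n + 2) - x ^ (n + 2) - (n + 2) * x ^ (n + 1) * d) +
        (n + 2) * x ^ (n + 1) * d ^ 2 := by push_cast; ring
    rw [e]
    have h1 : |x + d| ≤ 2 * m := (abs_add_le _ _).trans (by linarith)
    have h2 : |x ^ (n + 1)| ≤ m ^ (n + 1) := by rw [abs_pow]; gcongr
    have h3 : (n + 2 : ℝ) ≤ 4 ^ (n + 2) := by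
      have : n + 2 < 4 ^ (n + 2) := Nat.lt_pow_self (by norm_num)
      exact_mod_cast this.le
    calc _ ≤ |x + d| * |(x + d) ^ (n + 2) - x ^ (n + 2) - (n + 2) * x ^ (n + 1) * d| +
        (n + 2) * |x ^ (n + 1)| * d ^ 2 := by
          refine (abs_add_le _ _).trans (le_of_eq ?_)
          rw [abs_mul, abs_mul, abs_mul, abs_of_nonneg (sq_nonneg d),
            abs_of_nonneg (by positivity : (0:ℝ) ≤ n + 2)]
      _ ≤ (2 * m) * (4 ^ (n + 2) * m ^ n * d ^ 2) + 4 ^ (n + 2) * m ^ (n + 1) * d ^ 2 := by gcongr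
      _ = 3 * (4 ^ (n + 2) * m ^ (n + 1) * d ^ 2) := by ring
      _ ≤ 4 * (4 ^ (n + 2) * m ^ (n + 1) * d ^ 2) := by gcongr; norm_num
      _ = _ := by ring

theorem sp_path (k : ℕ) (x d N : ℝ) (hN : 1 ≤ N) :
    (x + d) ^ (2 * (k + 1)) ≤ (1 + 16 ^ (k + 1) / N) * x ^ (2 * (k + 1)) +
      (2 * k + 2) * (x ^ (2 * k + 1) * d) + 16 ^ (k + 1) * N ^ k * d ^ (2 * (k + 1)) := by
  have h := sp_taylor x d (max |x| |d|) (le_max_left _ _) (le_max_right _ _) (2 * k)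
  have h1 := (abs_le.1 h).2
  have e : (max |x| |d|) ^ (2 * k) = (max (x ^ 2) (d ^ 2)) ^ k := by
    rw [pow_mul]; congr 1
    rcases le_total |x| |d| with h | h
    · rw [max_eq_right h, max_eq_right (sq_le_sq.2 h), sq_abs]
    · rw [max_eq_left h, max_eq_left (sq_le_sq.2 h), sq_abs]
  have e4 : (4:ℝ) ^ (2 * k + 2) = 16 ^ (k + 1) := by
    rw [show 2 * k + 2 = 2 * (k + 1) by ring, pow_mul]; norm_num
  have hN0 : 0 < N := by linarith
  have key : (max (x ^ 2) (d ^ 2)) ^ k * d ^ 2 ≤ x ^ (2 * (k + 1)) / N + N ^ k * d ^ (2 * (k + 1)) := by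
    have p1 : 0 ≤ x ^ (2 * (k + 1)) := by rw [pow_mul]; positivity
    have p2 : 0 ≤ d ^ (2 * (k + 1)) := by rw [pow_mul]; positivity
    by_cases hc : N * d ^ 2 ≤ x ^ 2
    · have : d ^ 2 ≤ x ^ 2 := le_trans (by nlinarith [sq_nonneg d]) hc
      rw [max_eq_left this]
      have h2 : d ^ 2 ≤ x ^ 2 / N := by rw [le_div_iff₀ hN0]; linarith
      calc (x ^ 2) ^ k * d ^ 2 ≤ (x ^ 2) ^ k * (x ^ 2 / N) := by gcongr
        _ = x ^ (2 * (k + 1)) / N := by rw [pow_mul, pow_succ]; ring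
        _ ≤ _ := by linarith [mul_nonneg (pow_nonneg hN0.le k) p2]
    · push Not at hc
      have h2 : max (x ^ 2) (d ^ 2) ≤ N * d ^ 2 := max_le hc.le (by nlinarith [sq_nonneg d])
      calc (max (x ^ 2) (d ^ 2)) ^ k * d ^ 2 ≤ (N * d ^ 2) ^ k * d ^ 2 := by gcongr
        _ = N ^ k * d ^ (2 * (k + 1)) := by rw [pow_mul, mul_pow, pow_succ]; ring
        _ ≤ _ := by linarith [div_nonneg p1 hN0.le]
  rw [e, e4] at h1
  push_cast at h1
  have h3 : (16:ℝ) ^ (k + 1) * ((max (x ^ 2) (d ^ 2)) ^ k * d ^ 2) ≤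
    16 ^ (k + 1) * (x ^ (2 * (k + 1)) / N + N ^ k * d ^ (2 * (k + 1))) := by gcongr
  have e5 : 2 * (k + 1) = 2 * k + 2 := by ring
  rw [e5] at h3 ⊢
  have e6 : (1 + 16 ^ (k + 1) / N) * x ^ (2 * k + 2) = x ^ (2 * k + 2) +
    16 ^ (k + 1) * (x ^ (2 * k + 2) / N) := by ring
  rw [e6]
  linarith

theorem sp_bdg {Ω : Type*} [m0 : MeasurableSpace Ω] {μ : Measure Ω} [IsProbabilityMeasure μ]
    (k N : ℕ) (hN : 1 ≤ N) (G : ℕ → MeasurableSpace Ω) (hG : ∀ i, G i ≤ m0)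
    (hmono : ∀ i j, i ≤ j → G i ≤ G j)
    (d : ℕ → Ω → ℝ) (hd : ∀ i, StronglyMeasurable[G (i + 1)] (d i)) {c δ : ℝ}
    (hδ : 0 ≤ δ)
    (hb : ∀ i, ∀ᵐ ω ∂μ, |d i ω| ≤ c) (hc : ∀ i, μ[d i|G i] =ᵐ[μ] 0)
    (hp : ∀ i, ∫ ω, (d i ω) ^ (2 * (k + 1)) ∂μ ≤ δ) :
    ∫ ω, (∑ i ∈ Finset.range N, d i ω) ^ (2 * (k + 1)) ∂μ ≤
      16 ^ (k + 1) * Real.exp (16 ^ (k + 1)) * N ^ (k + 1) * δ := by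
  have hdm : ∀ i, Measurable (d i) := fun i => ((hd i).mono (hG _)).measurable
  have hMm : ∀ n, StronglyMeasurable[G n] (fun ω => ∑ i ∈ Finset.range n, d i ω) := by
    intro n
    exact Finset.stronglyMeasurable_fun_sum (m := G n) _ fun i hi =>
      (hd i).mono (hmono _ _ (Finset.mem_range.1 hi))
  have hMm' : ∀ n, Measurable (fun ω => ∑ i ∈ Finset.range n, d i ω) := fun n =>
    ((hMm n).mono (hG _)).measurable
  have hball : ∀ᵐ ω ∂μ, ∀ i, |d i ω| ≤ c := ae_all_iff.2 hb
  have hMb : ∀ᵐ ω ∂μ, ∀ n : ℕ, |∑ i ∈ Finset.range n, d i ω| ≤ n * c := by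
    filter_upwards [hball] with ω hω n
    refine (Finset.abs_sum_le_sum_abs _ _).trans ((Finset.sum_le_sum fun i _ => hω i).trans ?_)
    simp
  have hIntg : ∀ n p q, Integrable (fun ω => (∑ i ∈ Finset.range n, d i ω) ^ p * (d n ω) ^ q) μ := by
    intro n p q
    refine Integrable.of_bound (((hMm' n).pow_const p).mul
      ((hdm n).pow_const q)).aestronglyMeasurable ((n * c) ^ p * c ^ q) ?_
    filter_upwards [hMb, hball] with ω h1 h2
    rw [norm_mul, norm_pow, norm_pow, norm_eq_abs, norm_eq_abs]
    have := h1 n; have := h2 n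
    have : 0 ≤ c := (abs_nonneg _).trans this
    gcongr
  have hz : ∀ n p, ∫ ω, (∑ i ∈ Finset.range n, d i ω) ^ p * d n ω ∂μ = 0 := by
    intro n p
    have h1 := condExp_mul_of_stronglyMeasurable_left (μ := μ) (m := G n)
      (f := fun ω => (∑ i ∈ Finset.range n, d i ω) ^ p) (g := d n)
      ((hMm n).pow p) (by have := hIntg n p 1; simp only [pow_one] at this; exact this) (by simpa using hIntg n 0 1)
    have h2 : ∫ ω, (∑ i ∈ Finset.range n, d i ω) ^ p * d n ω ∂μ =
      ∫ ω, (μ[(fun ω => (∑ i ∈ Finset.range n, d i ω) ^ p) * d n|G n]) ω ∂μ :=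
      (integral_condExp (hG n)).symm
    rw [h2, integral_congr_ae (g := fun _ => (0:ℝ)), integral_zero]
    filter_upwards [h1, hc n] with ω h1 h2
    rw [h1, Pi.mul_apply, h2]; simp
  set C : ℝ := 16 ^ (k + 1) with hC
  have hC0 : 0 < C := by positivity
  have hNr : (1:ℝ) ≤ N := by exact_mod_cast hN
  have hrec : ∀ n, ∫ ω, (∑ i ∈ Finset.range (n + 1), d i ω) ^ (2 * (k + 1)) ∂μ ≤
      (1 + C / N) * (∫ ω, (∑ i ∈ Finset.range n, d i ω) ^ (2 * (k + 1)) ∂μ) + C * N ^ k * δ := by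
    intro n
    have i1 : Integrable (fun ω => (∑ i ∈ Finset.range n, d i ω) ^ (2 * (k + 1))) μ := by
      simpa using hIntg n (2 * (k + 1)) 0
    have i2 : Integrable (fun ω => (d n ω) ^ (2 * (k + 1))) μ := by
      simpa using hIntg n 0 (2 * (k + 1))
    have i3 : Integrable (fun ω => (∑ i ∈ Finset.range n, d i ω) ^ (2 * k + 1) * d n ω) μ := by
      simpa using hIntg n (2 * k + 1) 1
    have i0 : Integrable (fun ω => (∑ i ∈ Finset.range (n + 1), d i ω) ^ (2 * (k + 1))) μ := by
      simpa using hIntg (n + 1) (2 * (k + 1)) 0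
    have i4 : Integrable (fun ω => (1 + C / N) * (∑ i ∈ Finset.range n, d i ω) ^ (2 * (k + 1)) +
          (2 * k + 2) * ((∑ i ∈ Finset.range n, d i ω) ^ (2 * k + 1) * d n ω)) μ :=
      (i1.const_mul _).add (i3.const_mul _)
    calc _ ≤ ∫ ω, ((1 + C / N) * (∑ i ∈ Finset.range n, d i ω) ^ (2 * (k + 1)) +
          (2 * k + 2) * ((∑ i ∈ Finset.range n, d i ω) ^ (2 * k + 1) * d n ω) +
          C * N ^ k * (d n ω) ^ (2 * (k + 1))) ∂μ := by
          refine integral_mono i0 (i4.add (i2.const_mul _)) fun ω => ?_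
          simp only [Finset.sum_range_succ]
          exact sp_path k _ _ _ hNr
      _ = (1 + C / N) * (∫ ω, (∑ i ∈ Finset.range n, d i ω) ^ (2 * (k + 1)) ∂μ) +
          C * N ^ k * ∫ ω, (d n ω) ^ (2 * (k + 1)) ∂μ := by
          rw [integral_add i4 (i2.const_mul _), integral_add (i1.const_mul _) (i3.const_mul _),
            integral_const_mul, integral_const_mul, integral_const_mul, hz n]
          ring
      _ ≤ _ := by gcongr; exact hp n
  have hCN : 0 ≤ C / N := by positivity
  have hall : ∀ n : ℕ, ∫ ω, (∑ i ∈ Finset.range n, d i ω) ^ (2 * (k + 1)) ∂μ ≤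
      n * (1 + C / N) ^ n * (C * N ^ k * δ) := by
    intro n
    induction n with
    | zero => simp
    | succ n ih =>
      refine (hrec n).trans ?_
      have h1 : (1 + C / N) * (∫ ω, (∑ i ∈ Finset.range n, d i ω) ^ (2 * (k + 1)) ∂μ) ≤
        (1 + C / N) * (n * (1 + C / N) ^ n * (C * N ^ k * δ)) := by gcongr
      have h2 : (1:ℝ) ≤ (1 + C / N) ^ (n + 1) := one_le_pow₀ (by linarith)
      have h3 : 0 ≤ C * N ^ k * δ := by positivity
      have h4 : C * N ^ k * δ ≤ (1 + C / N) ^ (n + 1) * (C * N ^ k * δ) := le_mul_of_one_le_left h3 h2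
      push_cast
      calc _ ≤ (1 + C / N) * (n * (1 + C / N) ^ n * (C * N ^ k * δ)) +
            (1 + C / N) ^ (n + 1) * (C * N ^ k * δ) := by linarith
        _ = _ := by ring
  refine (hall N).trans ?_
  have h5 : (1 + C / N) ^ N ≤ Real.exp C := by
    have := Real.add_one_le_exp (C / N)
    calc (1 + C / N) ^ N ≤ (Real.exp (C / N)) ^ N := by gcongr; linarith
      _ = Real.exp C := by rw [← Real.exp_nat_mul]; congr 1; field_simp
  calc (N:ℝ) * (1 + C / N) ^ N * (C * N ^ k * δ) ≤ N * Real.exp C * (C * N ^ k * δ) := by gcongr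
    _ = _ := by ring

/-- The even integrability exponent `2 (k + 1)`. -/
def sp_p (k : ℕ) : ℝ≥0∞ := ((2 * (k + 1) : ℕ) : ℝ≥0∞)

theorem sp_p_one (k : ℕ) : 1 ≤ sp_p k := by
  unfold sp_p
  exact_mod_cast (by omega : 1 ≤ 2 * (k + 1))

theorem sp_lp_iff {Ω : Type*} [MeasurableSpace Ω] {μ : Measure Ω} (k : ℕ) (X : Ω → ℝ) {c : ℝ}
    (hc : 0 ≤ c) : eLpNorm X (sp_p k) μ ≤ ENNReal.ofReal c ↔
      ∫⁻ ω, ENNReal.ofReal (X ω ^ (2 * (k + 1))) ∂μ ≤ ENNReal.ofReal (c ^ (2 * (k + 1))) := by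
  have hp0 : sp_p k ≠ 0 := (lt_of_lt_of_le one_pos (sp_p_one k)).ne'
  have hpt : sp_p k ≠ ∞ := by unfold sp_p; exact ENNReal.natCast_ne_top _
  have hpr : (sp_p k).toReal = ((2 * (k + 1) : ℕ) : ℝ) :=
    ENNReal.toReal_natCast _
  rw [eLpNorm_eq_lintegral_rpow_enorm_toReal hp0 hpt, hpr]
  have h1 : (∫⁻ ω, ‖X ω‖ₑ ^ (((2 * (k + 1) : ℕ)) : ℝ) ∂μ) =
      ∫⁻ ω, ENNReal.ofReal (X ω ^ (2 * (k + 1))) ∂μ := by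
    refine lintegral_congr fun ω => ?_
    rw [ENNReal.rpow_natCast, Real.enorm_eq_ofReal_abs, ← ENNReal.ofReal_pow (abs_nonneg _),
      Even.pow_abs ⟨k + 1, by ring⟩]
  rw [h1, ENNReal.ofReal_pow hc, ← ENNReal.rpow_natCast (ENNReal.ofReal c), one_div,
    ENNReal.rpow_inv_le_iff (by positivity)]

theorem sp_lp_int {Ω : Type*} [MeasurableSpace Ω] {μ : Measure Ω} (k : ℕ) {X : Ω → ℝ} {c : ℝ}
    (hX : AEStronglyMeasurable X μ)
    (hc : 0 ≤ c) (h : eLpNorm X (sp_p k) μ ≤ ENNReal.ofReal c) :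
    ∫ ω, X ω ^ (2 * (k + 1)) ∂μ ≤ c ^ (2 * (k + 1)) := by
  have h1 := (sp_lp_iff k X hc).1 h
  rw [integral_eq_lintegral_of_nonneg_ae]
  · exact ENNReal.toReal_le_of_le_ofReal (by positivity) h1
  · filter_upwards with ω; exact Even.pow_nonneg ⟨k + 1, by ring⟩ _
  · exact hX.pow _

/-- Burkholder constant. -/
def sp_Cb (k : ℕ) : ℝ := 16 ^ (k + 1) * Real.exp (16 ^ (k + 1))

theorem sp_Cb_one (k : ℕ) : 1 ≤ sp_Cb k := by
  unfold sp_Cb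
  have h1 : (1:ℝ) ≤ 16 ^ (k + 1) := one_le_pow₀ (by norm_num)
  have h2 : (1:ℝ) ≤ Real.exp (16 ^ (k + 1)) := Real.one_le_exp (by positivity)
  nlinarith

theorem sp_bdg_lp {Ω : Type*} [m0 : MeasurableSpace Ω] {μ : Measure Ω} [IsProbabilityMeasure μ]
    (k N : ℕ) (hN : 1 ≤ N) (G : ℕ → MeasurableSpace Ω) (hG : ∀ i, G i ≤ m0)
    (hmono : ∀ i j, i ≤ j → G i ≤ G j)
    (d : ℕ → Ω → ℝ) (hd : ∀ i, StronglyMeasurable[G (i + 1)] (d i)) {c δ : ℝ}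
    (hδ : 0 ≤ δ)
    (hb : ∀ i, ∀ᵐ ω ∂μ, |d i ω| ≤ c) (hc : ∀ i, μ[d i|G i] =ᵐ[μ] 0)
    (hp : ∀ i, eLpNorm (d i) (sp_p k) μ ≤ ENNReal.ofReal δ) :
    eLpNorm (fun ω => ∑ i ∈ Finset.range N, d i ω) (sp_p k) μ ≤
      ENNReal.ofReal (sp_Cb k * √N * δ) := by
  have hC := sp_Cb_one k
  have hdm : ∀ i, StronglyMeasurable (d i) := fun i => (hd i).mono (hG _)
  have h := sp_bdg k N hN G hG hmono d hd (δ := δ ^ (2 * (k + 1))) (by positivity) hb hc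
    (fun i => sp_lp_int k (hdm i).aestronglyMeasurable hδ (hp i))
  rw [sp_lp_iff k _ (by positivity)]
  have hm : Measurable (fun ω => ∑ i ∈ Finset.range N, d i ω) :=
    Finset.measurable_fun_sum _ fun i _ => (hdm i).measurable
  have hbb : ∀ᵐ ω ∂μ, |∑ i ∈ Finset.range N, d i ω| ≤ N * c := by
    filter_upwards [ae_all_iff.2 hb] with ω hω
    refine (Finset.abs_sum_le_sum_abs _ _).trans ((Finset.sum_le_sum fun i _ => hω i).trans ?_)
    simp
  have hi : Integrable (fun ω => (∑ i ∈ Finset.range N, d i ω) ^ (2 * (k + 1))) μ := by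
    refine Integrable.of_bound (hm.pow_const _).aestronglyMeasurable ((N * c) ^ (2 * (k + 1))) ?_
    filter_upwards [hbb] with ω hω
    rw [norm_pow, norm_eq_abs]; gcongr
  rw [← ofReal_integral_eq_lintegral_ofReal hi (by
    filter_upwards with ω; exact Even.pow_nonneg ⟨k + 1, by ring⟩ _)]
  refine ENNReal.ofReal_le_ofReal (h.trans ?_)
  rw [mul_pow, mul_pow, pow_mul (√(N:ℝ)), Real.sq_sqrt (by positivity)]
  have : sp_Cb k ≤ sp_Cb k ^ (2 * (k + 1)) := le_self_pow₀ hC (by omega)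
  change sp_Cb k * (N:ℝ) ^ (k + 1) * δ ^ (2 * (k + 1)) ≤ _
  gcongr

/-- A sum in which at most one summand is non-zero. -/
theorem sp_one_term (q N : ℕ) (hq : q ≠ 0) (w x : ℕ → ℝ) (hw : ∀ i, w i = 0 ∨ w i = 1)
    (hs : ∑ i ∈ Finset.range N, w i ≤ 1) :
    (∑ i ∈ Finset.range N, w i * x i) ^ q = ∑ i ∈ Finset.range N, (w i * x i) ^ q := by
  by_cases h : ∀ i ∈ Finset.range N, w i = 0
  · rw [Finset.sum_eq_zero (fun i hi => by rw [h i hi, zero_mul]),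
      Finset.sum_eq_zero (fun i hi => by rw [h i hi, zero_mul, zero_pow hq]), zero_pow hq]
  · push Not at h
    obtain ⟨i0, hi0, h0⟩ := h
    have h1 : w i0 = 1 := (hw i0).resolve_left h0
    have h2 : ∀ j ∈ Finset.range N, j ≠ i0 → w j = 0 := by
      intro j hj hne
      by_contra hj0
      have h3 : w j = 1 := (hw j).resolve_left hj0
      have h4 : ∑ i ∈ ({i0, j} : Finset ℕ), w i ≤ ∑ i ∈ Finset.range N, w i := by
        refine Finset.sum_le_sum_of_subset_of_nonneg ?_ fun i _ _ => ?_
        · intro i hi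
          simp only [Finset.mem_insert, Finset.mem_singleton] at hi
          rcases hi with rfl | rfl <;> assumption
        · rcases hw i with h | h <;> rw [h] <;> norm_num
      rw [Finset.sum_pair hne.symm, h1, h3] at h4
      linarith
    rw [Finset.sum_eq_single_of_mem i0 hi0 (fun j hj hne => by rw [h2 j hj hne, zero_mul]),
      Finset.sum_eq_single_of_mem i0 hi0 (fun j hj hne => by
        rw [h2 j hj hne, zero_mul, zero_pow hq])]

theorem sp_one_term_lp {Ω : Type*} [MeasurableSpace Ω] {μ : Measure Ω}
    (k N : ℕ) (hN : 1 ≤ N) (w x : ℕ → Ω → ℝ) (hw : ∀ i ω, w i ω = 0 ∨ w i ω = 1)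
    (hs : ∀ ω, ∑ i ∈ Finset.range N, w i ω ≤ 1) {δ : ℝ} (hδ : 0 ≤ δ)
    (hm : ∀ i, Measurable (fun ω => w i ω * x i ω))
    (h : ∀ i, eLpNorm (fun ω => w i ω * x i ω) (sp_p k) μ ≤ ENNReal.ofReal δ) :
    eLpNorm (fun ω => ∑ i ∈ Finset.range N, w i ω * x i ω) (sp_p k) μ ≤
      ENNReal.ofReal (√N * δ) := by
  rw [sp_lp_iff k _ (by positivity)]
  have hnn : ∀ y : ℝ, 0 ≤ y ^ (2 * (k + 1)) := fun y => Even.pow_nonneg ⟨k + 1, by ring⟩ _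
  calc ∫⁻ ω, ENNReal.ofReal ((∑ i ∈ Finset.range N, w i ω * x i ω) ^ (2 * (k + 1))) ∂μ
      = ∫⁻ ω, ∑ i ∈ Finset.range N, ENNReal.ofReal ((w i ω * x i ω) ^ (2 * (k + 1))) ∂μ := by
        refine lintegral_congr fun ω => ?_
        rw [sp_one_term _ N (by omega) (fun i => w i ω) (fun i => x i ω) (fun i => hw i ω) (hs ω),
          ENNReal.ofReal_sum_of_nonneg fun i _ => hnn _]
    _ = ∑ i ∈ Finset.range N, ∫⁻ ω, ENNReal.ofReal ((w i ω * x i ω) ^ (2 * (k + 1))) ∂μ :=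
        lintegral_finsetSum _ fun i _ => ((hm i).pow_const _).ennreal_ofReal
    _ ≤ ∑ i ∈ Finset.range N, ENNReal.ofReal (δ ^ (2 * (k + 1))) :=
        Finset.sum_le_sum fun i _ => (sp_lp_iff k _ hδ).1 (h i)
    _ = ENNReal.ofReal (N * δ ^ (2 * (k + 1))) := by
        rw [Finset.sum_const, Finset.card_range, nsmul_eq_mul, ENNReal.ofReal_mul (by positivity),
          ENNReal.ofReal_natCast]
    _ ≤ _ := by
        refine ENNReal.ofReal_le_ofReal ?_
        rw [mul_pow, pow_mul (√(N:ℝ)), Real.sq_sqrt (by positivity)]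
        have : (N:ℝ) ≤ (N:ℝ) ^ (k + 1) := le_self_pow₀ (by exact_mod_cast hN) (by omega)
        gcongr

/-- Pointwise domination. -/
theorem sp_lp_mono {Ω : Type*} [MeasurableSpace Ω] {μ : Measure Ω} {k : ℕ} {X Y : Ω → ℝ} {c d : ℝ}
    (hc : 0 ≤ c) (h : ∀ᵐ ω ∂μ, |X ω| ≤ c * |Y ω|)
    (hY : eLpNorm Y (sp_p k) μ ≤ ENNReal.ofReal d) :
    eLpNorm X (sp_p k) μ ≤ ENNReal.ofReal (c * d) := by
  have h1 : eLpNorm X (sp_p k) μ ≤ ENNReal.ofReal c * eLpNorm Y (sp_p k) μ :=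
    eLpNorm_le_mul_eLpNorm_of_ae_le_mul (by simpa using h) _
  rw [ENNReal.ofReal_mul hc]
  exact h1.trans (by gcongr)

theorem sp_lp_add {Ω : Type*} [MeasurableSpace Ω] {μ : Measure Ω} {k : ℕ} {X Y : Ω → ℝ} {c d : ℝ}
    (hX : AEStronglyMeasurable X μ) (hY : AEStronglyMeasurable Y μ) (hc : 0 ≤ c) (hd : 0 ≤ d)
    (h1 : eLpNorm X (sp_p k) μ ≤ ENNReal.ofReal c)
    (h2 : eLpNorm Y (sp_p k) μ ≤ ENNReal.ofReal d) :
    eLpNorm (fun ω => X ω + Y ω) (sp_p k) μ ≤ ENNReal.ofReal (c + d) := by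
  rw [ENNReal.ofReal_add hc hd]
  exact (eLpNorm_add_le hX hY (sp_p_one k)).trans (add_le_add h1 h2)

theorem sp_lp_sum {Ω : Type*} [MeasurableSpace Ω] {μ : Measure Ω} {k : ℕ} (N : ℕ)
    {X : ℕ → Ω → ℝ} {c : ℝ} (hX : ∀ i, AEStronglyMeasurable (X i) μ)
    (h : ∀ i, eLpNorm (X i) (sp_p k) μ ≤ ENNReal.ofReal c) :
    eLpNorm (fun ω => ∑ i ∈ Finset.range N, X i ω) (sp_p k) μ ≤ ENNReal.ofReal (N * c) := by
  have e : (fun ω => ∑ i ∈ Finset.range N, X i ω) = ∑ i ∈ Finset.range N, X i := by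
    ext ω; simp
  rw [e]
  refine (eLpNorm_sum_le (fun i _ => hX i) (sp_p_one k)).trans ?_
  refine (Finset.sum_le_sum fun i _ => h i).trans (le_of_eq ?_)
  rw [Finset.sum_const, Finset.card_range, nsmul_eq_mul, ENNReal.ofReal_mul (by positivity),
          ENNReal.ofReal_natCast]

/-- The pair of adapted drifts, together with a localisation indicator `J`. -/
structure SPPath {Ω : Type*} [MeasurableSpace Ω] (F : ℝ → MeasurableSpace Ω)
    (ψ1 ψ2 J : ℝ → Ω → ℝ) (S0 L Q : ℝ) : Prop where
  S0n : 0 ≤ S0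
  Ln : 0 ≤ L
  m1 : ∀ u, S0 ≤ u → Measurable[F u] (ψ1 u)
  m2 : ∀ u, S0 ≤ u → Measurable[F u] (ψ2 u)
  mJ : ∀ u, S0 ≤ u → Measurable[F u] (J u)
  b1 : ∀ u ω, |ψ1 u ω| ≤ Q
  b2 : ∀ u ω, |ψ2 u ω| ≤ Q
  J01 : ∀ u ω, J u ω = 0 ∨ J u ω = 1
  Janti : ∀ u v, S0 ≤ u → u ≤ v → ∀ ω, J v ω ≤ J u ω
  l1 : ∀ u v, S0 ≤ u → u ≤ v → ∀ ω, J v ω = 1 → |ψ1 v ω - ψ1 u ω| ≤ L * (v - u)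
  l2 : ∀ u v, S0 ≤ u → u ≤ v → ∀ ω, J v ω = 1 → |ψ2 v ω - ψ2 u ω| ≤ L * (v - u)

/-- Frozen increments. -/
def sp_V {Ω : Type*} (f : ℝ → ℝ → ℝ) (Z ψ1 ψ2 : ℝ → Ω → ℝ) (s m t : ℝ) : Ω → ℝ :=
  sp_U f Z m t (ψ1 s) (ψ2 s)

theorem sp_V_meas {Ω : Type*} [MeasurableSpace Ω] {μ : Measure Ω}
    {F : ℝ → MeasurableSpace Ω} {Z : ℝ → Ω → ℝ} {H κ : ℝ} (hN : SPNoise μ F Z H κ)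
    {ψ1 ψ2 J : ℝ → Ω → ℝ} {S0 L Q : ℝ} (hP : SPPath F ψ1 ψ2 J S0 L Q)
    {f : ℝ → ℝ → ℝ} (hf : Measurable fun p : ℝ × ℝ => f p.1 p.2)
    {s m t : ℝ} (hs : S0 ≤ s) (hsm : s ≤ m) (hmt : m ≤ t) :
    Measurable[F t] (sp_V f Z ψ1 ψ2 s m t) := by
  refine @sp_U_meas Ω (F t) f hf Z m t hmt hN.cont (fun u hu => ?_) _ _ ?_ ?_
  · exact (hN.adapt u (by linarith [hP.S0n, hu.1])).mono (hN.mono _ _ hu.2) le_rfl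
  · exact (hP.m1 s hs).mono (hN.mono _ _ (hsm.trans hmt)) le_rfl
  · exact (hP.m2 s hs).mono (hN.mono _ _ (hsm.trans hmt)) le_rfl

theorem sp_V_int {Ω : Type*} [MeasurableSpace Ω] {μ : Measure Ω} [IsProbabilityMeasure μ]
    {F : ℝ → MeasurableSpace Ω} {Z : ℝ → Ω → ℝ} {H κ : ℝ} (hN : SPNoise μ F Z H κ)
    {ψ1 ψ2 J : ℝ → Ω → ℝ} {S0 L Q : ℝ} (hP : SPPath F ψ1 ψ2 J S0 L Q)
    {f : ℝ → ℝ → ℝ} (hf : Measurable fun p : ℝ × ℝ => f p.1 p.2) {M : ℝ}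
    (hM : ∀ u x, |f u x| ≤ M)
    {s m t : ℝ} (hs : S0 ≤ s) (hsm : s ≤ m) (hmt : m ≤ t) :
    Integrable (sp_V f Z ψ1 ψ2 s m t) μ :=
  Integrable.of_bound
    ((sp_V_meas hN hP hf hs hsm hmt).mono (hN.le t) le_rfl).aestronglyMeasurable
    (2 * M * (t - m)) (by filter_upwards with ω; exact sp_U_bound hM hmt _ _ ω)

/-- The drift-type remainder. -/
def sp_T1 {Ω : Type*} [MeasurableSpace Ω] (μ : Measure Ω) (F : ℝ → MeasurableSpace Ω)
    (f : ℝ → ℝ → ℝ) (Z ψ1 ψ2 J : ℝ → Ω → ℝ) (s m t : ℝ) (ω : Ω) : ℝ :=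
  J m ω * (μ[fun ω => sp_V f Z ψ1 ψ2 m m t ω - sp_V f Z ψ1 ψ2 s m t ω|F m]) ω

/-- The localisation remainder. -/
def sp_T2 {Ω : Type*} [MeasurableSpace Ω] (μ : Measure Ω) (F : ℝ → MeasurableSpace Ω)
    (f : ℝ → ℝ → ℝ) (Z ψ1 ψ2 J : ℝ → Ω → ℝ) (s m t : ℝ) (ω : Ω) : ℝ :=
  (J s ω - J m ω) * (μ[sp_V f Z ψ1 ψ2 s m t|F m]) ω

/-- The martingale remainder. -/
def sp_T3 {Ω : Type*} [MeasurableSpace Ω] (μ : Measure Ω) (F : ℝ → MeasurableSpace Ω)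
    (f : ℝ → ℝ → ℝ) (Z ψ1 ψ2 J : ℝ → Ω → ℝ) (s m t : ℝ) (ω : Ω) : ℝ :=
  J s ω * ((μ[sp_V f Z ψ1 ψ2 s m t|F m]) ω - (μ[sp_V f Z ψ1 ψ2 s m t|F s]) ω)

/-- The germ. -/
def sp_A {Ω : Type*} [MeasurableSpace Ω] (μ : Measure Ω) (F : ℝ → MeasurableSpace Ω)
    (f : ℝ → ℝ → ℝ) (Z ψ1 ψ2 J : ℝ → Ω → ℝ) (s t : ℝ) (ω : Ω) : ℝ :=
  J s ω * (μ[sp_V f Z ψ1 ψ2 s s t|F s]) ω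

section
variable {Ω : Type*} [MeasurableSpace Ω] {μ : Measure Ω} [IsProbabilityMeasure μ]
    {F : ℝ → MeasurableSpace Ω} {Z : ℝ → Ω → ℝ} {H κ : ℝ}
    {ψ1 ψ2 J : ℝ → Ω → ℝ} {S0 L Q : ℝ}
    {f : ℝ → ℝ → ℝ} {M : ℝ}
    {s m t : ℝ}

theorem sp_A_split (hN : SPNoise μ F Z H κ) (hP : SPPath F ψ1 ψ2 J S0 L Q)
    (hf : Measurable fun p : ℝ × ℝ => f p.1 p.2)
    (hM : ∀ u x, |f u x| ≤ M) (hs : S0 ≤ s) (hsm : s ≤ m) (hmt : m ≤ t) :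
    ∀ᵐ ω ∂μ, sp_A μ F f Z ψ1 ψ2 J s m ω + sp_A μ F f Z ψ1 ψ2 J m t ω =
      sp_A μ F f Z ψ1 ψ2 J s t ω + (sp_T1 μ F f Z ψ1 ψ2 J s m t ω - sp_T2 μ F f Z ψ1 ψ2 J s m t ω +
        sp_T3 μ F f Z ψ1 ψ2 J s m t ω) := by
  have i1 := sp_V_int hN hP hf hM hs le_rfl hsm
  have i2 := sp_V_int hN hP hf hM hs hsm hmt
  have i3 := sp_V_int hN hP hf hM (hs.trans hsm) le_rfl hmt
  have e1 : sp_V f Z ψ1 ψ2 s s t = sp_V f Z ψ1 ψ2 s s m + sp_V f Z ψ1 ψ2 s m t := by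
    ext ω
    simp only [sp_V, sp_U, Pi.add_apply]
    rw [← Ioc_union_Ioc_eq_Ioc hsm hmt, setIntegral_union (Ioc_disjoint_Ioc_of_le le_rfl)
      measurableSet_Ioc]
    all_goals
      refine Integrable.of_bound (Measurable.aestronglyMeasurable ?_) (2 * M) ?_
      · refine Measurable.sub ?_ ?_ <;>
        exact hf.comp (measurable_id.prodMk ((hN.cont ω).measurable.add_const _))
      · filter_upwards with u
        have e1 := abs_le.1 (hM u (Z u ω + ψ1 s ω)); have e2 := abs_le.1 (hM u (Z u ω + ψ2 s ω))
        rw [norm_eq_abs, abs_le]; constructor <;> linarith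
  have c1 := condExp_add i1 i2 (F s)
  have c2 := condExp_sub i3 i2 (F m)
  rw [← e1] at c1
  filter_upwards [c1, c2] with ω h1 h2
  have h2' : (μ[fun ω => sp_V f Z ψ1 ψ2 m m t ω - sp_V f Z ψ1 ψ2 s m t ω|F m]) ω =
    (μ[sp_V f Z ψ1 ψ2 m m t|F m]) ω - (μ[sp_V f Z ψ1 ψ2 s m t|F m]) ω := h2
  simp only [sp_A, sp_T1, sp_T2, sp_T3, h1, h2', Pi.add_apply]
  ring

theorem sp_b_int (hN : SPNoise μ F Z H κ) (hP : SPPath F ψ1 ψ2 J S0 L Q) (hs : S0 ≤ s) :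
    Integrable (fun ω => |ψ1 s ω - ψ2 s ω|) μ := by
  have h1 := (hP.m1 s hs).mono (hN.le s) le_rfl
  have h2 := (hP.m2 s hs).mono (hN.le s) le_rfl
  refine Integrable.of_bound (h1.sub h2).abs.aestronglyMeasurable (2 * Q) ?_
  filter_upwards with ω
  have e1 := abs_le.1 (hP.b1 s ω); have e2 := abs_le.1 (hP.b2 s ω)
  rw [norm_eq_abs, abs_abs, abs_le]; constructor <;> linarith

theorem sp_V_cond (hN : SPNoise μ F Z H κ) (hP : SPPath F ψ1 ψ2 J S0 L Q)
    (hf : Measurable fun p : ℝ × ℝ => f p.1 p.2)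
    (hM : ∀ u x, |f u x| ≤ M) (hs : S0 ≤ s) (hsm : s ≤ m) (hmt : m ≤ t) :
    ∀ᵐ ω ∂μ, |(μ[sp_V f Z ψ1 ψ2 s m t|F m]) ω| ≤
      4 * M * κ⁻¹ * (t - m) ^ (1 - H) * |ψ1 s ω - ψ2 s ω| :=
  sp_cond1 hN hf hM (hP.S0n.trans (hs.trans hsm)) hmt
    ((hP.m1 s hs).mono (hN.mono _ _ hsm) le_rfl) ((hP.m2 s hs).mono (hN.mono _ _ hsm) le_rfl)
    (sp_b_int hN hP hs)

theorem sp_V_cond' (hN : SPNoise μ F Z H κ) (hP : SPPath F ψ1 ψ2 J S0 L Q)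
    (hf : Measurable fun p : ℝ × ℝ => f p.1 p.2)
    (hM : ∀ u x, |f u x| ≤ M) (hs : S0 ≤ s) (hsm : s ≤ m) (hmt : m ≤ t) :
    ∀ᵐ ω ∂μ, |(μ[sp_V f Z ψ1 ψ2 s m t|F s]) ω| ≤
      4 * M * κ⁻¹ * (t - m) ^ (1 - H) * |ψ1 s ω - ψ2 s ω| := by
  have h := sp_V_cond hN hP hf hM hs hsm hmt
  have i2 := sp_V_int hN hP hf hM hs hsm hmt
  have hi := (sp_b_int hN hP hs).const_mul (4 * M * κ⁻¹ * (t - m) ^ (1 - H))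
  refine sp_condExp_le (hN.le s) i2 hi ?_ fun A hA => ?_
  · exact (measurable_norm.comp ((hP.m1 s hs).sub (hP.m2 s hs))).const_mul _
  · rw [← setIntegral_condExp (hN.le m) i2 (hN.mono _ _ hsm A hA)]
    refine abs_integral_le_integral_abs.trans (integral_mono_of_nonneg ?_ hi.integrableOn ?_)
    · filter_upwards with ω; exact abs_nonneg _
    · exact ae_restrict_of_ae h

theorem sp_T1_le (hN : SPNoise μ F Z H κ) (hP : SPPath F ψ1 ψ2 J S0 L Q)
    (hf : Measurable fun p : ℝ × ℝ => f p.1 p.2)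
    (hM : ∀ u x, |f u x| ≤ M) (hs : S0 ≤ s) (hsm : s ≤ m) (hmt : m ≤ t) {k : ℕ} {K D : ℝ}
    (hK : 0 ≤ K) (hD : 0 ≤ D)
    (h1 : eLpNorm (fun ω => J m ω * ((ψ1 m ω - ψ2 m ω) - (ψ1 s ω - ψ2 s ω))) (sp_p k) μ ≤
      ENNReal.ofReal K)
    (h2 : eLpNorm (fun ω => J s ω * (ψ1 s ω - ψ2 s ω)) (sp_p k) μ ≤ ENNReal.ofReal D) :
    eLpNorm (sp_T1 μ F f Z ψ1 ψ2 J s m t) (sp_p k) μ ≤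
      ENNReal.ofReal (4 * M * κ⁻¹ * (t - m) ^ (1 - H) * K +
        16 * M * (κ ^ 2)⁻¹ * (t - m) ^ (1 - 2 * H) * (L * (m - s)) * D) := by
  have hM0 : 0 ≤ M := (abs_nonneg _).trans (hM 0 0)
  have hκ := hN.kpos
  have hL := hP.Ln
  have hm0 := hs.trans hsm
  have ms1 := hP.m1 s hs
  have ms2 := hP.m2 s hs
  have hp1 : 0 ≤ (t - m) ^ (1 - H) := rpow_nonneg (by linarith) _
  have hp2 : 0 ≤ (t - m) ^ (1 - 2 * H) := rpow_nonneg (by linarith) _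
  have hp3 : 0 ≤ m - s := by linarith
  have ns1 := ms1.mono (hN.le s) le_rfl
  have ns2 := ms2.mono (hN.le s) le_rfl
  have nm1 := (hP.m1 m hm0).mono (hN.le m) le_rfl
  have nm2 := (hP.m2 m hm0).mono (hN.le m) le_rfl
  have nJs := (hP.mJ s hs).mono (hN.le s) le_rfl
  have nJm := (hP.mJ m hm0).mono (hN.le m) le_rfl
  have hQ : ∀ u ω, |ψ1 u ω| ≤ Q ∧ |ψ2 u ω| ≤ Q := fun u ω => ⟨hP.b1 u ω, hP.b2 u ω⟩
  have hc := sp_cond2 hN hf hM (hP.S0n.trans hm0) hmt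
    (ms1.mono (hN.mono _ _ hsm) le_rfl) (ms2.mono (hN.mono _ _ hsm) le_rfl)
    (hP.m1 m hm0) (hP.m2 m hm0)
    (by
      refine Integrable.of_bound ((nm1.sub nm2).sub (ns1.sub ns2)).abs.aestronglyMeasurable
        (4 * Q) ?_
      filter_upwards with ω
      have e1 := abs_le.1 (hQ s ω).1; have e2 := abs_le.1 (hQ s ω).2
      have e3 := abs_le.1 (hQ m ω).1; have e4 := abs_le.1 (hQ m ω).2
      rw [norm_eq_abs, abs_abs, abs_le]; constructor <;> linarith)
    (by
      refine Integrable.of_bound ((ns1.sub ns2).abs.mul (nm2.sub ns2).abs).aestronglyMeasurable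
        ((2 * Q) * (2 * Q)) ?_
      filter_upwards with ω
      have e1 := abs_le.1 (hQ s ω).1; have e2 := abs_le.1 (hQ s ω).2
      have e4 := abs_le.1 (hQ m ω).2
      rw [norm_mul, norm_eq_abs, norm_eq_abs, abs_abs, abs_abs]
      refine mul_le_mul ?_ ?_ (abs_nonneg _) (by linarith) <;>
      · rw [abs_le]; constructor <;> linarith)
  have hdom : ∀ᵐ ω ∂μ, |sp_T1 μ F f Z ψ1 ψ2 J s m t ω| ≤ 1 *
      abs (4 * M * κ⁻¹ * (t - m) ^ (1 - H) * |J m ω * ((ψ1 m ω - ψ2 m ω) - (ψ1 s ω - ψ2 s ω))| +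
        16 * M * (κ ^ 2)⁻¹ * (t - m) ^ (1 - 2 * H) * (L * (m - s)) *
          |J s ω * (ψ1 s ω - ψ2 s ω)|) := by
    filter_upwards [hc] with ω hω
    rw [one_mul]
    refine le_trans ?_ (le_abs_self _)
    rcases hP.J01 m ω with hj | hj
    · rw [sp_T1, hj]; simp only [zero_mul, abs_zero, mul_zero, zero_add]; positivity
    · have hjs : J s ω = 1 := by
        rcases hP.J01 s ω with h | h
        · have := hP.Janti s m hs hsm ω; rw [hj, h] at this; linarith
        · exact h
      have hl := hP.l2 s m hs hsm ω hj
      rw [sp_T1, hj, hjs]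
      simp only [one_mul]
      refine hω.trans ?_
      rw [mul_assoc (16 * M * (κ ^ 2)⁻¹ * (t - m) ^ (1 - 2 * H)) (L * (m - s)),
        mul_comm (L * (m - s))]
      gcongr
  have key := sp_lp_mono (k := k) zero_le_one hdom (d := 4 * M * κ⁻¹ * (t - m) ^ (1 - H) * K +
        16 * M * (κ ^ 2)⁻¹ * (t - m) ^ (1 - 2 * H) * (L * (m - s)) * D) ?_
  · simpa using key
  · refine sp_lp_add ?_ ?_ (by positivity) (by positivity)
      (sp_lp_mono (by positivity) (Filter.Eventually.of_forall fun ω => ?_) h1)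
      (sp_lp_mono (by positivity) (Filter.Eventually.of_forall fun ω => ?_) h2)
    · exact ((nJm.mul ((nm1.sub nm2).sub (ns1.sub ns2))).abs.const_mul _).aestronglyMeasurable
    · exact ((nJs.mul (ns1.sub ns2)).abs.const_mul _).aestronglyMeasurable
    · rw [abs_of_nonneg (by positivity)]
    · rw [abs_of_nonneg (by positivity)]

end

set_option linter.unusedSectionVars false

section
variable {Ω : Type*} [MeasurableSpace Ω] {μ : Measure Ω} [IsProbabilityMeasure μ]
    {F : ℝ → MeasurableSpace Ω} {Z : ℝ → Ω → ℝ} {H κ : ℝ}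
    {ψ1 ψ2 J : ℝ → Ω → ℝ} {S0 L Q : ℝ}
    {f : ℝ → ℝ → ℝ} {M : ℝ}
    {s m t : ℝ}

theorem sp_T3_meas (hN : SPNoise μ F Z H κ) (hP : SPPath F ψ1 ψ2 J S0 L Q)
    (hs : S0 ≤ s) (hsm : s ≤ m) :
    StronglyMeasurable[F m] (sp_T3 μ F f Z ψ1 ψ2 J s m t) := by
  have h1 : StronglyMeasurable[F m] (J s) :=
    ((hP.mJ s hs).stronglyMeasurable).mono (hN.mono _ _ hsm)
  have h2 : StronglyMeasurable[F m] (μ[sp_V f Z ψ1 ψ2 s m t|F m]) := stronglyMeasurable_condExp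
  have h3 : StronglyMeasurable[F m] (μ[sp_V f Z ψ1 ψ2 s m t|F s]) :=
    stronglyMeasurable_condExp.mono (hN.mono _ _ hsm)
  exact h1.mul (h2.sub h3)

theorem sp_T1_meas (hN : SPNoise μ F Z H κ) (hP : SPPath F ψ1 ψ2 J S0 L Q)
    (hm : S0 ≤ m) : StronglyMeasurable (sp_T1 μ F f Z ψ1 ψ2 J s m t) := by
  have h1 : StronglyMeasurable[F m] (J m) := (hP.mJ m hm).stronglyMeasurable
  exact (h1.mul stronglyMeasurable_condExp).mono (hN.le m)

theorem sp_T2_meas (hN : SPNoise μ F Z H κ) (hP : SPPath F ψ1 ψ2 J S0 L Q)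
    (hs : S0 ≤ s) (hsm : s ≤ m) : StronglyMeasurable (sp_T2 μ F f Z ψ1 ψ2 J s m t) := by
  have h1 : StronglyMeasurable[F m] (J s) :=
    ((hP.mJ s hs).stronglyMeasurable).mono (hN.mono _ _ hsm)
  have h2 : StronglyMeasurable[F m] (J m) := (hP.mJ m (hs.trans hsm)).stronglyMeasurable
  exact ((h1.sub h2).mul stronglyMeasurable_condExp).mono (hN.le m)

theorem sp_A_meas (hN : SPNoise μ F Z H κ) (hP : SPPath F ψ1 ψ2 J S0 L Q)
    (hs : S0 ≤ s) : StronglyMeasurable (sp_A μ F f Z ψ1 ψ2 J s t) := by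
  have h1 : StronglyMeasurable[F s] (J s) := (hP.mJ s hs).stronglyMeasurable
  exact (h1.mul stronglyMeasurable_condExp).mono (hN.le s)

theorem sp_T3_bound (hN : SPNoise μ F Z H κ) (hP : SPPath F ψ1 ψ2 J S0 L Q)
    (hf : Measurable fun p : ℝ × ℝ => f p.1 p.2)
    (hM : ∀ u x, |f u x| ≤ M) (hs : S0 ≤ s) (hsm : s ≤ m) (hmt : m ≤ t) :
    ∀ᵐ ω ∂μ, |sp_T3 μ F f Z ψ1 ψ2 J s m t ω| ≤
      (2 * (4 * M * κ⁻¹ * (t - m) ^ (1 - H))) * |J s ω * (ψ1 s ω - ψ2 s ω)| := by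
  filter_upwards [sp_V_cond hN hP hf hM hs hsm hmt, sp_V_cond' hN hP hf hM hs hsm hmt] with ω h1 h2
  rw [sp_T3, abs_mul, abs_mul, ← mul_assoc, mul_comm _ |J s ω|, mul_assoc]
  gcongr
  refine (abs_sub _ _).trans ?_
  linarith

theorem sp_T3_cond (hN : SPNoise μ F Z H κ) (hP : SPPath F ψ1 ψ2 J S0 L Q)
    (hs : S0 ≤ s) (hsm : s ≤ m) :
    μ[sp_T3 μ F f Z ψ1 ψ2 J s m t|F s] =ᵐ[μ] 0 := by
  set V := sp_V f Z ψ1 ψ2 s m t with hV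
  have h1 : StronglyMeasurable[F s] (J s) := (hP.mJ s hs).stronglyMeasurable
  have hi : Integrable (μ[V|F m] - μ[V|F s]) μ := integrable_condExp.sub integrable_condExp
  have hi2 : Integrable (J s * (μ[V|F m] - μ[V|F s])) μ := by
    refine hi.bdd_mul (c := 1) ((h1.mono (hN.le s)).aestronglyMeasurable) ?_
    filter_upwards with ω
    rcases hP.J01 s ω with h | h <;> rw [h] <;> simp
  have e1 := condExp_mul_of_stronglyMeasurable_left (μ := μ) h1 hi2 hi
  have e2 := condExp_sub (μ := μ) (integrable_condExp (m := F m) (f := V))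
    (integrable_condExp (m := F s) (f := V)) (F s)
  have e3 : μ[μ[V|F m]|F s] =ᵐ[μ] μ[V|F s] := condExp_condExp_of_le (hN.mono _ _ hsm) (hN.le m)
  have e4 : μ[μ[V|F s]|F s] = μ[V|F s] :=
    condExp_of_stronglyMeasurable (hN.le s) stronglyMeasurable_condExp integrable_condExp
  have e5 : sp_T3 μ F f Z ψ1 ψ2 J s m t = J s * (μ[V|F m] - μ[V|F s]) := rfl
  rw [e5]
  filter_upwards [e1, e2, e3] with ω h1 h2 h3
  rw [h1, Pi.mul_apply, h2, Pi.sub_apply, h3, e4]; simp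

theorem sp_level (hN : SPNoise μ F Z H κ) (hP : SPPath F ψ1 ψ2 J S0 L Q)
    (hf : Measurable fun p : ℝ × ℝ => f p.1 p.2)
    (hM : ∀ u x, |f u x| ≤ M) (hs : S0 ≤ s) {k : ℕ} {K D : ℝ} (hK : 0 ≤ K) (hD : 0 ≤ D)
    (h1 : ∀ u v, s ≤ u → u ≤ v → eLpNorm (fun ω => J v ω * ((ψ1 v ω - ψ2 v ω) -
      (ψ1 u ω - ψ2 u ω))) (sp_p k) μ ≤ ENNReal.ofReal (K * (v - u) ^ (1 - H)))
    (h2 : ∀ u, s ≤ u → eLpNorm (fun ω => J u ω * (ψ1 u ω - ψ2 u ω)) (sp_p k) μ ≤ ENNReal.ofReal D)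
    (N : ℕ) (hN1 : 1 ≤ N) {Δ : ℝ} (hΔ : 0 ≤ Δ) :
    eLpNorm (fun ω => ∑ i ∈ Finset.range N,
      (sp_T1 μ F f Z ψ1 ψ2 J (s + (2 * i : ℕ) * Δ) (s + (2 * i + 1 : ℕ) * Δ)
          (s + (2 * i + 2 : ℕ) * Δ) ω -
        sp_T2 μ F f Z ψ1 ψ2 J (s + (2 * i : ℕ) * Δ) (s + (2 * i + 1 : ℕ) * Δ)
          (s + (2 * i + 2 : ℕ) * Δ) ω +
        sp_T3 μ F f Z ψ1 ψ2 J (s + (2 * i : ℕ) * Δ) (s + (2 * i + 1 : ℕ) * Δ)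
          (s + (2 * i + 2 : ℕ) * Δ) ω)) (sp_p k) μ ≤
      ENNReal.ofReal (N * (4 * M * κ⁻¹ * Δ ^ (1 - H) * (K * Δ ^ (1 - H)) +
        16 * M * (κ ^ 2)⁻¹ * Δ ^ (1 - 2 * H) * (L * Δ) * D) +
        (4 * M * κ⁻¹ * Δ ^ (1 - H)) * (√N * D) +
        sp_Cb k * √N * (2 * (4 * M * κ⁻¹ * Δ ^ (1 - H)) * D)) := by
  have hM0 : 0 ≤ M := (abs_nonneg _).trans (hM 0 0)
  have hκ := hN.kpos
  have hL := hP.Ln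
  have hCb := sp_Cb_one k
  set p : ℕ → ℝ := fun i => s + i * Δ with hp
  have hpm : ∀ i j, i ≤ j → p i ≤ p j := by
    intro i j hij
    have : (i:ℝ) ≤ j := by exact_mod_cast hij
    simp only [hp]; nlinarith
  have hps : ∀ i, s ≤ p i := fun i => by
    have := hpm 0 i (Nat.zero_le _); simp only [hp] at this ⊢; simpa using this
  have hpS : ∀ i, S0 ≤ p i := fun i => hs.trans (hps i)
  have hd1 : ∀ i, p (2 * i + 1) - p (2 * i) = Δ := fun i => by simp only [hp]; push_cast; ring
  have hd2 : ∀ i, p (2 * i + 2) - p (2 * i + 1) = Δ := fun i => by simp only [hp]; push_cast; ring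
  have m1 : ∀ i, AEStronglyMeasurable (sp_T1 μ F f Z ψ1 ψ2 J (p (2 * i)) (p (2 * i + 1))
      (p (2 * i + 2))) μ := fun i => (sp_T1_meas hN hP (hpS _)).aestronglyMeasurable
  have m2 : ∀ i, AEStronglyMeasurable (sp_T2 μ F f Z ψ1 ψ2 J (p (2 * i)) (p (2 * i + 1))
      (p (2 * i + 2))) μ := fun i =>
    (sp_T2_meas hN hP (hpS _) (hpm _ _ (by omega))).aestronglyMeasurable
  have m3' : ∀ i, StronglyMeasurable[F (p (2 * i + 1))] (sp_T3 μ F f Z ψ1 ψ2 J (p (2 * i))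
      (p (2 * i + 1)) (p (2 * i + 2))) := fun i => sp_T3_meas hN hP (hpS _) (hpm _ _ (by omega))
  have m3 : ∀ i, AEStronglyMeasurable (sp_T3 μ F f Z ψ1 ψ2 J (p (2 * i)) (p (2 * i + 1))
      (p (2 * i + 2))) μ := fun i => ((m3' i).mono (hN.le _)).aestronglyMeasurable
  have hα : 0 ≤ Δ ^ (1 - H) := rpow_nonneg hΔ _
  have hα2 : 0 ≤ Δ ^ (1 - 2 * H) := rpow_nonneg hΔ _
  -- first part
  have E1 : eLpNorm (fun ω => ∑ i ∈ Finset.range N, sp_T1 μ F f Z ψ1 ψ2 J (p (2 * i))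
      (p (2 * i + 1)) (p (2 * i + 2)) ω) (sp_p k) μ ≤
      ENNReal.ofReal (N * (4 * M * κ⁻¹ * Δ ^ (1 - H) * (K * Δ ^ (1 - H)) +
        16 * M * (κ ^ 2)⁻¹ * Δ ^ (1 - 2 * H) * (L * Δ) * D)) := by
    refine sp_lp_sum N m1 fun i => ?_
    have := sp_T1_le hN hP hf hM (hpS (2 * i)) (hpm (2 * i) (2 * i + 1) (by omega))
      (hpm (2 * i + 1) (2 * i + 2) (by omega)) (k := k) (K := K * Δ ^ (1 - H)) (D := D)
      (by positivity) hD (by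
        have := h1 (p (2 * i)) (p (2 * i + 1)) (hps _) (hpm _ _ (by omega))
        rwa [hd1] at this) (h2 _ (hps _))
    rwa [hd1, hd2] at this
  -- second part
  have E2 : eLpNorm (fun ω => ∑ i ∈ Finset.range N, sp_T2 μ F f Z ψ1 ψ2 J (p (2 * i))
      (p (2 * i + 1)) (p (2 * i + 2)) ω) (sp_p k) μ ≤
      ENNReal.ofReal ((4 * M * κ⁻¹ * Δ ^ (1 - H)) * (√N * D)) := by
    have hw : ∀ i ω, J (p (2 * i)) ω - J (p (2 * i + 1)) ω = 0 ∨
        J (p (2 * i)) ω - J (p (2 * i + 1)) ω = 1 := by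
      intro i ω
      have := hP.Janti (p (2 * i)) (p (2 * i + 1)) (hpS _) (hpm _ _ (by omega)) ω
      rcases hP.J01 (p (2 * i)) ω with h | h <;> rcases hP.J01 (p (2 * i + 1)) ω with h' | h' <;>
        first | (exfalso; linarith) | (left; linarith) | (right; linarith)
    have hw0 : ∀ i ω, 0 ≤ J (p (2 * i)) ω - J (p (2 * i + 1)) ω := fun i ω => by
      rcases hw i ω with h | h <;> linarith
    have nm : ∀ i, Measurable (fun ω => (J (p (2 * i)) ω - J (p (2 * i + 1)) ω) *
        |ψ1 (p (2 * i)) ω - ψ2 (p (2 * i)) ω|) := fun i =>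
      (((hP.mJ _ (hpS _)).mono (hN.le _) le_rfl).sub ((hP.mJ _ (hpS _)).mono (hN.le _) le_rfl)).mul
      (((hP.m1 _ (hpS _)).mono (hN.le _) le_rfl).sub ((hP.m2 _ (hpS _)).mono (hN.le _) le_rfl)).abs
    have hx := sp_one_term_lp (μ := μ) k N hN1
      (fun i ω => J (p (2 * i)) ω - J (p (2 * i + 1)) ω)
      (fun i ω => |ψ1 (p (2 * i)) ω - ψ2 (p (2 * i)) ω|) hw (fun ω => by
        have h3 : ∀ n, ∑ i ∈ Finset.range n, (J (p (2 * i)) ω - J (p (2 * i + 1)) ω) ≤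
          J (p 0) ω - J (p (2 * n)) ω := by
          intro n
          induction n with
          | zero => simp
          | succ n ih =>
            rw [Finset.sum_range_succ]
            have := hP.Janti (p (2 * n + 1)) (p (2 * (n + 1))) (hpS _) (hpm _ _ (by omega)) ω
            linarith
        refine (h3 N).trans ?_
        rcases hP.J01 (p 0) ω with h | h <;> rcases hP.J01 (p (2 * N)) ω with h' | h' <;>
          rw [h, h'] <;> norm_num) hD nm (fun i => by
        have := sp_lp_mono (k := k) (μ := μ) zero_le_one (Filter.Eventually.of_forall fun ω => ?_)
          (h2 (p (2 * i)) (hps _))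
          (X := fun ω => (J (p (2 * i)) ω - J (p (2 * i + 1)) ω) *
            |ψ1 (p (2 * i)) ω - ψ2 (p (2 * i)) ω|)
        · simpa using this
        · rw [one_mul, abs_mul, abs_mul, abs_abs]
          gcongr ?_ * _
          rw [abs_of_nonneg (hw0 i ω)]
          refine le_trans ?_ (le_abs_self _)
          rcases hP.J01 (p (2 * i + 1)) ω with h | h <;> rw [h] <;> linarith)
    refine sp_lp_mono (by positivity) ?_ hx
    have hall : ∀ᵐ ω ∂μ, ∀ i : ℕ, |(μ[sp_V f Z ψ1 ψ2 (p (2 * i)) (p (2 * i + 1))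
        (p (2 * i + 2))|F (p (2 * i + 1))]) ω| ≤
        4 * M * κ⁻¹ * Δ ^ (1 - H) * |ψ1 (p (2 * i)) ω - ψ2 (p (2 * i)) ω| := by
      refine ae_all_iff.2 fun i => ?_
      have := sp_V_cond hN hP hf hM (hpS (2 * i)) (hpm (2 * i) (2 * i + 1) (by omega))
        (hpm (2 * i + 1) (2 * i + 2) (by omega))
      rwa [hd2] at this
    filter_upwards [hall] with ω hω
    rw [abs_of_nonneg (a := ∑ i ∈ Finset.range N, (J (p (2 * i)) ω - J (p (2 * i + 1)) ω) *
      |ψ1 (p (2 * i)) ω - ψ2 (p (2 * i)) ω|)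
      (Finset.sum_nonneg fun i _ => mul_nonneg (hw0 i ω) (abs_nonneg _))]
    refine (Finset.abs_sum_le_sum_abs _ _).trans ?_
    rw [Finset.mul_sum]
    refine Finset.sum_le_sum fun i _ => ?_
    rw [sp_T2, abs_mul, abs_of_nonneg (hw0 i ω)]
    calc _ ≤ (J (p (2 * i)) ω - J (p (2 * i + 1)) ω) *
        (4 * M * κ⁻¹ * Δ ^ (1 - H) * |ψ1 (p (2 * i)) ω - ψ2 (p (2 * i)) ω|) :=
          mul_le_mul_of_nonneg_left (hω i) (hw0 i ω)
      _ = _ := by ring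
  -- third part
  have E3 : eLpNorm (fun ω => ∑ i ∈ Finset.range N, sp_T3 μ F f Z ψ1 ψ2 J (p (2 * i))
      (p (2 * i + 1)) (p (2 * i + 2)) ω) (sp_p k) μ ≤
      ENNReal.ofReal (sp_Cb k * √N * (2 * (4 * M * κ⁻¹ * Δ ^ (1 - H)) * D)) := by
    have hb : ∀ i, ∀ᵐ ω ∂μ, |sp_T3 μ F f Z ψ1 ψ2 J (p (2 * i)) (p (2 * i + 1)) (p (2 * i + 2)) ω| ≤
      (2 * (4 * M * κ⁻¹ * Δ ^ (1 - H))) *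
        |J (p (2 * i)) ω * (ψ1 (p (2 * i)) ω - ψ2 (p (2 * i)) ω)| := by
      intro i
      have := sp_T3_bound hN hP hf hM (hpS (2 * i)) (hpm (2 * i) (2 * i + 1) (by omega))
        (hpm (2 * i + 1) (2 * i + 2) (by omega))
      rwa [hd2] at this
    refine sp_bdg_lp k N hN1 (fun i => F (p (2 * i))) (fun i => hN.le _)
      (fun i j hij => hN.mono _ _ (hpm _ _ (by omega)))
      (fun i => sp_T3 μ F f Z ψ1 ψ2 J (p (2 * i)) (p (2 * i + 1)) (p (2 * i + 2)))
      (fun i => (m3' i).mono (hN.mono _ _ (hpm _ _ (by omega))))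
      (c := (2 * (4 * M * κ⁻¹ * Δ ^ (1 - H))) * (2 * Q))
      (by positivity) (fun i => ?_) (fun i => ?_) (fun i => ?_)
    · filter_upwards [hb i] with ω hω
      refine hω.trans ?_
      gcongr
      have e1 := abs_le.1 (hP.b1 (p (2 * i)) ω); have e2 := abs_le.1 (hP.b2 (p (2 * i)) ω)
      rcases hP.J01 (p (2 * i)) ω with h | h
      · rw [h]; simp only [zero_mul, abs_zero]; linarith
      · rw [h, one_mul, abs_le]; constructor <;> linarith
    · exact sp_T3_cond hN hP (hpS _) (hpm _ _ (by omega))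
    · exact sp_lp_mono (by positivity) (hb i) (h2 _ (hps _))
  have ms : ∀ X : ℕ → Ω → ℝ, (∀ i, AEStronglyMeasurable (X i) μ) →
      AEStronglyMeasurable (fun ω => ∑ i ∈ Finset.range N, X i ω) μ := fun X hX =>
    Finset.aestronglyMeasurable_fun_sum _ fun i _ => hX i
  have E2' : eLpNorm (fun ω => -∑ i ∈ Finset.range N, sp_T2 μ F f Z ψ1 ψ2 J (p (2 * i))
      (p (2 * i + 1)) (p (2 * i + 2)) ω) (sp_p k) μ ≤
      ENNReal.ofReal ((4 * M * κ⁻¹ * Δ ^ (1 - H)) * (√N * D)) := by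
    have := eLpNorm_neg (fun ω => ∑ i ∈ Finset.range N, sp_T2 μ F f Z ψ1 ψ2 J (p (2 * i))
      (p (2 * i + 1)) (p (2 * i + 2)) ω) (sp_p k) μ
    exact (le_of_eq this).trans E2
  have fin := sp_lp_add ((ms _ m1).add (ms _ m2).neg) (ms _ m3) (by positivity) (by positivity)
    (sp_lp_add (ms _ m1) (ms _ m2).neg (by positivity) (by positivity) E1 E2') E3
  refine le_trans (le_of_eq ?_) fin
  congr 1
  ext ω
  rw [Finset.sum_add_distrib, Finset.sum_sub_distrib, sub_eq_add_neg]
  rfl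

end

set_option linter.unusedSectionVars false

theorem sp_dyadic {H h : ℝ} (hH : H < 1 / 6) (hh : 0 ≤ h) (n : ℕ) :
    √((2 ^ n : ℕ) : ℝ) * (h / 2 ^ (n + 1)) ^ (1 - H) ≤ (4 / 5) ^ n * h ^ (1 - H) := by
  have h1 : ((1:ℝ) / 2 ^ (n + 1)) ^ (1 - H) ≤ ((1 / 2 : ℝ) ^ (5 / 6 : ℝ)) ^ n := by
    calc ((1:ℝ) / 2 ^ (n + 1)) ^ (1 - H) ≤ ((1:ℝ) / 2 ^ (n + 1)) ^ (5 / 6 : ℝ) := by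
          refine rpow_le_rpow_of_exponent_ge (by positivity) ?_ (by linarith)
          rw [div_le_one (by positivity)]; exact one_le_pow₀ (by norm_num)
      _ ≤ ((1 / 2 : ℝ) ^ n) ^ (5 / 6 : ℝ) := by
          refine rpow_le_rpow (by positivity) ?_ (by norm_num)
          rw [one_div_pow]
          exact one_div_le_one_div_of_le (by positivity)
            (pow_le_pow_right₀ (by norm_num) (by omega))
      _ = _ := by
          rw [← rpow_natCast, ← rpow_mul (by norm_num), mul_comm, rpow_mul (by norm_num),
            rpow_natCast]
  have h2 : √((2 ^ n : ℕ) : ℝ) = √2 ^ n := by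
    push_cast
    rw [Real.sqrt_eq_iff_mul_self_eq (by positivity) (by positivity), ← mul_pow,
      Real.mul_self_sqrt (by norm_num)]
  have h3 : √2 * (1 / 2 : ℝ) ^ (5 / 6 : ℝ) ≤ 4 / 5 := by
    have e : (√2 * (1 / 2 : ℝ) ^ (5 / 6 : ℝ)) ^ 6 ≤ (4 / 5 : ℝ) ^ 6 := by
      rw [mul_pow, show √2 ^ 6 = (√2 ^ 2) ^ 3 by ring, Real.sq_sqrt (by norm_num),
        ← rpow_natCast ((1 / 2 : ℝ) ^ (5 / 6 : ℝ)) 6, ← rpow_mul (by norm_num)]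
      have : (5 / 6 : ℝ) * ((6 : ℕ) : ℝ) = ((5 : ℕ) : ℝ) := by norm_num
      rw [this, rpow_natCast]
      norm_num
    exact le_of_pow_le_pow_left₀ (by norm_num) (by norm_num) e
  rw [div_eq_mul_one_div, mul_rpow hh (by positivity), h2]
  calc √2 ^ n * (h ^ (1 - H) * (1 / 2 ^ (n + 1)) ^ (1 - H))
      ≤ √2 ^ n * (h ^ (1 - H) * ((1 / 2 : ℝ) ^ (5 / 6 : ℝ)) ^ n) := by gcongr
    _ = (√2 * (1 / 2 : ℝ) ^ (5 / 6 : ℝ)) ^ n * h ^ (1 - H) := by rw [mul_pow]; ring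
    _ ≤ _ := by gcongr

section
variable {Ω : Type*} [MeasurableSpace Ω] {μ : Measure Ω} [IsProbabilityMeasure μ]
    {F : ℝ → MeasurableSpace Ω} {Z : ℝ → Ω → ℝ} {H κ : ℝ}
    {ψ1 ψ2 J : ℝ → Ω → ℝ} {S0 L Q : ℝ}
    {f : ℝ → ℝ → ℝ} {M : ℝ}
    {s m t : ℝ}

/-- Riemann-type sums of the germ. -/
def sp_Sg (μ : Measure Ω) (F : ℝ → MeasurableSpace Ω)
    (f : ℝ → ℝ → ℝ) (Z ψ1 ψ2 J : ℝ → Ω → ℝ) (s : ℝ) (N : ℕ) (Δ : ℝ) (ω : Ω) : ℝ :=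
  ∑ i ∈ Finset.range N, sp_A μ F f Z ψ1 ψ2 J (s + (i : ℕ) * Δ) (s + (i + 1 : ℕ) * Δ) ω

theorem sp_sum_even_odd (a : ℕ → ℝ) (N : ℕ) :
    ∑ i ∈ Finset.range (2 * N), a i = ∑ i ∈ Finset.range N, (a (2 * i) + a (2 * i + 1)) := by
  induction N with
  | zero => simp
  | succ n ih => rw [show 2 * (n + 1) = 2 * n + 1 + 1 by ring, Finset.sum_range_succ,
      Finset.sum_range_succ, Finset.sum_range_succ, ih]; ring

theorem sp_Sg_succ (hN : SPNoise μ F Z H κ) (hP : SPPath F ψ1 ψ2 J S0 L Q)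
    (hf : Measurable fun p : ℝ × ℝ => f p.1 p.2)
    (hM : ∀ u x, |f u x| ≤ M) (hs : S0 ≤ s) (N : ℕ) {Δ : ℝ} (hΔ : 0 ≤ Δ) :
    ∀ᵐ ω ∂μ, sp_Sg μ F f Z ψ1 ψ2 J s (2 * N) Δ ω = sp_Sg μ F f Z ψ1 ψ2 J s N (2 * Δ) ω +
      ∑ i ∈ Finset.range N,
      (sp_T1 μ F f Z ψ1 ψ2 J (s + (2 * i : ℕ) * Δ) (s + (2 * i + 1 : ℕ) * Δ)
          (s + (2 * i + 2 : ℕ) * Δ) ω -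
        sp_T2 μ F f Z ψ1 ψ2 J (s + (2 * i : ℕ) * Δ) (s + (2 * i + 1 : ℕ) * Δ)
          (s + (2 * i + 2 : ℕ) * Δ) ω +
        sp_T3 μ F f Z ψ1 ψ2 J (s + (2 * i : ℕ) * Δ) (s + (2 * i + 1 : ℕ) * Δ)
          (s + (2 * i + 2 : ℕ) * Δ) ω) := by
  have hall : ∀ᵐ ω ∂μ, ∀ i : ℕ, _ := ae_all_iff.2 fun i =>
    sp_A_split hN hP hf hM (s := s + (2 * i : ℕ) * Δ) (m := s + (2 * i + 1 : ℕ) * Δ)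
      (t := s + (2 * i + 2 : ℕ) * Δ) (by
        have : 0 ≤ ((2 * i : ℕ) : ℝ) * Δ := by positivity
        linarith) (by push_cast; nlinarith) (by push_cast; nlinarith)
  filter_upwards [hall] with ω hω
  rw [sp_Sg, sp_Sg, sp_sum_even_odd, ← Finset.sum_add_distrib]
  refine Finset.sum_congr rfl fun i _ => ?_
  have e1 : s + (i : ℕ) * (2 * Δ) = s + (2 * i : ℕ) * Δ := by push_cast; ring
  have e2 : s + (i + 1 : ℕ) * (2 * Δ) = s + (2 * i + 2 : ℕ) * Δ := by push_cast; ring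
  rw [e1, e2]
  exact hω i

/-- The sewing bound. -/
def sp_B (k : ℕ) (M κ H L K D h : ℝ) : ℝ :=
  (4 * M * κ⁻¹ * K + 16 * M * (κ ^ 2)⁻¹ * L * D) * (h ^ (1 - H) * h ^ (1 - H)) +
    (1 + 2 * sp_Cb k) * (4 * M * κ⁻¹) * D * h ^ (1 - H)

theorem sp_Sg_bound (hN : SPNoise μ F Z H κ) (hP : SPPath F ψ1 ψ2 J S0 L Q)
    (hf : Measurable fun p : ℝ × ℝ => f p.1 p.2)
    (hM : ∀ u x, |f u x| ≤ M) (hs : S0 ≤ s) {k : ℕ} {K D : ℝ} (hK : 0 ≤ K) (hD : 0 ≤ D)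
    (h1 : ∀ u v, s ≤ u → u ≤ v → eLpNorm (fun ω => J v ω * ((ψ1 v ω - ψ2 v ω) -
      (ψ1 u ω - ψ2 u ω))) (sp_p k) μ ≤ ENNReal.ofReal (K * (v - u) ^ (1 - H)))
    (h2 : ∀ u, s ≤ u → eLpNorm (fun ω => J u ω * (ψ1 u ω - ψ2 u ω)) (sp_p k) μ ≤ ENNReal.ofReal D)
    {h : ℝ} (hh : 0 < h) (n : ℕ) :
    eLpNorm (sp_Sg μ F f Z ψ1 ψ2 J s (2 ^ n) (h / 2 ^ n)) (sp_p k) μ ≤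
      ENNReal.ofReal (4 * M * κ⁻¹ * h ^ (1 - H) * D +
        5 * (1 - (4 / 5) ^ n) * sp_B k M κ H L K D h) := by
  have hM0 : 0 ≤ M := (abs_nonneg _).trans (hM 0 0)
  have hκ := hN.kpos
  have hL := hP.Ln
  have hCb := sp_Cb_one k
  have hB : 0 ≤ sp_B k M κ H L K D h := by unfold sp_B; positivity
  induction n with
  | zero =>
    have e : sp_Sg μ F f Z ψ1 ψ2 J s (2 ^ 0) (h / 2 ^ 0) = sp_A μ F f Z ψ1 ψ2 J s (s + h) := by
      ext ω; simp [sp_Sg]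
    rw [e]
    have hc := sp_V_cond hN hP hf hM hs le_rfl (by linarith : s ≤ s + h)
    have := sp_lp_mono (X := sp_A μ F f Z ψ1 ψ2 J s (s + h)) (c := 4 * M * κ⁻¹ * h ^ (1 - H))
      (by positivity) ?_ (h2 s le_rfl)
    · simpa using this
    · filter_upwards [hc] with ω hω
      rw [sp_A, abs_mul, abs_mul]
      rw [add_sub_cancel_left] at hω
      calc _ ≤ |J s ω| * (4 * M * κ⁻¹ * h ^ (1 - H) * |ψ1 s ω - ψ2 s ω|) := by gcongr
        _ = _ := by ring
  | succ n ih =>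
    have hΔ : 0 ≤ h / 2 ^ (n + 1) := by positivity
    have hsucc := sp_Sg_succ hN hP hf hM hs (2 ^ n) hΔ
    have hlev := sp_level hN hP hf hM hs hK hD h1 h2 (2 ^ n) Nat.one_le_two_pow hΔ
    have e1 : 2 * (h / 2 ^ (n + 1)) = h / 2 ^ n := by rw [pow_succ]; field_simp
    have e2 : 2 * 2 ^ n = 2 ^ (n + 1) := by ring
    rw [e1, e2] at hsucc
    rw [eLpNorm_congr_ae hsucc]
    have hd := sp_dyadic hN.Hlt hh.le n
    set Δ := h / 2 ^ (n + 1) with hΔd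
    have hΔp : 0 < Δ := by positivity
    set a := √((2 ^ n : ℕ) : ℝ) * Δ ^ (1 - H) with ha
    have ha0 : 0 ≤ a := by positivity
    have haN : a * a = (2 ^ n : ℕ) * (Δ ^ (1 - H) * Δ ^ (1 - H)) := by
      have : √((2 ^ n : ℕ) : ℝ) * √((2 ^ n : ℕ) : ℝ) = ((2 ^ n : ℕ) : ℝ) :=
        Real.mul_self_sqrt (by positivity)
      rw [← this, ha]; ring
    have hα2 : Δ ^ (1 - 2 * H) * Δ = Δ ^ (1 - H) * Δ ^ (1 - H) := by
      rw [← rpow_add hΔp]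
      nth_rewrite 2 [← rpow_one Δ]
      rw [← rpow_add hΔp]; congr 1; ring
    have h45 : (4 / 5 : ℝ) ^ n ≤ 1 := pow_le_one₀ (by norm_num) (by norm_num)
    have haa : a * a ≤ (4 / 5) ^ n * (h ^ (1 - H) * h ^ (1 - H)) := by
      calc a * a ≤ ((4 / 5) ^ n * h ^ (1 - H)) * ((4 / 5) ^ n * h ^ (1 - H)) := by gcongr
        _ = (4 / 5) ^ n * ((4 / 5) ^ n * (h ^ (1 - H) * h ^ (1 - H))) := by ring
        _ ≤ (4 / 5) ^ n * (1 * (h ^ (1 - H) * h ^ (1 - H))) := by gcongr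
        _ = _ := by ring
    have hfin : ((2 ^ n : ℕ) : ℝ) * (4 * M * κ⁻¹ * Δ ^ (1 - H) * (K * Δ ^ (1 - H)) +
        16 * M * (κ ^ 2)⁻¹ * Δ ^ (1 - 2 * H) * (L * Δ) * D) +
        (4 * M * κ⁻¹ * Δ ^ (1 - H)) * (√((2 ^ n : ℕ) : ℝ) * D) +
        sp_Cb k * √((2 ^ n : ℕ) : ℝ) * (2 * (4 * M * κ⁻¹ * Δ ^ (1 - H)) * D) ≤
        (4 / 5) ^ n * sp_B k M κ H L K D h := by
      calc _ = (4 * M * κ⁻¹ * K) * (((2 ^ n : ℕ) : ℝ) * (Δ ^ (1 - H) * Δ ^ (1 - H))) +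
            (16 * M * (κ ^ 2)⁻¹ * L * D) * (((2 ^ n : ℕ) : ℝ) * (Δ ^ (1 - 2 * H) * Δ)) +
            (1 + 2 * sp_Cb k) * (4 * M * κ⁻¹) * D * (√((2 ^ n : ℕ) : ℝ) * Δ ^ (1 - H)) := by ring
        _ = (4 * M * κ⁻¹ * K + 16 * M * (κ ^ 2)⁻¹ * L * D) * (a * a) +
            (1 + 2 * sp_Cb k) * (4 * M * κ⁻¹) * D * a := by rw [hα2, ← haN]; ring
        _ ≤ (4 * M * κ⁻¹ * K + 16 * M * (κ ^ 2)⁻¹ * L * D) *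
              ((4 / 5) ^ n * (h ^ (1 - H) * h ^ (1 - H))) +
            (1 + 2 * sp_Cb k) * (4 * M * κ⁻¹) * D * ((4 / 5) ^ n * h ^ (1 - H)) := by gcongr
        _ = _ := by unfold sp_B; ring
    have hpS : ∀ i : ℕ, S0 ≤ s + i * Δ := fun i => by
      have : 0 ≤ (i:ℝ) * Δ := by positivity
      linarith
    have hpm : ∀ i j : ℕ, i ≤ j → s + i * Δ ≤ s + j * Δ := fun i j hij => by
      have : (i:ℝ) ≤ j := by exact_mod_cast hij
      nlinarith
    have mA : AEStronglyMeasurable (sp_Sg μ F f Z ψ1 ψ2 J s (2 ^ n) (h / 2 ^ n)) μ := by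
      refine Finset.aestronglyMeasurable_fun_sum _ fun i _ =>
        (sp_A_meas hN hP ?_).aestronglyMeasurable
      have : 0 ≤ (i:ℝ) * (h / 2 ^ n) := by positivity
      linarith
    have h45' : 0 ≤ 5 * (1 - (4 / 5 : ℝ) ^ n) := by linarith
    refine (sp_lp_add mA ?_ (add_nonneg (by positivity) (mul_nonneg h45' hB))
      (by positivity) ih (hlev.trans (ENNReal.ofReal_le_ofReal hfin))).trans
      (ENNReal.ofReal_le_ofReal (le_of_eq ?_))
    · refine Finset.aestronglyMeasurable_fun_sum _ fun i _ => ?_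
      refine ((AEStronglyMeasurable.sub ?_ ?_).add ?_)
      · exact (sp_T1_meas hN hP (hpS _)).aestronglyMeasurable
      · exact (sp_T2_meas hN hP (hpS _) (hpm _ _ (by omega))).aestronglyMeasurable
      · exact ((sp_T3_meas hN hP (hpS _) (hpm _ _ (by omega))).mono
          (hN.le _)).aestronglyMeasurable
    · rw [pow_succ]; ring

end

/-- Fatou for the `L^p` bound. -/
theorem sp_fatou {Ω : Type*} [MeasurableSpace Ω] {μ : Measure Ω} {p : ℝ≥0∞} {X : ℕ → Ω → ℝ}
    {Y : Ω → ℝ} {c : ℝ≥0∞} (hX : ∀ n, AEStronglyMeasurable (X n) μ)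
    (hl : ∀ᵐ ω ∂μ, Filter.Tendsto (fun n => X n ω) Filter.atTop (nhds (Y ω)))
    (hc : ∀ n, eLpNorm (X n) p μ ≤ c) : eLpNorm Y p μ ≤ c := by
  refine (Lp.eLpNorm_lim_le_liminf_eLpNorm hX Y hl).trans ?_
  refine (Filter.liminf_le_liminf (Filter.Eventually.of_forall hc)).trans ?_
  simp

/-- The true integral. -/
def sp_I {Ω : Type*} (f : ℝ → ℝ → ℝ) (Z ψ1 ψ2 : ℝ → Ω → ℝ) (s t : ℝ) (ω : Ω) : ℝ :=
  ∫ u in Ioc s t, (f u (Z u ω + ψ1 u ω) - f u (Z u ω + ψ2 u ω))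

section
variable {Ω : Type*} [MeasurableSpace Ω] {μ : Measure Ω} [IsProbabilityMeasure μ]
    {F : ℝ → MeasurableSpace Ω} {Z : ℝ → Ω → ℝ} {H κ : ℝ}
    {ψ1 ψ2 J : ℝ → Ω → ℝ} {S0 L Q : ℝ}
    {f : ℝ → ℝ → ℝ} {M : ℝ}
    {s m t : ℝ}

theorem sp_mart (hN : SPNoise μ F Z H κ) (hP : SPPath F ψ1 ψ2 J S0 L Q)
    (hf : Measurable fun p : ℝ × ℝ => f p.1 p.2)
    (hM : ∀ u x, |f u x| ≤ M) (hs : S0 ≤ s) (N : ℕ) (hN1 : 1 ≤ N) {Δ : ℝ} (hΔ : 0 ≤ Δ) :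
    eLpNorm (fun ω => ∑ i ∈ Finset.range N, J (s + (i : ℕ) * Δ) ω *
      (sp_V f Z ψ1 ψ2 (s + (i : ℕ) * Δ) (s + (i : ℕ) * Δ) (s + (i + 1 : ℕ) * Δ) ω -
      (μ[sp_V f Z ψ1 ψ2 (s + (i : ℕ) * Δ) (s + (i : ℕ) * Δ) (s + (i + 1 : ℕ) * Δ)|
        F (s + (i : ℕ) * Δ)]) ω)) (sp_p 0) μ ≤
      ENNReal.ofReal (sp_Cb 0 * √N * (4 * M * Δ)) := by
  have hM0 : 0 ≤ M := (abs_nonneg _).trans (hM 0 0)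
  set p : ℕ → ℝ := fun i => s + i * Δ with hp
  have hpm : ∀ i j, i ≤ j → p i ≤ p j := by
    intro i j hij
    have : (i:ℝ) ≤ j := by exact_mod_cast hij
    simp only [hp]; nlinarith
  have hpS : ∀ i, S0 ≤ p i := fun i => by
    have : 0 ≤ (i:ℝ) * Δ := by positivity
    simp only [hp]; linarith
  have hpd : ∀ i, p (i + 1) - p i = Δ := fun i => by simp only [hp]; push_cast; ring
  set V : ℕ → Ω → ℝ := fun i => sp_V f Z ψ1 ψ2 (p i) (p i) (p (i + 1)) with hV
  have hVb : ∀ i ω, |V i ω| ≤ 2 * M * Δ := fun i ω => by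
    have := sp_U_bound hM (hpm i (i+1) (by omega)) (Z := Z) (ψ1 (p i)) (ψ2 (p i)) ω
    rwa [hpd] at this
  have hVi : ∀ i, Integrable (V i) μ := fun i =>
    sp_V_int hN hP hf hM (hpS i) le_rfl (hpm i (i+1) (by omega))
  have hVm : ∀ i, Measurable[F (p (i+1))] (V i) := fun i =>
    sp_V_meas hN hP hf (hpS i) le_rfl (hpm i (i+1) (by omega))
  have hJm : ∀ i, StronglyMeasurable[F (p i)] (J (p i)) := fun i =>
    (hP.mJ _ (hpS i)).stronglyMeasurable
  have hb : ∀ i, ∀ᵐ ω ∂μ, |J (p i) ω * (V i ω - (μ[V i|F (p i)]) ω)| ≤ 4 * M * Δ := by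
    intro i
    have : ∀ᵐ ω ∂μ, |(μ[V i|F (p i)]) ω| ≤ ((2 * M * Δ).toNNReal : ℝ) :=
      ae_bdd_condExp_of_ae_bdd (by
        filter_upwards with ω
        rw [Real.coe_toNNReal _ (by positivity)]; exact hVb i ω)
    filter_upwards [this] with ω hω
    rw [Real.coe_toNNReal _ (by positivity)] at hω
    have h2 := hVb i ω
    rcases hP.J01 (p i) ω with h | h
    · rw [h]; simp; positivity
    · rw [h, one_mul]
      exact (abs_sub _ _).trans (by linarith)
  have hq : ∀ i, eLpNorm (fun ω => J (p i) ω * (V i ω - (μ[V i|F (p i)]) ω)) (sp_p 0) μ ≤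
      ENNReal.ofReal (4 * M * Δ) := fun i => by
    have h := eLpNorm_le_of_ae_bound (p := sp_p 0) (μ := μ) (C := 4 * M * Δ)
      (f := fun ω => J (p i) ω * (V i ω - (μ[V i|F (p i)]) ω)) (hb i)
    simpa using h
  refine sp_bdg_lp 0 N hN1 (fun i => F (p i)) (fun i => hN.le _)
    (fun i j hij => hN.mono _ _ (hpm i j hij))
    (fun i ω => J (p i) ω * (V i ω - (μ[V i|F (p i)]) ω)) (fun i => ?_) (c := 4 * M * Δ)
    (by positivity) hb (fun i => ?_) hq
  · have hle := hN.mono _ _ (hpm i (i+1) (by omega))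
    exact ((hJm i).mono hle).mul ((hVm i).stronglyMeasurable.sub
      (stronglyMeasurable_condExp.mono hle))
  · have hi : Integrable (V i - μ[V i|F (p i)]) μ := (hVi i).sub integrable_condExp
    have hi2 : Integrable (J (p i) * (V i - μ[V i|F (p i)])) μ := by
      refine hi.bdd_mul (c := 1) (((hJm i).mono (hN.le _)).aestronglyMeasurable) ?_
      filter_upwards with ω
      rcases hP.J01 (p i) ω with h | h <;> rw [h] <;> simp
    have e1 := condExp_mul_of_stronglyMeasurable_left (μ := μ) (hJm i) hi2 hi
    have e2 := condExp_sub (μ := μ) (hVi i)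
      (integrable_condExp (m := F (p i)) (f := V i)) (F (p i))
    have e4 : μ[μ[V i|F (p i)]|F (p i)] = μ[V i|F (p i)] :=
      condExp_of_stronglyMeasurable (hN.le _) stronglyMeasurable_condExp integrable_condExp
    have e5 : (fun ω => J (p i) ω * (V i ω - (μ[V i|F (p i)]) ω)) =
      J (p i) * (V i - μ[V i|F (p i)]) := rfl
    rw [e5]
    filter_upwards [e1, e2] with ω h1 h2
    rw [h1, Pi.mul_apply, h2, Pi.sub_apply, e4]; simp

/-- Riemann sums converge for space-uniformly continuous `f` (deterministic estimate). -/
theorem sp_riem (hN : SPNoise μ F Z H κ) (hP : SPPath F ψ1 ψ2 J S0 L Q)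
    (hf : Measurable fun p : ℝ × ℝ => f p.1 p.2)
    (hM : ∀ u x, |f u x| ≤ M) (hs : S0 ≤ s) {N : ℕ} {Δ : ℝ} (hΔ : 0 ≤ Δ)
    {ε δ : ℝ} (hu : ∀ u x y, |x - y| ≤ δ → |f u x - f u y| ≤ ε)
    (hLδ : L * Δ ≤ δ) {ω : Ω} (hJ : J (s + N * Δ) ω = 1) :
    |∑ i ∈ Finset.range N,
      sp_V f Z ψ1 ψ2 (s + (i : ℕ) * Δ) (s + (i : ℕ) * Δ) (s + (i + 1 : ℕ) * Δ) ω -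
      sp_I f Z ψ1 ψ2 s (s + N * Δ) ω| ≤ N * (2 * ε * Δ) := by
  set p : ℕ → ℝ := fun i => s + i * Δ with hp
  have hL := hP.Ln
  have hpm : ∀ i j, i ≤ j → p i ≤ p j := by
    intro i j hij
    have : (i:ℝ) ≤ j := by exact_mod_cast hij
    simp only [hp]; nlinarith
  have hpS : ∀ i, S0 ≤ p i := fun i => by
    have : 0 ≤ (i:ℝ) * Δ := by positivity
    simp only [hp]; linarith
  have hpd : ∀ i, p (i + 1) - p i = Δ := fun i => by simp only [hp]; push_cast; ring
  have hJ' : ∀ u, S0 ≤ u → u ≤ p N → J u ω = 1 := fun u h1 h2 => by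
    have := hP.Janti u _ h1 h2 ω
    have h3 : J (p N) ω = 1 := hJ
    rw [h3] at this
    rcases hP.J01 u ω with h | h
    · linarith
    · exact h
  -- continuity of the paths
  have hc : ∀ ψ : ℝ → Ω → ℝ, (∀ u v, S0 ≤ u → u ≤ v → J v ω = 1 →
      |ψ v ω - ψ u ω| ≤ L * (v - u)) → ContinuousOn (fun u => ψ u ω) (Icc s (p N)) := by
    intro ψ hψ
    have : LipschitzOnWith L.toNNReal (fun u => ψ u ω) (Icc s (p N)) := by
      refine LipschitzOnWith.of_dist_le_mul fun x hx y hy => ?_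
      rw [Real.coe_toNNReal _ hL, dist_eq, dist_eq]
      rcases le_total x y with h | h
      · rw [abs_sub_comm, abs_sub_comm x y, abs_of_nonneg (sub_nonneg.2 h)]
        exact hψ x y (hs.trans hx.1) h (hJ' _ (hs.trans hy.1) hy.2)
      · rw [abs_of_nonneg (sub_nonneg.2 h)]
        exact hψ y x (hs.trans hy.1) h (hJ' _ (hs.trans hx.1) hx.2)
    exact this.continuousOn
  set g : ℝ → ℝ := fun u => f u (Z u ω + ψ1 u ω) - f u (Z u ω + ψ2 u ω) with hg
  have hgb : ∀ u, ‖g u‖ ≤ 2 * M := fun u => by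
    have e1 := abs_le.1 (hM u (Z u ω + ψ1 u ω)); have e2 := abs_le.1 (hM u (Z u ω + ψ2 u ω))
    rw [norm_eq_abs, abs_le]; constructor <;> linarith
  have hgm : AEStronglyMeasurable g (volume.restrict (Icc s (p N))) := by
    have h0 : ∀ ψ : ℝ → Ω → ℝ, ContinuousOn (fun u => ψ u ω) (Icc s (p N)) →
        AEMeasurable (fun u => f u (Z u ω + ψ u ω)) (volume.restrict (Icc s (p N))) :=
      fun ψ h => hf.comp_aemeasurable (aemeasurable_id.prodMk
        ((hN.cont ω).measurable.aemeasurable.add (h.aemeasurable measurableSet_Icc)))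
    exact ((h0 ψ1 (hc ψ1 fun u v a b c => hP.l1 u v a b ω c)).sub
      (h0 ψ2 (hc ψ2 fun u v a b c => hP.l2 u v a b ω c))).aestronglyMeasurable
  have hgi : IntegrableOn g (Icc s (p N)) volume :=
    Integrable.of_bound hgm (2 * M) (by filter_upwards with u; exact hgb u)
  have hps : p 0 = s := by simp [hp]
  have hgi' : ∀ i j, i ≤ j → j ≤ N → IntegrableOn g (Ioc (p i) (p j)) volume := fun i j hi hj =>
    hgi.mono_set fun u hu => ⟨by have := hpm 0 i (by omega); rw [hps] at this; exact this.trans hu.1.le,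
      hu.2.trans (hpm _ _ hj)⟩
  have key : ∀ n, n ≤ N → |∑ i ∈ Finset.range n,
      sp_V f Z ψ1 ψ2 (p i) (p i) (p (i + 1)) ω - ∫ u in Ioc s (p n), g u| ≤ n * (2 * ε * Δ) := by
    intro n
    induction n with
    | zero => simp [hps]
    | succ n ih =>
      intro hn
      have ih' := ih (by omega)
      have hadd : ∫ u in Ioc s (p (n+1)), g u = (∫ u in Ioc s (p n), g u) +
          ∫ u in Ioc (p n) (p (n+1)), g u := by
        have h0 : s ≤ p n := by have := hpm 0 n (by omega); rwa [hps] at this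
        rw [← Ioc_union_Ioc_eq_Ioc h0 (hpm n (n+1) (by omega)),
          setIntegral_union (Ioc_disjoint_Ioc_of_le le_rfl) measurableSet_Ioc]
        · have := hgi' 0 n (by omega) (by omega)
          rwa [hps] at this
        · exact hgi' n (n+1) (by omega) hn
      have hstep : |sp_V f Z ψ1 ψ2 (p n) (p n) (p (n + 1)) ω - ∫ u in Ioc (p n) (p (n+1)), g u| ≤
          2 * ε * Δ := by
        have hV : sp_V f Z ψ1 ψ2 (p n) (p n) (p (n + 1)) ω = ∫ u in Ioc (p n) (p (n+1)),
          (f u (Z u ω + ψ1 (p n) ω) - f u (Z u ω + ψ2 (p n) ω)) := rfl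
        rw [hV, ← integral_sub ?_ (hgi' n (n+1) (by omega) hn)]
        · have := norm_setIntegral_le_of_norm_le_const (μ := volume) (s := Ioc (p n) (p (n+1)))
            (C := 2 * ε)
            (f := fun u => (f u (Z u ω + ψ1 (p n) ω) - f u (Z u ω + ψ2 (p n) ω)) - g u)
            (by simp) (fun u hu' => by
              have hun : u ≤ p N := hu'.2.trans (hpm _ _ hn)
              have hJu := hJ' u ((hpS n).trans hu'.1.le) hun
              have hb : L * (u - p n) ≤ δ := by
                refine le_trans ?_ hLδ
                have : u - p n ≤ Δ := by have := hpd n; linarith [hu'.2]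
                gcongr
              have e1 := hu u (Z u ω + ψ1 (p n) ω) (Z u ω + ψ1 u ω) (by
                have := hP.l1 (p n) u (hpS n) hu'.1.le ω hJu
                rw [abs_sub_comm] at this
                rw [add_sub_add_left_eq_sub]; linarith)
              have e2 := hu u (Z u ω + ψ2 (p n) ω) (Z u ω + ψ2 u ω) (by
                have := hP.l2 (p n) u (hpS n) hu'.1.le ω hJu
                rw [abs_sub_comm] at this
                rw [add_sub_add_left_eq_sub]; linarith)
              have e1' := abs_le.1 e1; have e2' := abs_le.1 e2
              rw [norm_eq_abs, hg, abs_le]; constructor <;> simp only <;> linarith)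
          rwa [Real.volume_real_Ioc_of_le (hpm _ _ (by omega)), hpd, norm_eq_abs] at this
        · refine Integrable.of_bound (Measurable.aestronglyMeasurable ?_) (2 * M) ?_
          · refine Measurable.sub ?_ ?_ <;>
            exact hf.comp (measurable_id.prodMk ((hN.cont ω).measurable.add_const _))
          · filter_upwards with u
            have e1 := abs_le.1 (hM u (Z u ω + ψ1 (p n) ω))
            have e2 := abs_le.1 (hM u (Z u ω + ψ2 (p n) ω))
            rw [norm_eq_abs, abs_le]; constructor <;> linarith
      rw [Finset.sum_range_succ, hadd]
      have e1 := abs_le.1 ih'; have e2 := abs_le.1 hstep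
      push_cast
      rw [abs_le]; constructor <;> nlinarith
  exact key N le_rfl

end

section
variable {Ω : Type*} [MeasurableSpace Ω] {μ : Measure Ω} [IsProbabilityMeasure μ]
    {F : ℝ → MeasurableSpace Ω} {Z : ℝ → Ω → ℝ} {H κ : ℝ}
    {ψ1 ψ2 J : ℝ → Ω → ℝ} {S0 L Q : ℝ}
    {f : ℝ → ℝ → ℝ} {M : ℝ}
    {s m t : ℝ}

theorem sp_mart_rate {C h : ℝ} :
    Filter.Tendsto (fun n : ℕ => C * √((2 ^ n : ℕ) : ℝ) * (h / 2 ^ n)) Filter.atTop (nhds 0) := by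
  have e : (fun n : ℕ => C * √((2 ^ n : ℕ) : ℝ) * (h / 2 ^ n)) = fun n : ℕ => (C * h) * (√2 / 2) ^ n := by
    ext n
    have h2 : √((2 ^ n : ℕ) : ℝ) = √2 ^ n := by
      push_cast
      rw [Real.sqrt_eq_iff_mul_self_eq (by positivity) (by positivity), ← mul_pow,
        Real.mul_self_sqrt (by norm_num)]
    rw [h2, div_pow]; ring
  rw [e]
  have : √2 < 2 := by
    rw [Real.sqrt_lt' (by norm_num)]; norm_num
  have := (tendsto_pow_atTop_nhds_zero_of_lt_one (r := √2 / 2) (by positivity) (by linarith)).const_mul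
    (C * h)
  simpa using this

theorem sp_I_uc (hN : SPNoise μ F Z H κ) (hP : SPPath F ψ1 ψ2 J S0 L Q)
    (hf : Measurable fun p : ℝ × ℝ => f p.1 p.2)
    (hM : ∀ u x, |f u x| ≤ M) (hs : S0 ≤ s) {k : ℕ} {K D : ℝ} (hK : 0 ≤ K) (hD : 0 ≤ D)
    (h1 : ∀ u v, s ≤ u → u ≤ v → eLpNorm (fun ω => J v ω * ((ψ1 v ω - ψ2 v ω) -
      (ψ1 u ω - ψ2 u ω))) (sp_p k) μ ≤ ENNReal.ofReal (K * (v - u) ^ (1 - H)))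
    (h2 : ∀ u, s ≤ u → eLpNorm (fun ω => J u ω * (ψ1 u ω - ψ2 u ω)) (sp_p k) μ ≤ ENNReal.ofReal D)
    {h : ℝ} (hh : 0 < h)
    (huc : ∀ ε, 0 < ε → ∃ δ, 0 < δ ∧ ∀ u x y, |x - y| ≤ δ → |f u x - f u y| ≤ ε) :
    eLpNorm (fun ω => J (s + h) ω * sp_I f Z ψ1 ψ2 s (s + h) ω) (sp_p k) μ ≤
      ENNReal.ofReal (4 * M * κ⁻¹ * h ^ (1 - H) * D + 5 * sp_B k M κ H L K D h) := by
  have hM0 : 0 ≤ M := (abs_nonneg _).trans (hM 0 0)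
  have hκ := hN.kpos
  have hL := hP.Ln
  have hCb := sp_Cb_one k
  have hB : 0 ≤ sp_B k M κ H L K D h := by unfold sp_B; positivity
  set Δ : ℕ → ℝ := fun n => h / 2 ^ n with hΔ
  have hΔ0 : ∀ n, 0 ≤ Δ n := fun n => by positivity
  have hend : ∀ n : ℕ, s + ((2 ^ n : ℕ) : ℝ) * Δ n = s + h := fun n => by
    simp only [hΔ]; push_cast; field_simp
  have hpS : ∀ n (i : ℕ), S0 ≤ s + i * Δ n := fun n i => by
    have : 0 ≤ (i:ℝ) * Δ n := by have := hΔ0 n; positivity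
    linarith
  have hpm : ∀ n (i j : ℕ), i ≤ j → s + i * Δ n ≤ s + j * Δ n := fun n i j hij => by
    have : (i:ℝ) ≤ j := by exact_mod_cast hij
    have := hΔ0 n
    nlinarith
  set R : ℕ → Ω → ℝ := fun n ω => ∑ i ∈ Finset.range (2 ^ n), J (s + (i : ℕ) * Δ n) ω *
      (sp_V f Z ψ1 ψ2 (s + (i : ℕ) * Δ n) (s + (i : ℕ) * Δ n) (s + (i + 1 : ℕ) * Δ n) ω -
      (μ[sp_V f Z ψ1 ψ2 (s + (i : ℕ) * Δ n) (s + (i : ℕ) * Δ n) (s + (i + 1 : ℕ) * Δ n)|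
        F (s + (i : ℕ) * Δ n)]) ω) with hR
  have hRm : ∀ n, AEStronglyMeasurable (R n) μ := fun n => by
    refine Finset.aestronglyMeasurable_fun_sum _ fun i _ => ?_
    refine AEStronglyMeasurable.mul ?_ (AEStronglyMeasurable.sub ?_ ?_)
    · exact ((hP.mJ _ (hpS n i)).mono (hN.le _) le_rfl).aestronglyMeasurable
    · exact (sp_V_int hN hP hf hM (hpS n i) le_rfl (hpm n i (i+1) (by omega))).1
    · exact (stronglyMeasurable_condExp.mono (hN.le _)).aestronglyMeasurable
  have hR0 : Filter.Tendsto (fun n => eLpNorm (R n - (fun _ => (0:ℝ))) (sp_p 0) μ) Filter.atTop (nhds 0) := by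
    have hz : Filter.Tendsto (fun n : ℕ => ENNReal.ofReal (sp_Cb 0 * √((2 ^ n : ℕ) : ℝ) * (4 * M * Δ n)))
        Filter.atTop (nhds 0) := by
      have := ENNReal.tendsto_ofReal (sp_mart_rate (C := sp_Cb 0 * (4 * M)) (h := h))
      rw [ENNReal.ofReal_zero] at this
      refine this.congr fun n => ?_
      congr 1; simp only [hΔ]; ring
    refine tendsto_of_tendsto_of_tendsto_of_le_of_le tendsto_const_nhds hz (fun _ => zero_le) fun n => ?_
    have e : R n - (fun _ => (0:ℝ)) = R n := by ext; simp
    simp only [e]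
    exact sp_mart hN hP hf hM hs (2 ^ n) Nat.one_le_two_pow (hΔ0 n)
  obtain ⟨ns, hns, hae⟩ := (tendstoInMeasure_of_tendsto_eLpNorm (by simp [sp_p]) hRm
    aestronglyMeasurable_const hR0).exists_seq_tendsto_ae
  refine sp_fatou (X := fun n ω => J (s + h) ω * sp_Sg μ F f Z ψ1 ψ2 J s (2 ^ (ns n)) (Δ (ns n)) ω)
    (fun n => ?_) ?_ fun n => ?_
  · refine AEStronglyMeasurable.mul
      ((hP.mJ _ (by linarith)).mono (hN.le _) le_rfl).aestronglyMeasurable ?_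
    exact Finset.aestronglyMeasurable_fun_sum _ fun i _ =>
        (sp_A_meas hN hP (hpS _ i)).aestronglyMeasurable
  · filter_upwards [hae] with ω hω
    rcases hP.J01 (s + h) ω with hJ | hJ
    · simp [hJ]
    simp only [hJ, one_mul]
    have hJ' : ∀ u, S0 ≤ u → u ≤ s + h → J u ω = 1 := fun u a b => by
      have := hP.Janti u _ a b ω
      rw [hJ] at this
      rcases hP.J01 u ω with h | h
      · linarith
      · exact h
    have hsum : ∀ n, sp_Sg μ F f Z ψ1 ψ2 J s (2 ^ n) (Δ n) ω =
        (∑ i ∈ Finset.range (2 ^ n), sp_V f Z ψ1 ψ2 (s + (i : ℕ) * Δ n) (s + (i : ℕ) * Δ n)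
          (s + (i + 1 : ℕ) * Δ n) ω) - R n ω := fun n => by
      rw [sp_Sg, hR, ← Finset.sum_sub_distrib]
      refine Finset.sum_congr rfl fun i hi => ?_
      have : J (s + (i : ℕ) * Δ n) ω = 1 := hJ' _ (hpS n i) (by
        rw [← hend n]; exact hpm n _ _ (Finset.mem_range.1 hi).le)
      rw [sp_A, this]; ring
    simp only [hsum]
    have hlim : Filter.Tendsto (fun n => ∑ i ∈ Finset.range (2 ^ n), sp_V f Z ψ1 ψ2
        (s + (i : ℕ) * Δ n) (s + (i : ℕ) * Δ n) (s + (i + 1 : ℕ) * Δ n) ω) Filter.atTop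
        (nhds (sp_I f Z ψ1 ψ2 s (s + h) ω)) := by
      rw [Metric.tendsto_atTop]
      intro ε hε
      obtain ⟨δ, hδ, hu⟩ := huc (ε / (4 * h)) (by positivity)
      have hLt : Filter.Tendsto (fun n => L * Δ n) Filter.atTop (nhds 0) := by
        have := (tendsto_pow_atTop_nhds_zero_of_lt_one (r := (1:ℝ) / 2) (by positivity)
          (by norm_num)).const_mul (L * h)
        rw [mul_zero] at this
        refine this.congr fun n => ?_
        simp only [hΔ]; rw [one_div_pow]; ring
      obtain ⟨n0, hn0⟩ := Filter.eventually_atTop.1 (hLt.eventually_lt_const hδ)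
      refine ⟨n0, fun n hn => ?_⟩
      rw [dist_eq]
      have := sp_riem hN hP hf hM hs (N := 2 ^ n) (hΔ0 n) hu (hn0 n hn).le (ω := ω)
        (by rw [hend]; exact hJ)
      rw [hend] at this
      refine this.trans_lt ?_
      have e : ((2 ^ n : ℕ) : ℝ) * (2 * (ε / (4 * h)) * Δ n) = ε / 2 := by
        simp only [hΔ]; push_cast; field_simp; ring
      rw [e]; linarith
    have := (hlim.comp hns.tendsto_atTop).sub hω
    simpa using this
  · have hb := sp_Sg_bound hN hP hf hM hs hK hD h1 h2 hh (ns n)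
    have := sp_lp_mono (X := fun ω => J (s + h) ω * sp_Sg μ F f Z ψ1 ψ2 J s (2 ^ (ns n)) (Δ (ns n)) ω)
      zero_le_one (by
        filter_upwards with ω
        rw [abs_mul]
        rcases hP.J01 (s + h) ω with hJ | hJ <;> rw [hJ] <;> simp [hΔ]) hb
    refine this.trans (ENNReal.ofReal_le_ofReal ?_)
    rw [one_mul]
    have : (0:ℝ) ≤ (4/5) ^ (ns n) := by positivity
    have : 5 * (1 - (4 / 5) ^ (ns n)) * sp_B k M κ H L K D h ≤ 5 * 1 * sp_B k M κ H L K D h := by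
      gcongr; linarith
    linarith

end

/-- Approximation by uniformly continuous functions. -/
theorem sp_approx {f : ℝ → ℝ → ℝ} {M : ℝ} (hf : Measurable fun p : ℝ × ℝ => f p.1 p.2)
    (hM : ∀ u x, |f u x| ≤ M) (ν : Measure (ℝ × ℝ)) [IsFiniteMeasure ν] {ε : ℝ≥0∞} (hε : ε ≠ 0) :
    ∃ g : ℝ → ℝ → ℝ, (Measurable fun p : ℝ × ℝ => g p.1 p.2) ∧ (∀ u x, |g u x| ≤ M) ∧
      (∀ ε, 0 < ε → ∃ δ, 0 < δ ∧ ∀ u x y, |x - y| ≤ δ → |g u x - g u y| ≤ ε) ∧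
      ∫⁻ p, ENNReal.ofReal |f p.1 p.2 - g p.1 p.2| ∂ν ≤ ε := by
  have hM0 : 0 ≤ M := (abs_nonneg _).trans (hM 0 0)
  have hmem : MemLp (fun p : ℝ × ℝ => f p.1 p.2) 1 ν :=
    MemLp.of_bound hf.aestronglyMeasurable M (by filter_upwards with p; exact hM _ _)
  obtain ⟨g, hgs, hge, hgc, -⟩ := hmem.exists_hasCompactSupport_eLpNorm_sub_le (by simp) hε
  have hguc : UniformContinuous g := hgc.uniformContinuous_of_tendsto_cocompact
    hgs.is_zero_at_infty
  have hcl : ∀ a b : ℝ, |max (-M) (min a M) - max (-M) (min b M)| ≤ |a - b| := fun a b => by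
    have h1 := abs_max_sub_max_le_max (-M) (min a M) (-M) (min b M)
    have h2 := abs_min_sub_min_le_max a M b M
    rw [sub_self, abs_zero, max_eq_right (abs_nonneg (min a M - min b M))] at h1
    rw [sub_self, abs_zero, max_eq_left (abs_nonneg (a - b))] at h2
    exact h1.trans h2
  refine ⟨fun u x => max (-M) (min (g (u, x)) M), ?_, ?_, ?_, ?_⟩
  · exact (measurable_const.max (hgc.measurable.min measurable_const))
  · intro u x
    rw [abs_le]
    exact ⟨le_max_left _ _, max_le (by linarith) (min_le_right _ _)⟩
  · intro ε hε
    obtain ⟨δ, hδ, h⟩ := Metric.uniformContinuous_iff.1 hguc ε hε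
    refine ⟨δ / 2, by positivity, fun u x y hxy => (hcl _ _).trans ?_⟩
    have := h (a := (u, x)) (b := (u, y)) (by
      rw [Prod.dist_eq, dist_self, dist_eq]
      simp only
      rw [max_eq_right (abs_nonneg _)]; linarith)
    exact this.le
  · rw [eLpNorm_one_eq_lintegral_enorm] at hge
    refine le_trans (lintegral_mono fun p => ?_) hge
    rw [enorm_eq_ofReal_abs]
    refine ENNReal.ofReal_le_ofReal ?_
    have e : f p.1 p.2 = max (-M) (min (f p.1 p.2) M) := by
      have := abs_le.1 (hM p.1 p.2)
      rw [min_eq_left this.2, max_eq_right this.1]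
    rw [e]
    exact hcl _ _

section
variable {Ω : Type*} [MeasurableSpace Ω] {μ : Measure Ω} [IsProbabilityMeasure μ]
    {F : ℝ → MeasurableSpace Ω} {Z : ℝ → Ω → ℝ} {H κ : ℝ}
    {ψ1 ψ2 J : ℝ → Ω → ℝ} {S0 L Q : ℝ}
    {f : ℝ → ℝ → ℝ} {M : ℝ}
    {s m t : ℝ}

/-- Localised and clamped paths are jointly measurable. -/
theorem sp_jm (hN : SPNoise μ F Z H κ) (hP : SPPath F ψ1 ψ2 J S0 L Q) (hs : S0 ≤ s) (hst : s ≤ t)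
    {ψ : ℝ → Ω → ℝ} (hm : ∀ u, S0 ≤ u → Measurable[F u] (ψ u))
    (hl : ∀ u v, S0 ≤ u → u ≤ v → ∀ ω, J v ω = 1 → |ψ v ω - ψ u ω| ≤ L * (v - u)) :
    Measurable (fun p : ℝ × Ω => Z p.1 p.2 + J t p.2 * ψ (max s (min p.1 t)) p.2) := by
  have hL := hP.Ln
  have hmem : ∀ u, max s (min u t) ∈ Icc s t := fun u =>
    ⟨le_max_left _ _, max_le hst (min_le_right _ _)⟩
  refine Measurable.add ?_ ?_
  · exact measurable_uncurry_of_continuous_of_measurable (u := Z) hN.cont hN.meas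
  refine measurable_uncurry_of_continuous_of_measurable
    (u := fun u ω => J t ω * ψ (max s (min u t)) ω) (fun ω => ?_) (fun u => ?_)
  · rcases hP.J01 t ω with h | h
    · simp only [h, zero_mul]; exact continuous_const
    · simp only [h, one_mul]
      have hJ' : ∀ u, S0 ≤ u → u ≤ t → J u ω = 1 := fun u a b => by
        have := hP.Janti u _ a b ω
        rw [h] at this
        rcases hP.J01 u ω with h | h
        · linarith
        · exact h
      have : LipschitzOnWith L.toNNReal (fun u => ψ u ω) (Icc s t) := by
        refine LipschitzOnWith.of_dist_le_mul fun x hx y hy => ?_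
        rw [Real.coe_toNNReal _ hL, dist_eq, dist_eq]
        rcases le_total x y with h | h
        · rw [abs_sub_comm, abs_sub_comm x y, abs_of_nonneg (sub_nonneg.2 h)]
          exact hl x y (hs.trans hx.1) h ω (hJ' _ (hs.trans hy.1) hy.2)
        · rw [abs_of_nonneg (sub_nonneg.2 h)]
          exact hl y x (hs.trans hy.1) h ω (hJ' _ (hs.trans hx.1) hx.2)
      exact this.continuousOn.comp_continuous (by fun_prop) hmem
  · exact ((hP.mJ t (hs.trans hst)).mono (hN.le _) le_rfl).mul
      ((hm _ (hs.trans (hmem u).1)).mono (hN.le _) le_rfl)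

theorem sp_I_gen (hN : SPNoise μ F Z H κ) (hP : SPPath F ψ1 ψ2 J S0 L Q)
    (hf : Measurable fun p : ℝ × ℝ => f p.1 p.2)
    (hM : ∀ u x, |f u x| ≤ M) (hs : S0 ≤ s) {k : ℕ} {K D : ℝ} (hK : 0 ≤ K) (hD : 0 ≤ D)
    (h1 : ∀ u v, s ≤ u → u ≤ v → eLpNorm (fun ω => J v ω * ((ψ1 v ω - ψ2 v ω) -
      (ψ1 u ω - ψ2 u ω))) (sp_p k) μ ≤ ENNReal.ofReal (K * (v - u) ^ (1 - H)))
    (h2 : ∀ u, s ≤ u → eLpNorm (fun ω => J u ω * (ψ1 u ω - ψ2 u ω)) (sp_p k) μ ≤ ENNReal.ofReal D)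
    {h : ℝ} (hh : 0 < h) :
    eLpNorm (fun ω => J (s + h) ω * sp_I f Z ψ1 ψ2 s (s + h) ω) (sp_p k) μ ≤
      ENNReal.ofReal (4 * M * κ⁻¹ * h ^ (1 - H) * D + 5 * sp_B k M κ H L K D h) := by
  have hM0 : 0 ≤ M := (abs_nonneg _).trans (hM 0 0)
  set t := s + h with ht
  have hst : s ≤ t := by linarith
  set φ1 : ℝ × Ω → ℝ × ℝ := fun p => (p.1, Z p.1 p.2 + J t p.2 * ψ1 (max s (min p.1 t)) p.2) with hφ1
  set φ2 : ℝ × Ω → ℝ × ℝ := fun p => (p.1, Z p.1 p.2 + J t p.2 * ψ2 (max s (min p.1 t)) p.2) with hφ2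
  have m1 : Measurable φ1 := measurable_fst.prodMk (sp_jm hN hP hs hst hP.m1 hP.l1)
  have m2 : Measurable φ2 := measurable_fst.prodMk (sp_jm hN hP hs hst hP.m2 hP.l2)
  set pim : Measure (ℝ × Ω) := (volume.restrict (Ioc s t)).prod μ with hpi
  set ν : Measure (ℝ × ℝ) := pim.map φ1 + pim.map φ2 with hν
  have : IsFiniteMeasure (volume.restrict (Ioc s t)) := by infer_instance
  choose g hgm hgM hguc hge using fun n : ℕ => sp_approx hf hM ν (ε := ENNReal.ofReal ((1 / 2) ^ n))
    (by simp)
  -- representation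
  have hrep : ∀ a : ℝ → ℝ → ℝ, (fun ω => J t ω * sp_I a Z ψ1 ψ2 s t ω) = fun ω =>
      J t ω * ∫ u in Ioc s t, (a (φ1 (u, ω)).1 (φ1 (u, ω)).2 - a (φ2 (u, ω)).1 (φ2 (u, ω)).2) := by
    intro a; ext ω
    rcases hP.J01 t ω with hJ | hJ
    · simp [hJ]
    congr 1
    refine setIntegral_congr_fun measurableSet_Ioc fun u hu => ?_
    have : max s (min u t) = u := by rw [min_eq_left hu.2, max_eq_right hu.1.le]
    simp only [hφ1, hφ2, this, hJ, one_mul]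
  have hmeas : ∀ a : ℝ → ℝ → ℝ, (Measurable fun p : ℝ × ℝ => a p.1 p.2) →
      Measurable fun p : ℝ × Ω => a (φ1 p).1 (φ1 p).2 - a (φ2 p).1 (φ2 p).2 := fun a ha =>
    (ha.comp m1).sub (ha.comp m2)
  have hJt : Measurable (J t) := (hP.mJ t (hs.trans hst)).mono (hN.le _) le_rfl
  have hXm : ∀ a : ℝ → ℝ → ℝ, (Measurable fun p : ℝ × ℝ => a p.1 p.2) →
      AEStronglyMeasurable (fun ω => J t ω * sp_I a Z ψ1 ψ2 s t ω) μ := fun a ha => by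
    rw [hrep]
    exact (hJt.mul (hmeas a ha).stronglyMeasurable.integral_prod_left'.measurable).aestronglyMeasurable
  have hbdd : ∀ a : ℝ → ℝ → ℝ, (Measurable fun p : ℝ × ℝ => a p.1 p.2) → (∀ u x, |a u x| ≤ M) →
      ∀ ω, IntegrableOn (fun u => a (φ1 (u, ω)).1 (φ1 (u, ω)).2 - a (φ2 (u, ω)).1 (φ2 (u, ω)).2)
        (Ioc s t) := fun a ha hb ω => by
    refine Integrable.of_bound ((hmeas a ha).comp (measurable_id.prodMk measurable_const)).aestronglyMeasurable
      (2 * M) ?_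
    filter_upwards with u
    have e1 := abs_le.1 (hb (φ1 (u, ω)).1 (φ1 (u, ω)).2)
    have e2 := abs_le.1 (hb (φ2 (u, ω)).1 (φ2 (u, ω)).2)
    rw [norm_eq_abs, abs_le]; constructor <;> linarith
  have hlim : Filter.Tendsto (fun n => eLpNorm ((fun ω => J t ω * sp_I (g n) Z ψ1 ψ2 s t ω) -
      (fun ω => J t ω * sp_I f Z ψ1 ψ2 s t ω)) 1 μ) Filter.atTop (nhds 0) := by
    have hz : Filter.Tendsto (fun n : ℕ => ENNReal.ofReal ((1 / 2) ^ n)) Filter.atTop (nhds 0) := by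
      have := ENNReal.tendsto_ofReal (tendsto_pow_atTop_nhds_zero_of_lt_one (r := (1:ℝ) / 2)
        (by positivity) (by norm_num))
      rwa [ENNReal.ofReal_zero] at this
    refine tendsto_of_tendsto_of_tendsto_of_le_of_le tendsto_const_nhds hz (fun _ => zero_le) fun n => ?_
    refine le_trans ?_ (hge n)
    rw [eLpNorm_one_eq_lintegral_enorm, hν, lintegral_add_measure]
    have hdm : Measurable fun p : ℝ × ℝ => ENNReal.ofReal |f p.1 p.2 - g n p.1 p.2| :=
      ((hf.sub (hgm n)).abs).ennreal_ofReal
    have c1 : Measurable fun p => ENNReal.ofReal |f (φ1 p).1 (φ1 p).2 - g n (φ1 p).1 (φ1 p).2| :=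
      hdm.comp m1
    have c2 : Measurable fun p => ENNReal.ofReal |f (φ2 p).1 (φ2 p).2 - g n (φ2 p).1 (φ2 p).2| :=
      hdm.comp m2
    have c3 : Measurable fun p => ENNReal.ofReal |f (φ1 p).1 (φ1 p).2 - g n (φ1 p).1 (φ1 p).2| +
      ENNReal.ofReal |f (φ2 p).1 (φ2 p).2 - g n (φ2 p).1 (φ2 p).2| := c1.add c2
    rw [lintegral_map hdm m1, lintegral_map hdm m2, ← lintegral_add_left c1, hpi,
      lintegral_prod_symm' _ c3]
    refine lintegral_mono fun ω => ?_
    rw [Pi.sub_apply, congrFun (hrep (g n)) ω, congrFun (hrep f) ω, ← mul_sub, ← integral_sub (hbdd _ (hgm n) (hgM n) ω) (hbdd _ hf hM ω)]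
    have : ‖J t ω * ∫ u in Ioc s t, ((g n (φ1 (u, ω)).1 (φ1 (u, ω)).2 - g n (φ2 (u, ω)).1 (φ2 (u, ω)).2)
        - (f (φ1 (u, ω)).1 (φ1 (u, ω)).2 - f (φ2 (u, ω)).1 (φ2 (u, ω)).2))‖ₑ ≤
        ‖∫ u in Ioc s t, ((g n (φ1 (u, ω)).1 (φ1 (u, ω)).2 - g n (φ2 (u, ω)).1 (φ2 (u, ω)).2)
        - (f (φ1 (u, ω)).1 (φ1 (u, ω)).2 - f (φ2 (u, ω)).1 (φ2 (u, ω)).2))‖ₑ := by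
      rcases hP.J01 t ω with hJ | hJ <;> simp [hJ]
    refine this.trans ((enorm_integral_le_lintegral_enorm _).trans (lintegral_mono fun u => ?_))
    rw [enorm_eq_ofReal_abs]
    simp only
    rw [← ENNReal.ofReal_add (abs_nonneg _) (abs_nonneg _)]
    refine ENNReal.ofReal_le_ofReal ?_
    rw [abs_le]
    constructor <;>
    · have e1 := le_abs_self (f (φ1 (u, ω)).1 (φ1 (u, ω)).2 - g n (φ1 (u, ω)).1 (φ1 (u, ω)).2)
      have e2 := neg_abs_le (f (φ1 (u, ω)).1 (φ1 (u, ω)).2 - g n (φ1 (u, ω)).1 (φ1 (u, ω)).2)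
      have e3 := le_abs_self (f (φ2 (u, ω)).1 (φ2 (u, ω)).2 - g n (φ2 (u, ω)).1 (φ2 (u, ω)).2)
      have e4 := neg_abs_le (f (φ2 (u, ω)).1 (φ2 (u, ω)).2 - g n (φ2 (u, ω)).1 (φ2 (u, ω)).2)
      linarith
  obtain ⟨ns, hns, hae⟩ := (tendstoInMeasure_of_tendsto_eLpNorm (by simp) (fun n => hXm _ (hgm n))
    (hXm _ hf) hlim).exists_seq_tendsto_ae
  exact sp_fatou (fun n => hXm _ (hgm (ns n))) hae fun n =>
    sp_I_uc hN hP (hgm _) (hgM _) hs hK hD h1 h2 hh (hguc _)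

end

section
variable {Ω : Type*} [MeasurableSpace Ω] {μ : Measure Ω} [IsProbabilityMeasure μ]
    {F : ℝ → MeasurableSpace Ω} {Z : ℝ → Ω → ℝ} {H κ : ℝ}
    {ψ1 ψ2 J : ℝ → Ω → ℝ} {S0 L Q : ℝ}
    {f : ℝ → ℝ → ℝ} {M : ℝ}
    {s m t T : ℝ}

set_option linter.unusedSectionVars false

theorem sp_trunc (hP : SPPath F ψ1 ψ2 J S0 L Q) (τ : ℝ) :
    SPPath F ψ1 ψ2 (fun u ω => if u ≤ τ then J u ω else 0) S0 L Q where
  S0n := hP.S0n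
  Ln := hP.Ln
  m1 := hP.m1
  m2 := hP.m2
  mJ u hu := by
    by_cases h : u ≤ τ
    · simp only [h, if_true]; exact hP.mJ u hu
    · simp only [h, if_false]; exact measurable_const
  b1 := hP.b1
  b2 := hP.b2
  J01 u ω := by
    by_cases h : u ≤ τ
    · simp only [h, if_true]; exact hP.J01 u ω
    · simp [h]
  Janti u v hu huv ω := by
    by_cases h : v ≤ τ
    · simp only [h, huv.trans h, if_true]; exact hP.Janti u v hu huv ω
    · simp only [h, if_false]
      by_cases h' : u ≤ τ
      · simp only [h', if_true]
        rcases hP.J01 u ω with h | h <;> rw [h]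
        norm_num
      · simp [h']
  l1 u v hu huv ω h := by
    by_cases h' : v ≤ τ
    · simp only [h', if_true] at h; exact hP.l1 u v hu huv ω h
    · simp [h'] at h
  l2 u v hu huv ω h := by
    by_cases h' : v ≤ τ
    · simp only [h', if_true] at h; exact hP.l2 u v hu huv ω h
    · simp [h'] at h

theorem sp_path_meas (hN : SPNoise μ F Z H κ) (hP : SPPath F ψ1 ψ2 J S0 L Q) {u v w : ℝ}
    (hu : S0 ≤ u) (hv : S0 ≤ v) (hw : S0 ≤ w) :
    Measurable (J v) ∧ Measurable (fun ω => ψ1 u ω - ψ2 u ω) ∧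
      Measurable (fun ω => J v ω * (ψ1 u ω - ψ2 u ω)) ∧
      Measurable (fun ω => J v ω * ((ψ1 w ω - ψ2 w ω) - (ψ1 u ω - ψ2 u ω))) := by
  have a := (hP.mJ v hv).mono (hN.le _) le_rfl
  have b := ((hP.m1 u hu).mono (hN.le _) le_rfl).sub ((hP.m2 u hu).mono (hN.le _) le_rfl)
  have c := ((hP.m1 w hw).mono (hN.le _) le_rfl).sub ((hP.m2 w hw).mono (hN.le _) le_rfl)
  exact ⟨a, b, a.mul b, a.mul (c.sub b)⟩

/-- From increments to values. -/
theorem sp_val (hN : SPNoise μ F Z H κ) (hP : SPPath F ψ1 ψ2 J S0 L Q) (hs : S0 ≤ s) (hst : s ≤ t)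
    {k : ℕ} {d0 e : ℝ} (hd0 : 0 ≤ d0) (he : 0 ≤ e)
    (hd : eLpNorm (fun ω => J s ω * (ψ1 s ω - ψ2 s ω)) (sp_p k) μ ≤ ENNReal.ofReal d0)
    (hi : eLpNorm (fun ω => J t ω * ((ψ1 t ω - ψ2 t ω) - (ψ1 s ω - ψ2 s ω))) (sp_p k) μ ≤
      ENNReal.ofReal e) :
    eLpNorm (fun ω => J t ω * (ψ1 t ω - ψ2 t ω)) (sp_p k) μ ≤ ENNReal.ofReal (d0 + e) := by
  have h1 : eLpNorm (fun ω => J t ω * (ψ1 s ω - ψ2 s ω)) (sp_p k) μ ≤ ENNReal.ofReal (1 * d0) := by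
    refine sp_lp_mono zero_le_one ?_ hd
    filter_upwards with ω
    have := hP.Janti s t hs hst ω
    rw [abs_mul, abs_mul, one_mul]
    rcases hP.J01 t ω with h | h
    · rw [h]; simp; positivity
    · rcases hP.J01 s ω with h' | h'
      · rw [h, h'] at this; norm_num at this
      · rw [h, h']
  rw [one_mul] at h1
  have := sp_lp_add (sp_path_meas hN hP hs (hs.trans hst) hs).2.2.1.aestronglyMeasurable
    (sp_path_meas hN hP hs (hs.trans hst) (hs.trans hst)).2.2.2.aestronglyMeasurable hd0 he h1 hi
  refine le_trans (le_of_eq ?_) this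
  congr 1; ext ω; ring

theorem sp_improve (hN : SPNoise μ F Z H κ) (hP : SPPath F ψ1 ψ2 J S0 L Q)
    (hf : Measurable fun p : ℝ × ℝ => f p.1 p.2) (hM : ∀ u x, |f u x| ≤ L)
    (hE : ∀ u v, S0 ≤ u → u ≤ v → v ≤ T → ∀ ω, J v ω = 1 →
      (ψ1 v ω - ψ2 v ω) - (ψ1 u ω - ψ2 u ω) = sp_I f Z ψ1 ψ2 u v ω)
    (hs : S0 ≤ s) {h : ℝ} (hh : 0 < h) (hτ : s + h ≤ T) {k : ℕ} {d0 K : ℝ} (hd0 : 0 ≤ d0)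
    (hd : eLpNorm (fun ω => J s ω * (ψ1 s ω - ψ2 s ω)) (sp_p k) μ ≤ ENNReal.ofReal d0)
    (hη : 200 * sp_Cb k * (L * κ⁻¹) * h ^ (1 - H) ≤ 1) (hK : 0 ≤ K)
    (hi : ∀ u v, s ≤ u → u ≤ v → v ≤ s + h → eLpNorm (fun ω => J v ω * ((ψ1 v ω - ψ2 v ω) -
      (ψ1 u ω - ψ2 u ω))) (sp_p k) μ ≤ ENNReal.ofReal (K * (v - u) ^ (1 - H)))
    (u v : ℝ) (hu : s ≤ u) (huv : u ≤ v) (hv : v ≤ s + h) :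
    eLpNorm (fun ω => J v ω * ((ψ1 v ω - ψ2 v ω) -
      (ψ1 u ω - ψ2 u ω))) (sp_p k) μ ≤ ENNReal.ofReal ((65 * sp_Cb k * (L * κ⁻¹) * d0 + K / 2) *
        (v - u) ^ (1 - H)) := by
  rcases huv.eq_or_lt with rfl | huv'
  · simp
  have hκ := hN.kpos
  have hL := hP.Ln
  have hCb := sp_Cb_one k
  have hα : 0 < 1 - H := by linarith [hN.Hlt]
  set D := d0 + K * h ^ (1 - H) with hD
  have hD0 : 0 ≤ D := by positivity
  have hDu : ∀ w, s ≤ w → w ≤ s + h →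
      eLpNorm (fun ω => J w ω * (ψ1 w ω - ψ2 w ω)) (sp_p k) μ ≤ ENNReal.ofReal D := fun w h1 h2 => by
    refine (sp_val hN hP hs h1 hd0 (mul_nonneg hK (rpow_nonneg (by linarith) _)) hd
      (hi s w le_rfl h1 h2)).trans
      (ENNReal.ofReal_le_ofReal ?_)
    have : (w - s) ^ (1 - H) ≤ h ^ (1 - H) := rpow_le_rpow (by linarith) (by linarith) hα.le
    rw [hD]; gcongr
  have hP' := sp_trunc hP (s + h)
  have main := sp_I_gen hN hP' hf hM (hs.trans hu) (k := k) (K := K) (D := D) hK hD0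
    (fun a b ha hab => by
      by_cases hb : b ≤ s + h
      · simp only [hb, if_true]; exact hi a b (hu.trans ha) hab hb
      · simp [hb])
    (fun a ha => by
      by_cases hb : a ≤ s + h
      · simp only [hb, if_true]; exact hDu a (hu.trans ha) hb
      · simp [hb]) (h := v - u) (by linarith)
  rw [add_sub_cancel] at main
  simp only [hv, if_true] at main
  have e : (fun ω => J v ω * ((ψ1 v ω - ψ2 v ω) - (ψ1 u ω - ψ2 u ω))) =
      fun ω => J v ω * sp_I f Z ψ1 ψ2 u v ω := by
    ext ω
    rcases hP.J01 v ω with h0 | h0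
    · rw [h0]; ring
    · rw [hE u v (hs.trans hu) huv (hv.trans hτ) ω h0]
  rw [e]
  refine main.trans (ENNReal.ofReal_le_ofReal ?_)
  set q := (v - u) ^ (1 - H) with hq
  have hq0 : 0 ≤ q := rpow_nonneg (by linarith) _
  have hqh : q ≤ h ^ (1 - H) := rpow_le_rpow (by linarith) (by linarith) hα.le
  set g := h ^ (1 - H) with hg
  have hg0 : 0 ≤ g := by positivity
  set a := L * κ⁻¹ with ha
  have ha0 : 0 ≤ a := by positivity
  set C := sp_Cb k with hC
  have hag : a * g ≤ 1 / 200 := by nlinarith [mul_nonneg ha0 hg0]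
  have hCag : C * (a * g) ≤ 1 / 200 := by nlinarith
  have haq : a * q ≤ a * g := by gcongr
  have e1 : 4 * L * κ⁻¹ * q * D + 5 * sp_B k L κ H L K D (v - u) =
      (4 * a * D + 5 * ((4 * a * K + 16 * a * a * D) * q + (1 + 2 * C) * (4 * a) * D)) * q := by
    rw [sp_B, ← hq, ha]
    ring
  rw [e1]
  refine mul_le_mul_of_nonneg_right ?_ hq0
  have e2 : a * a * D * q ≤ a * D * (1 / 200) := by
    calc a * a * D * q = (a * D) * (a * q) := by ring
      _ ≤ (a * D) * (1 / 200) := mul_le_mul_of_nonneg_left (haq.trans hag) (by positivity)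
  have e3 : a * K * q ≤ K * (1 / 200) := by
    calc a * K * q = K * (a * q) := by ring
      _ ≤ _ := mul_le_mul_of_nonneg_left (haq.trans hag) hK
  have e4 : a * D ≤ C * a * D := by
    have : 0 ≤ a * D := by positivity
    nlinarith
  have e5 : C * a * D = C * a * d0 + K * (C * (a * g)) := by rw [hD]; ring
  have e6 : K * (C * (a * g)) ≤ K * (1 / 200) := mul_le_mul_of_nonneg_left hCag hK
  nlinarith

theorem sp_step (hN : SPNoise μ F Z H κ) (hP : SPPath F ψ1 ψ2 J S0 L Q)
    (hf : Measurable fun p : ℝ × ℝ => f p.1 p.2) (hM : ∀ u x, |f u x| ≤ L)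
    (hE : ∀ u v, S0 ≤ u → u ≤ v → v ≤ T → ∀ ω, J v ω = 1 →
      (ψ1 v ω - ψ2 v ω) - (ψ1 u ω - ψ2 u ω) = sp_I f Z ψ1 ψ2 u v ω)
    (hs : S0 ≤ s) {h : ℝ} (hh : 0 < h) (hτ : s + h ≤ T) {k : ℕ} {d0 : ℝ} (hd0 : 0 ≤ d0)
    (hd : eLpNorm (fun ω => J s ω * (ψ1 s ω - ψ2 s ω)) (sp_p k) μ ≤ ENNReal.ofReal d0)
    (hη : 200 * sp_Cb k * (L * κ⁻¹) * h ^ (1 - H) ≤ 1)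
    (u v : ℝ) (hu : s ≤ u) (huv : u ≤ v) (hv : v ≤ s + h) :
    eLpNorm (fun ω => J v ω * ((ψ1 v ω - ψ2 v ω) -
      (ψ1 u ω - ψ2 u ω))) (sp_p k) μ ≤ ENNReal.ofReal ((130 * sp_Cb k * (L * κ⁻¹) * d0) *
        (v - u) ^ (1 - H)) := by
  have hκ := hN.kpos
  have hL := hP.Ln
  have hCb := sp_Cb_one k
  have hα : 0 < 1 - H := by linarith [hN.Hlt]
  set c := 130 * sp_Cb k * (L * κ⁻¹) * d0 with hc
  have hc0 : 0 ≤ c := by positivity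
  set K0 := 2 * L * h ^ H with hK0
  have hK00 : 0 ≤ K0 := by positivity
  have key : ∀ n : ℕ, ∀ u v, s ≤ u → u ≤ v → v ≤ s + h → eLpNorm (fun ω => J v ω *
      ((ψ1 v ω - ψ2 v ω) - (ψ1 u ω - ψ2 u ω))) (sp_p k) μ ≤
      ENNReal.ofReal ((c + K0 * (1 / 2) ^ n) * (v - u) ^ (1 - H)) := by
    intro n
    induction n with
    | zero =>
      intro u v hu huv hv
      have hb : ∀ᵐ ω ∂μ, ‖J v ω * ((ψ1 v ω - ψ2 v ω) - (ψ1 u ω - ψ2 u ω))‖ ≤ 2 * L * (v - u) := by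
        filter_upwards with ω
        rcases hP.J01 v ω with h0 | h0
        · rw [h0, zero_mul, norm_zero]
          exact mul_nonneg (by positivity) (by linarith)
        · have e1 := abs_le.1 (hP.l1 u v (hs.trans hu) huv ω h0)
          have e2 := abs_le.1 (hP.l2 u v (hs.trans hu) huv ω h0)
          rw [h0, one_mul, norm_eq_abs, abs_le]
          constructor <;> linarith
      have h1 := eLpNorm_le_of_ae_bound (p := sp_p k) hb
      simp only [measure_univ, ENNReal.toReal_one, ENNReal.one_rpow, one_mul] at h1
      refine h1.trans (ENNReal.ofReal_le_ofReal ?_)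
      rcases huv.eq_or_lt with rfl | huv'
      · rw [sub_self, mul_zero, zero_rpow hα.ne', mul_zero]
      have e : v - u = (v - u) ^ H * (v - u) ^ (1 - H) := by
        rw [← rpow_add (by linarith)]; simp
      have e2 : (v - u) ^ H ≤ h ^ H := rpow_le_rpow (by linarith) (by linarith) hN.Hpos.le
      have e3 : 0 ≤ (v - u) ^ (1 - H) := rpow_nonneg (by linarith) _
      calc 2 * L * (v - u) = (2 * L * (v - u) ^ H) * (v - u) ^ (1 - H) := by
            rw [mul_assoc (2 * L), ← e]
        _ ≤ (c + K0 * (1/2) ^ 0) * (v - u) ^ (1 - H) := by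
            refine mul_le_mul_of_nonneg_right ?_ e3
            have : 2 * L * (v - u) ^ H ≤ K0 := by rw [hK0]; gcongr
            simp; linarith
    | succ n ih =>
      intro u v hu huv hv
      refine (sp_improve hN hP hf hM hE hs hh hτ hd0 hd hη (by positivity) ih u v hu huv hv).trans
        (ENNReal.ofReal_le_ofReal (le_of_eq ?_))
      congr 1
      rw [hc, pow_succ]; ring
  have hlim : Filter.Tendsto (fun n : ℕ => ENNReal.ofReal ((c + K0 * (1 / 2) ^ n) * (v - u) ^ (1 - H)))
      Filter.atTop (nhds (ENNReal.ofReal (c * (v - u) ^ (1 - H)))) := by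
    refine ENNReal.tendsto_ofReal ?_
    have := ((tendsto_pow_atTop_nhds_zero_of_lt_one (r := (1:ℝ) / 2) (by positivity)
          (by norm_num)).const_mul K0).const_add c |>.mul_const ((v - u) ^ (1 - H))
    simpa using this
  exact ge_of_tendsto' hlim fun n => key n u v hu huv hv

end

/-- The scale constant. -/
def sp_Ac (k : ℕ) (L κ : ℝ) : ℝ := 1 + 200 * sp_Cb k * (L * κ⁻¹)

/-- Number of windows. -/
def sp_Nw (k : ℕ) (L κ T : ℝ) : ℕ := ⌈T * sp_Ac k L κ ^ (3 / 2 : ℝ)⌉₊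

section
variable {Ω : Type*} [MeasurableSpace Ω] {μ : Measure Ω} [IsProbabilityMeasure μ]
    {F : ℝ → MeasurableSpace Ω} {Z : ℝ → Ω → ℝ} {H κ : ℝ}
    {ψ1 ψ2 J : ℝ → Ω → ℝ} {S0 L Q : ℝ}
    {f : ℝ → ℝ → ℝ} {M : ℝ}
    {s m t T : ℝ}

set_option linter.unusedSectionVars false

theorem sp_gron (hN : SPNoise μ F Z H κ) (hP : SPPath F ψ1 ψ2 J S0 L Q)
    (hf : Measurable fun p : ℝ × ℝ => f p.1 p.2) (hM : ∀ u x, |f u x| ≤ L)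
    (hE : ∀ u v, S0 ≤ u → u ≤ v → v ≤ T → ∀ ω, J v ω = 1 →
      (ψ1 v ω - ψ2 v ω) - (ψ1 u ω - ψ2 u ω) = sp_I f Z ψ1 ψ2 u v ω)
    {k : ℕ} {d0 : ℝ} (hd0 : 0 ≤ d0)
    (hd : eLpNorm (fun ω => J S0 ω * (ψ1 S0 ω - ψ2 S0 ω)) (sp_p k) μ ≤ ENNReal.ofReal d0)
    (u v : ℝ) (hu : S0 ≤ u) (huv : u ≤ v) (hv : v ≤ T) :
    eLpNorm (fun ω => J v ω * ((ψ1 v ω - ψ2 v ω) -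
      (ψ1 u ω - ψ2 u ω))) (sp_p k) μ ≤
      ENNReal.ofReal ((2 * sp_Ac k L κ ^ 2 * 2 ^ (sp_Nw k L κ T) * d0) * (v - u) ^ (1 - H)) := by
  have hκ := hN.kpos
  have hL := hP.Ln
  have hCb := sp_Cb_one k
  have hH := hN.Hlt
  have hα : 0 < 1 - H := by linarith [hN.Hlt]
  set A := sp_Ac k L κ with hA
  have hA1 : 1 ≤ A := by
    rw [hA, sp_Ac]
    have : 0 ≤ 200 * sp_Cb k * (L * κ⁻¹) := by positivity
    linarith
  have hA0 : 0 < A := by linarith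
  set h := A ^ (-(3 / 2) : ℝ) with hh
  have hh0 : 0 < h := by positivity
  have hhα : h ^ (1 - H) ≤ A⁻¹ := by
    rw [hh, ← rpow_mul hA0.le, ← rpow_neg_one]
    exact rpow_le_rpow_of_exponent_le hA1 (by linarith)
  have hhα' : (A ^ 2)⁻¹ ≤ h ^ (1 - H) := by
    rw [hh, ← rpow_mul hA0.le, ← rpow_natCast, ← rpow_neg hA0.le]
    refine rpow_le_rpow_of_exponent_le hA1 ?_
    push_cast
    linarith [hN.Hpos]
  have hη : ∀ h', 0 ≤ h' → h' ≤ h → 200 * sp_Cb k * (L * κ⁻¹) * h' ^ (1 - H) ≤ 1 := by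
    intro h' h1 h2
    have e1 : h' ^ (1 - H) ≤ A⁻¹ := (rpow_le_rpow h1 h2 hα.le).trans hhα
    calc 200 * sp_Cb k * (L * κ⁻¹) * h' ^ (1 - H) ≤ A * A⁻¹ := by
          refine mul_le_mul ?_ e1 (by positivity) hA0.le
          rw [hA, sp_Ac]; linarith
      _ = 1 := by field_simp
  -- increments over one short window
  have hinc : ∀ a b d, S0 ≤ a → a ≤ b → b ≤ T → b - a ≤ h → 0 ≤ d →
      eLpNorm (fun ω => J a ω * (ψ1 a ω - ψ2 a ω)) (sp_p k) μ ≤ ENNReal.ofReal d →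
      eLpNorm (fun ω => J b ω * ((ψ1 b ω - ψ2 b ω) - (ψ1 a ω - ψ2 a ω))) (sp_p k) μ ≤
      ENNReal.ofReal (A * d * (b - a) ^ (1 - H)) := by
    intro a b d ha hab hb hbh hd' hda
    rcases hab.eq_or_lt with rfl | hab'
    · simp
    refine (sp_step hN hP hf hM hE ha (h := b - a) (by linarith) (by linarith) hd' hda
      (hη _ (by linarith) hbh) a b le_rfl hab (by linarith)).trans (ENNReal.ofReal_le_ofReal ?_)
    refine mul_le_mul_of_nonneg_right (mul_le_mul_of_nonneg_right ?_ hd')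
      (rpow_nonneg (by linarith) _)
    rw [hA, sp_Ac]
    have : 0 ≤ sp_Cb k * (L * κ⁻¹) := by positivity
    nlinarith
  have hval : ∀ a b d, S0 ≤ a → a ≤ b → b ≤ T → b - a ≤ h → 0 ≤ d →
      eLpNorm (fun ω => J a ω * (ψ1 a ω - ψ2 a ω)) (sp_p k) μ ≤ ENNReal.ofReal d →
      eLpNorm (fun ω => J b ω * (ψ1 b ω - ψ2 b ω)) (sp_p k) μ ≤ ENNReal.ofReal (2 * d) := by
    intro a b d ha hab hb hbh hd' hda
    refine (sp_val hN hP ha hab hd' ?_ hda (hinc a b d ha hab hb hbh hd' hda)).trans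
      (ENNReal.ofReal_le_ofReal ?_)
    · have := rpow_nonneg (sub_nonneg.2 hab) (1 - H)
      positivity
    · have e1 : (b - a) ^ (1 - H) ≤ A⁻¹ := (rpow_le_rpow (by linarith) hbh hα.le).trans hhα
      have : A * d * (b - a) ^ (1 - H) ≤ A * d * A⁻¹ := by gcongr
      have e : A * d * A⁻¹ = d := by field_simp
      linarith
  have hall : ∀ n : ℕ, ∀ w, S0 ≤ w → w ≤ T → w ≤ S0 + n * h →
      eLpNorm (fun ω => J w ω * (ψ1 w ω - ψ2 w ω)) (sp_p k) μ ≤ ENNReal.ofReal (2 ^ n * d0) := by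
    intro n
    induction n with
    | zero =>
      intro w h1 h2 h3
      have : w = S0 := le_antisymm (by simpa using h3) h1
      subst this; simpa using hd
    | succ n ih =>
      intro w h1 h2 h3
      push_cast at h3
      have := hval (max S0 (w - h)) w (2 ^ n * d0) (le_max_left _ _) (max_le h1 (by linarith)) h2
        (by linarith [le_max_right S0 (w - h)]) (by positivity)
        (ih _ (le_max_left _ _) (max_le (h1.trans h2) (by linarith)) (max_le (by
          have : 0 ≤ n * h := by positivity
          linarith) (by linarith)))
      rw [pow_succ, mul_comm ((2:ℝ) ^ n) 2, mul_assoc]; exact this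
  set N := sp_Nw k L κ T with hNd
  have hT0 : 0 ≤ T := hP.S0n.trans (hu.trans (huv.trans hv))
  have hNh : T ≤ N * h := by
    have : T * A ^ (3 / 2 : ℝ) ≤ N := Nat.le_ceil _
    calc T = T * A ^ (3 / 2 : ℝ) * h := by
          rw [hh, mul_assoc, ← rpow_add hA0]; simp
      _ ≤ _ := by gcongr
  have hV : ∀ w, S0 ≤ w → w ≤ T →
      eLpNorm (fun ω => J w ω * (ψ1 w ω - ψ2 w ω)) (sp_p k) μ ≤ ENNReal.ofReal (2 ^ N * d0) :=
    fun w h1 h2 => hall N w h1 h2 (by linarith [hP.S0n])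
  have hq0 : 0 ≤ (v - u) ^ (1 - H) := rpow_nonneg (by linarith) _
  by_cases hc : v - u ≤ h
  · refine (hinc u v _ hu huv hv hc (by positivity) (hV u hu (huv.trans hv))).trans
      (ENNReal.ofReal_le_ofReal (mul_le_mul_of_nonneg_right ?_ hq0))
    have : A ≤ 2 * A ^ 2 := by nlinarith
    calc A * (2 ^ N * d0) ≤ 2 * A ^ 2 * (2 ^ N * d0) := by gcongr
      _ = _ := by ring
  · push Not at hc
    have e1 : (A ^ 2)⁻¹ ≤ (v - u) ^ (1 - H) :=
      hhα'.trans (rpow_le_rpow hh0.le hc.le hα.le)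
    have h1 : eLpNorm (fun ω => -(J v ω * (ψ1 u ω - ψ2 u ω))) (sp_p k) μ ≤
        ENNReal.ofReal (1 * (2 ^ N * d0)) := by
      refine sp_lp_mono zero_le_one ?_ (hV u hu (huv.trans hv))
      filter_upwards with ω
      have := hP.Janti u v hu huv ω
      rw [abs_neg, abs_mul, abs_mul, one_mul]
      rcases hP.J01 v ω with h | h
      · rw [h]; simp; positivity
      · rcases hP.J01 u ω with h' | h'
        · rw [h, h'] at this; norm_num at this
        · rw [h, h']
    have h2 := sp_lp_add (sp_path_meas hN hP (hu.trans huv) (hu.trans huv) hu).2.2.1.aestronglyMeasurable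
      (sp_path_meas hN hP hu (hu.trans huv) hu).2.2.1.neg.aestronglyMeasurable
      (by positivity) (by positivity) (hV v (hu.trans huv) hv) h1
    refine le_trans (le_of_eq ?_) (h2.trans (ENNReal.ofReal_le_ofReal ?_))
    · congr 1; ext ω; simp only [Pi.neg_apply]; ring
    · have : A ^ 2 * (A ^ 2)⁻¹ = 1 := by field_simp
      calc 2 ^ N * d0 + 1 * (2 ^ N * d0) = 2 * (2 ^ N * d0) * (A ^ 2 * (A ^ 2)⁻¹) := by
            rw [this]; ring
        _ ≤ 2 * (2 ^ N * d0) * (A ^ 2 * (v - u) ^ (1 - H)) := by gcongr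
        _ = _ := by ring

end

set_option linter.unusedSectionVars false
section
variable {b : ℝ → ℝ → ℝ} {C0 T s x R : ℝ} {Xp Zp : ℝ → ℝ}

theorem sp_path_int (hbm : Measurable fun p : ℝ × ℝ => b p.1 p.2)
    (hb : ∀ t ∈ Icc (0:ℝ) T, ∀ x, |b t x| ≤ C0 * (1 + |x|)) (hX : Continuous Xp)
    {u v : ℝ} (hu : 0 ≤ u) (hv : v ≤ T) : IntegrableOn (fun r => b r (Xp r)) (Ioc u v) := by
  have h1 : IntegrableOn (fun r => C0 * (1 + |Xp r|)) (Ioc u v) := by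
    have : Continuous fun r => C0 * (1 + |Xp r|) := by fun_prop
    exact this.integrableOn_Ioc
  have hm : Measurable (fun r => b r (Xp r)) :=
    hbm.comp (measurable_id.prodMk hX.measurable)
  refine Integrable.mono' h1 hm.aestronglyMeasurable ?_
  filter_upwards [ae_restrict_mem measurableSet_Ioc] with r hr
  exact hb r ⟨hu.trans hr.1.le, hr.2.trans hv⟩ _

theorem sp_path_inc (hbm : Measurable fun p : ℝ × ℝ => b p.1 p.2)
    (hb : ∀ t ∈ Icc (0:ℝ) T, ∀ x, |b t x| ≤ C0 * (1 + |x|)) (hX : Continuous Xp) (hs : 0 ≤ s)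
    (heq : ∀ t ∈ Icc s T, Xp t = x + (∫ r in Ioc s t, b r (Xp r)) + (Zp t - Zp s))
    {u v : ℝ} (hu : s ≤ u) (huv : u ≤ v) (hv : v ≤ T) :
    (Xp v - Zp v) - (Xp u - Zp u) = ∫ r in Ioc u v, b r (Xp r) := by
  rw [heq v ⟨hu.trans huv, hv⟩, heq u ⟨hu, huv.trans hv⟩, ← Ioc_union_Ioc_eq_Ioc hu huv,
    setIntegral_union (Ioc_disjoint_Ioc_of_le le_rfl) measurableSet_Ioc
      (sp_path_int hbm hb hX hs (huv.trans hv)) (sp_path_int hbm hb hX (hs.trans hu) hv)]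
  ring

theorem sp_path_gron (hbm : Measurable fun p : ℝ × ℝ => b p.1 p.2) (hC0 : 0 ≤ C0)
    (hb : ∀ t ∈ Icc (0:ℝ) T, ∀ x, |b t x| ≤ C0 * (1 + |x|)) (hX : Continuous Xp) (hs : 0 ≤ s)
    (heq : ∀ t ∈ Icc s T, Xp t = x + (∫ r in Ioc s t, b r (Xp r)) + (Zp t - Zp s))
    {u : ℝ} (hu : s ≤ u) (huT : u ≤ T) (hZ : ∀ r ∈ Icc s u, |Zp r| ≤ R) :
    ∀ t ∈ Icc s u, 1 + |Xp t| ≤ (1 + |x| + 2 * R) * exp (C0 * T) := by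
  set g : ℝ → ℝ := fun r => C0 * (1 + |Xp r|) with hg
  have hgc : Continuous g := by rw [hg]; fun_prop
  set m : ℝ → ℝ := fun t => (1 + |x| + 2 * R) + ∫ r in s..t, g r with hm
  have hR : 0 ≤ R := (abs_nonneg _).trans (hZ s ⟨le_rfl, hu⟩)
  have hmd : ∀ t, HasDerivAt m (g t) t := fun t => by
    have := (intervalIntegral.integral_hasDerivAt_right (hgc.intervalIntegrable s t)
      (hgc.stronglyMeasurableAtFilter _ _) hgc.continuousAt).const_add (1 + |x| + 2 * R)
    exact this
  have hXm : ∀ t ∈ Icc s u, 1 + |Xp t| ≤ m t := by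
    intro t ht
    have h1 : |∫ r in Ioc s t, b r (Xp r)| ≤ ∫ r in Ioc s t, g r := by
      rw [← norm_eq_abs]
      refine norm_integral_le_of_norm_le hgc.integrableOn_Ioc ?_
      filter_upwards [ae_restrict_mem measurableSet_Ioc] with r hr
      exact hb r ⟨hs.trans hr.1.le, hr.2.trans (ht.2.trans huT)⟩ _
    have h2 := heq t ⟨ht.1, ht.2.trans huT⟩
    rw [hm]; simp only
    rw [intervalIntegral.integral_of_le ht.1, h2]
    have h3 := abs_le.1 (hZ t ht)
    have h4 := abs_le.1 (hZ s ⟨le_rfl, hu⟩)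
    have h5 := abs_le.1 h1
    have h6 := neg_abs_le x
    have h7 := le_abs_self x
    have : |x + (∫ r in Ioc s t, b r (Xp r)) + (Zp t - Zp s)| ≤
      |x| + 2 * R + ∫ r in Ioc s t, g r := by
      rw [abs_le]; constructor <;> linarith [h3.1, h3.2, h4.1, h4.2, h5.1, h5.2]
    linarith
  intro t ht
  have hm0 : ∀ t ∈ Icc s u, 0 ≤ m t := fun t ht => by
    have := hXm t ht
    have := abs_nonneg (Xp t)
    linarith
  have key := norm_le_gronwallBound_of_norm_deriv_right_le (f := m) (f' := g) (a := s) (b := u)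
    (δ := 1 + |x| + 2 * R) (K := C0) (ε := 0)
    (fun t _ => (hmd t).continuousAt.continuousWithinAt)
    (fun t _ => (hmd t).hasDerivWithinAt) (by
      rw [hm]; simp only [intervalIntegral.integral_same, add_zero]
      rw [norm_eq_abs, abs_of_nonneg (by positivity)])
    (fun t ht => by
      have h1 := hXm t ⟨ht.1, ht.2.le⟩
      have h2 := hm0 t ⟨ht.1, ht.2.le⟩
      rw [norm_eq_abs, norm_eq_abs, abs_of_nonneg h2, add_zero, hg]
      simp only
      rw [abs_of_nonneg (by positivity)]
      gcongr) t ht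
  rw [gronwallBound_ε0, norm_eq_abs] at key
  refine (hXm t ht).trans ((le_abs_self _).trans (key.trans ?_))
  gcongr
  linarith [ht.2]

end

/-- The localising event. -/
def sp_Ev {Ω : Type*} (Z : ℝ → Ω → ℝ) (G : Set Ω) (s T R u : ℝ) : Set Ω :=
  {ω | ω ∈ G ∧ s ≤ u ∧ u ≤ T ∧ ∀ r ∈ Icc s u, |Z r ω| ≤ R}

/-- Its indicator. -/
def sp_J {Ω : Type*} (Z : ℝ → Ω → ℝ) (G : Set Ω) (s T R u : ℝ) (ω : Ω) : ℝ :=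
  (sp_Ev Z G s T R u).indicator (fun _ => 1) ω

section
variable {Ω : Type*} [MeasurableSpace Ω] {μ : Measure Ω}
    {F : ℝ → MeasurableSpace Ω} {Z : ℝ → Ω → ℝ} {H κ : ℝ} {G : Set Ω} {s T R : ℝ}

theorem sp_J_one {u : ℝ} {ω : Ω} : sp_J Z G s T R u ω = 1 ↔ ω ∈ sp_Ev Z G s T R u := by
  unfold sp_J
  by_cases h : ω ∈ sp_Ev Z G s T R u <;> simp [h]

theorem sp_J_zero {u : ℝ} {ω : Ω} : sp_J Z G s T R u ω = 0 ↔ ω ∉ sp_Ev Z G s T R u := by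
  unfold sp_J
  by_cases h : ω ∈ sp_Ev Z G s T R u <;> simp [h]

theorem sp_Ev_anti {u v : ℝ} (hu : s ≤ u) (huv : u ≤ v) : sp_Ev Z G s T R v ⊆ sp_Ev Z G s T R u :=
  fun _ h => ⟨h.1, hu, huv.trans h.2.2.1, fun r hr => h.2.2.2 r ⟨hr.1, hr.2.trans huv⟩⟩

theorem sp_Ev_meas (hN : SPNoise μ F Z H κ) (hs : 0 ≤ s) (hG : ∀ u, MeasurableSet[F u] G)
    {u : ℝ} (hu : s ≤ u) : MeasurableSet[F u] (sp_Ev Z G s T R u) := by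
  by_cases huT : u ≤ T
  · have e : sp_Ev Z G s T R u = G ∩ ⋂ q : ℚ, {ω | |Z (max s (min (q:ℝ) u)) ω| ≤ R} := by
      ext ω
      simp only [sp_Ev, mem_ofPred_eq, mem_inter_iff, mem_iInter]
      constructor
      · rintro ⟨h1, h2, h3, h4⟩
        exact ⟨h1, fun q => h4 _ ⟨le_max_left _ _, max_le hu (min_le_right _ _)⟩⟩
      · rintro ⟨h1, h2⟩
        refine ⟨h1, hu, huT, fun r hr => ?_⟩
        have hc : Continuous fun t : ℝ => |Z (max s (min t u)) ω| := by
          have := hN.cont ω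
          fun_prop
        have hcl : IsClosed {t : ℝ | |Z (max s (min t u)) ω| ≤ R} :=
          isClosed_le hc continuous_const
        have := Rat.denseRange_cast (𝕜 := ℝ) |>.induction_on (p := fun t : ℝ => |Z (max s (min t u)) ω| ≤ R)
          r hcl h2
        rwa [min_eq_left hr.2, max_eq_right hr.1] at this
    rw [e]
    refine @MeasurableSet.inter _ (F u) _ _ (hG u) (@MeasurableSet.iInter _ _ (F u) _ _ fun q => ?_)
    have h1 : Measurable[F u] (Z (max s (min (q:ℝ) u))) :=
      (hN.adapt _ (hs.trans (le_max_left _ _))).mono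
        (hN.mono _ _ (max_le hu (min_le_right _ _))) le_rfl
    have h2 : Measurable[F u] fun ω => ‖Z (max s (min (q:ℝ) u)) ω‖ := measurable_norm.comp h1
    exact h2 measurableSet_Iic
  · have : sp_Ev Z G s T R u = ∅ := by
      ext ω; simp [sp_Ev, huT]
    rw [this]; exact @MeasurableSet.empty _ (F u)

theorem sp_ind_meas {Ω : Type*} {m : MeasurableSpace Ω} {A : Set Ω} (hA : MeasurableSet A) :
    Measurable (A.indicator fun _ => (1:ℝ)) := measurable_const.indicator hA

theorem sp_J_meas (hN : SPNoise μ F Z H κ) (hs : 0 ≤ s) (hG : ∀ u, MeasurableSet[F u] G)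
    {u : ℝ} (hu : s ≤ u) : Measurable[F u] (sp_J Z G s T R u) :=
  sp_ind_meas (sp_Ev_meas hN hs hG hu)

variable [IsProbabilityMeasure μ] {b : ℝ → ℝ → ℝ} {C0 x y CK : ℝ} {X Y : ℝ → Ω → ℝ}

/-- Localised moment bound for the increments of the difference of two solutions. -/
theorem sp_loc (hN : SPNoise μ F Z H κ) (hbm : Measurable fun p : ℝ × ℝ => b p.1 p.2)
    (hC0 : 0 ≤ C0) (hb : ∀ t ∈ Icc (0:ℝ) T, ∀ x, |b t x| ≤ C0 * (1 + |x|)) (hs : 0 ≤ s)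
    (hG : ∀ u, MeasurableSet[F u] G) (hR : 0 ≤ R)
    (hx : |x| ≤ CK) (hy : |y| ≤ CK)
    (hXc : ∀ ω, Continuous fun t => X t ω) (hYc : ∀ ω, Continuous fun t => Y t ω)
    (hXm : ∀ u, s ≤ u → Measurable[F u] (X u)) (hYm : ∀ u, s ≤ u → Measurable[F u] (Y u))
    (hXe : ∀ ω ∈ G, ∀ t ∈ Icc s T, X t ω = x + (∫ r in Ioc s t, b r (X r ω)) + (Z t ω - Z s ω))
    (hYe : ∀ ω ∈ G, ∀ t ∈ Icc s T, Y t ω = y + (∫ r in Ioc s t, b r (Y r ω)) + (Z t ω - Z s ω))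
    {L : ℝ} (hL : L = C0 * ((1 + CK + 2 * R) * exp (C0 * T))) (k : ℕ)
    (u v : ℝ) (hu : s ≤ u) (huv : u ≤ v) (hv : v ≤ T) :
    eLpNorm (fun ω => sp_J Z G s T R T ω * ((X v ω - Y v ω) -
      (X u ω - Y u ω))) (sp_p k) μ ≤
      ENNReal.ofReal ((2 * sp_Ac k L κ ^ 2 * 2 ^ (sp_Nw k L κ T) * |x - y|) * (v - u) ^ (1 - H)) := by
  set R' := (1 + CK + 2 * R) * exp (C0 * T) with hR'
  have hCK : 0 ≤ CK := (abs_nonneg x).trans hx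
  have hR'0 : 0 ≤ R' := by positivity
  have hL0 : 0 ≤ L := by rw [hL]; positivity
  set J := sp_J Z G s T R with hJ
  set f : ℝ → ℝ → ℝ := fun r z => if r ∈ Icc 0 T ∧ 1 + |z| ≤ R' then b r z else 0 with hf
  have hfm : Measurable fun p : ℝ × ℝ => f p.1 p.2 := by
    refine Measurable.ite ?_ hbm measurable_const
    refine MeasurableSet.inter (measurable_fst measurableSet_Icc) ?_
    have h1 : Measurable fun p : ℝ × ℝ => 1 + |p.2| := by fun_prop
    exact measurableSet_le h1 measurable_const
  have hfb : ∀ r z, |f r z| ≤ L := by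
    intro r z
    rw [hf]; simp only
    split_ifs with h
    · refine (hb r h.1 z).trans ?_
      rw [hL]; exact mul_le_mul_of_nonneg_left h.2 hC0
    · simpa using hL0
  -- facts on the localising event, for either solution
  have gen : ∀ (X : ℝ → Ω → ℝ) (x : ℝ), |x| ≤ CK → (∀ ω, Continuous fun t => X t ω) →
      (∀ ω ∈ G, ∀ t ∈ Icc s T, X t ω = x + (∫ r in Ioc s t, b r (X r ω)) + (Z t ω - Z s ω)) →
      ∀ ω v, J v ω = 1 → (∀ r ∈ Icc s v, 1 + |X r ω| ≤ R') ∧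
        ∀ u, s ≤ u → u ≤ v → (X v ω - Z v ω) - (X u ω - Z u ω) = ∫ r in Ioc u v, f r (X r ω) := by
    intro X x hx hXc hXe ω v hv
    have hE := sp_J_one.1 hv
    have h1 : ∀ r ∈ Icc s v, 1 + |X r ω| ≤ R' := by
      intro r hr
      refine (sp_path_gron hbm hC0 hb (hXc ω) hs (hXe ω hE.1) hE.2.1 hE.2.2.1 hE.2.2.2 r hr).trans ?_
      rw [hR']; gcongr
    refine ⟨h1, fun u hu huv => ?_⟩
    rw [sp_path_inc hbm hb (hXc ω) hs (hXe ω hE.1) hu huv hE.2.2.1]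
    refine setIntegral_congr_fun measurableSet_Ioc fun r hr => ?_
    have : r ∈ Icc 0 T ∧ 1 + |X r ω| ≤ R' :=
      ⟨⟨(hs.trans hu).trans hr.1.le, hr.2.trans hE.2.2.1⟩, h1 r ⟨hu.trans hr.1.le, hr.2⟩⟩
    simp only [hf, if_pos this]
  have J01 : ∀ u ω, J u ω = 0 ∨ J u ω = 1 := fun u ω => by
    rw [hJ, sp_J_zero, sp_J_one]; tauto
  have Jdown : ∀ u v ω, s ≤ u → u ≤ v → J v ω = 1 → J u ω = 1 := fun u v ω hu huv h =>
    sp_J_one.2 (sp_Ev_anti hu huv (sp_J_one.1 h))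
  have Jm : ∀ u, s ≤ u → Measurable[F u] (J u) := fun u hu => sp_J_meas hN hs hG hu
  set ψ : (ℝ → Ω → ℝ) → ℝ → Ω → ℝ := fun X u ω => J u ω * (X u ω - Z u ω) with hψ
  have ψm : ∀ X : ℝ → Ω → ℝ, (∀ u, s ≤ u → Measurable[F u] (X u)) →
      ∀ u, s ≤ u → Measurable[F u] (ψ X u) := fun X hX u hu =>
    (Jm u hu).mul ((hX u hu).sub (hN.adapt u (hs.trans hu)))
  have ψb : ∀ (X : ℝ → Ω → ℝ) (x : ℝ), |x| ≤ CK → (∀ ω, Continuous fun t => X t ω) →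
      (∀ ω ∈ G, ∀ t ∈ Icc s T, X t ω = x + (∫ r in Ioc s t, b r (X r ω)) + (Z t ω - Z s ω)) →
      ∀ u ω, |ψ X u ω| ≤ R' + R := by
    intro X x hx hXc hXe u ω
    rcases J01 u ω with h | h
    · simp only [hψ, h, zero_mul, abs_zero]; positivity
    · simp only [hψ, h, one_mul]
      have hE := sp_J_one.1 h
      have h1 := (gen X x hx hXc hXe ω u h).1 u ⟨hE.2.1, le_rfl⟩
      have h2 := hE.2.2.2 u ⟨hE.2.1, le_rfl⟩
      have := abs_sub (X u ω) (Z u ω)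
      linarith
  have ψl : ∀ (X : ℝ → Ω → ℝ) (x : ℝ), |x| ≤ CK → (∀ ω, Continuous fun t => X t ω) →
      (∀ ω ∈ G, ∀ t ∈ Icc s T, X t ω = x + (∫ r in Ioc s t, b r (X r ω)) + (Z t ω - Z s ω)) →
      ∀ u v, s ≤ u → u ≤ v → ∀ ω, J v ω = 1 → |ψ X v ω - ψ X u ω| ≤ L * (v - u) := by
    intro X x hx hXc hXe u v hu huv ω h
    simp only [hψ, h, Jdown u v ω hu huv h, one_mul]
    rw [(gen X x hx hXc hXe ω v h).2 u hu huv, ← norm_eq_abs]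
    refine (norm_setIntegral_le_of_norm_le_const (C := L) measure_Ioc_lt_top
      fun r _ => hfb r _).trans ?_
    rw [Real.volume_real_Ioc_of_le huv]
  have hP : SPPath F (ψ X) (ψ Y) J s L (R' + R) :=
    { S0n := hs
      Ln := hL0
      m1 := ψm X hXm
      m2 := ψm Y hYm
      mJ := Jm
      b1 := ψb X x hx hXc hXe
      b2 := ψb Y y hy hYc hYe
      J01 := J01
      Janti := fun u v hu huv ω => by
        rcases J01 v ω with h | h
        · rw [h]; rcases J01 u ω with h' | h' <;> rw [h'] <;> norm_num
        · rw [h, Jdown u v ω hu huv h]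
      l1 := ψl X x hx hXc hXe
      l2 := ψl Y y hy hYc hYe }
  have hfi : ∀ (X : ℝ → Ω → ℝ), (∀ ω, Continuous fun t => X t ω) → ∀ ω u v,
      IntegrableOn (fun r => f r (X r ω)) (Ioc u v) := by
    intro X hX ω u v
    have hm : Measurable (fun r => f r (X r ω)) := hfm.comp (measurable_id.prodMk (hX ω).measurable)
    exact Integrable.of_bound hm.aestronglyMeasurable L (by filter_upwards with r; exact hfb _ _)
  have hE : ∀ u v, s ≤ u → u ≤ v → v ≤ T → ∀ ω, J v ω = 1 →
      (ψ X v ω - ψ Y v ω) - (ψ X u ω - ψ Y u ω) = sp_I f Z (ψ X) (ψ Y) u v ω := by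
    intro u v hu huv hv ω h
    have e1 := (gen X x hx hXc hXe ω v h).2 u hu huv
    have e2 := (gen Y y hy hYc hYe ω v h).2 u hu huv
    have e3 : sp_I f Z (ψ X) (ψ Y) u v ω = ∫ r in Ioc u v, (f r (X r ω) - f r (Y r ω)) := by
      unfold sp_I
      refine setIntegral_congr_fun measurableSet_Ioc fun r hr => ?_
      simp only [hψ, Jdown r v ω (hu.trans hr.1.le) hr.2 h, one_mul]
      congr 2 <;> ring
    rw [e3, integral_sub (hfi X hXc ω u v) (hfi Y hYc ω u v), ← e1, ← e2]
    simp only [hψ, h, Jdown u v ω hu huv h, one_mul]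
    ring
  have hsT : s ≤ T := hu.trans (huv.trans hv)
  have hd : eLpNorm (fun ω => J s ω * (ψ X s ω - ψ Y s ω)) (sp_p k) μ ≤
      ENNReal.ofReal |x - y| := by
    have hbd : ∀ᵐ ω ∂μ, ‖J s ω * (ψ X s ω - ψ Y s ω)‖ ≤ |x - y| := by
      filter_upwards with ω
      rcases J01 s ω with h | h
      · rw [h, zero_mul, norm_zero]; exact abs_nonneg _
      · have hG := (sp_J_one.1 h).1
        have e1 := hXe ω hG s ⟨le_rfl, hsT⟩
        have e2 := hYe ω hG s ⟨le_rfl, hsT⟩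
        simp only [Ioc_self, Measure.restrict_empty, integral_zero_measure, sub_self, add_zero] at e1 e2
        simp only [hψ, h, one_mul, e1, e2]
        rw [norm_eq_abs]; apply le_of_eq; congr 1; ring
    have h1 := eLpNorm_le_of_ae_bound (p := sp_p k) hbd
    simpa only [measure_univ, ENNReal.one_rpow, one_mul] using h1
  have key := sp_gron hN hP hfm hfb hE (k := k) (abs_nonneg (x - y)) hd u v hu huv hv
  have := sp_lp_mono (X := fun ω => J T ω * ((X v ω - Y v ω) - (X u ω - Y u ω))) zero_le_one ?_ key
  · rwa [one_mul] at this
  · filter_upwards with ω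
    rcases J01 T ω with h | h
    · rw [h, zero_mul, abs_zero]; positivity
    · have hv1 := Jdown v T ω (hu.trans huv) hv h
      have hu1 := Jdown u v ω hu huv hv1
      simp only [h, hψ, hv1, hu1, one_mul]
      apply le_of_eq; congr 1; ring

end

set_option linter.unusedSectionVars false

/-- Deterministic dyadic chaining on the unit interval. -/
theorem sp_chain01 {g : ℝ → ℝ} (hg : Continuous g) {e : ℕ → ℝ} (he : ∀ n, 0 ≤ e n)
    (hs : Summable e)
    (h : ∀ n k : ℕ, k < 2 ^ n → |g (((k + 1 : ℕ) : ℝ) / 2 ^ n) - g ((k : ℝ) / 2 ^ n)| ≤ e n)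
    {t : ℝ} (ht : t ∈ Icc (0:ℝ) 1) : |g t - g 0| ≤ ∑' n, e n := by
  set c : ℕ → ℕ := fun n => ⌊t * 2 ^ n⌋₊ with hc
  have hc1 : ∀ n, (c n : ℝ) ≤ t * 2 ^ n := fun n => Nat.floor_le (by have := ht.1; positivity)
  have hc2 : ∀ n, t * 2 ^ n < c n + 1 := fun n => Nat.lt_floor_add_one _
  have hlim : Filter.Tendsto (fun n => (c n : ℝ) / 2 ^ n) Filter.atTop (nhds t) := by
    have h1 : Filter.Tendsto (fun n : ℕ => t - (1 / 2 : ℝ) ^ n) Filter.atTop (nhds t) := by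
      have := tendsto_pow_atTop_nhds_zero_of_lt_one (r := (1/2:ℝ)) (by norm_num) (by norm_num)
      simpa using this.const_sub t
    refine tendsto_of_tendsto_of_tendsto_of_le_of_le h1 tendsto_const_nhds ?_ ?_
    · intro n
      have := hc2 n
      have h2 : (0:ℝ) < 2 ^ n := by positivity
      show t - (1 / 2 : ℝ) ^ n ≤ (c n : ℝ) / 2 ^ n
      rw [le_div_iff₀ h2, sub_mul, ← mul_pow]
      norm_num; linarith
    · intro n
      have h2 : (0:ℝ) < 2 ^ n := by positivity
      show (c n : ℝ) / 2 ^ n ≤ t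
      rw [div_le_iff₀ h2]; exact hc1 n
  have hb : ∀ n, |g ((c n : ℝ) / 2 ^ n) - g 0| ≤ ∑ i ∈ Finset.range (n + 1), e i := by
    intro n
    induction n with
    | zero =>
      simp only [zero_add, Finset.range_one, Finset.sum_singleton]
      have h3 : c 0 ≤ 1 := by
        have := hc1 0
        have h4 : (c 0 : ℝ) ≤ 1 := this.trans (by simpa using ht.2)
        exact_mod_cast h4
      rcases Nat.le_one_iff_eq_zero_or_eq_one.1 h3 with h4 | h4
      · rw [h4]; simpa using he 0
      · rw [h4]; simpa using h 0 0 (by norm_num)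
    | succ n ih =>
      rw [Finset.sum_range_succ]
      have h5 : |g ((c (n+1) : ℝ) / 2 ^ (n+1)) - g ((c n : ℝ) / 2 ^ n)| ≤ e (n + 1) := by
        have a1 : c (n + 1) < 2 * c n + 2 := by
          have x1 := hc1 (n + 1)
          have x2 := hc2 n
          have : (c (n + 1) : ℝ) < 2 * c n + 2 := by rw [pow_succ] at x1; linarith
          exact_mod_cast this
        have a2 : 2 * c n < c (n + 1) + 1 := by
          have x1 := hc2 (n + 1)
          have x2 := hc1 n
          have : 2 * (c n : ℝ) < c (n + 1) + 1 := by rw [pow_succ] at x1; linarith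
          exact_mod_cast this
        have e1 : (c n : ℝ) / 2 ^ n = ((2 * c n : ℕ) : ℝ) / 2 ^ (n + 1) := by
          push_cast; rw [pow_succ]; field_simp
        have : c (n + 1) = 2 * c n ∨ c (n + 1) = 2 * c n + 1 := by omega
        rcases this with h6 | h6
        · rw [h6, e1, sub_self, abs_zero]; exact he _
        · rw [h6, e1]
          refine h (n + 1) (2 * c n) ?_
          have x1 := hc1 (n + 1)
          have : ((2 * c n + 1 : ℕ) : ℝ) ≤ ((2 ^ (n + 1) : ℕ) : ℝ) := by
            rw [← h6]; push_cast
            refine x1.trans ?_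
            exact mul_le_of_le_one_left (by positivity) ht.2
          have : 2 * c n + 1 ≤ 2 ^ (n + 1) := by exact_mod_cast this
          omega
      have := abs_add_le (g ((c (n+1) : ℝ) / 2 ^ (n+1)) - g ((c n : ℝ) / 2 ^ n))
        (g ((c n : ℝ) / 2 ^ n) - g 0)
      rw [sub_add_sub_cancel] at this
      linarith
  have hl2 : Filter.Tendsto (fun n => |g ((c n : ℝ) / 2 ^ n) - g 0|) Filter.atTop
      (nhds |g t - g 0|) := (((hg.tendsto t).comp hlim).sub_const _).abs
  refine le_of_tendsto hl2 (Filter.Eventually.of_forall fun n => (hb n).trans ?_)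
  exact hs.sum_le_tsum _ (fun i _ => he i)

/-- Dyadic points. -/
def sp_dy (a b : ℝ) (n k : ℕ) : ℝ := a + (b - a) * ((k : ℝ) / 2 ^ n)

theorem sp_dy_mem {a b : ℝ} (hab : a ≤ b) {n k : ℕ} (hk : k ≤ 2 ^ n) :
    a ≤ sp_dy a b n k ∧ sp_dy a b n k ≤ b := by
  have h1 : ((k : ℝ) / 2 ^ n) ≤ 1 := by
    rw [div_le_one (by positivity)]; exact_mod_cast hk
  have h0 : 0 ≤ ((k : ℝ) / 2 ^ n) := by positivity
  unfold sp_dy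
  constructor
  · have := mul_nonneg (sub_nonneg.2 hab) h0; linarith
  · have := mul_le_mul_of_nonneg_left h1 (sub_nonneg.2 hab); linarith

theorem sp_dy_sub (a b : ℝ) (n k : ℕ) :
    sp_dy a b n (k + 1) - sp_dy a b n k = (b - a) * (1 / 2) ^ n := by
  unfold sp_dy; push_cast; rw [div_pow, one_pow]; ring

theorem sp_chain {g : ℝ → ℝ} (hg : Continuous g) {a b : ℝ} (hab : a ≤ b) {e : ℕ → ℝ}
    (he : ∀ n, 0 ≤ e n) (hs : Summable e)
    (h : ∀ n k : ℕ, k < 2 ^ n → |g (sp_dy a b n (k + 1)) - g (sp_dy a b n k)| ≤ e n)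
    {t : ℝ} (ht : t ∈ Icc a b) : |g t - g a| ≤ ∑' n, e n := by
  rcases hab.eq_or_lt with rfl | hab'
  · have : t = a := le_antisymm ht.2 ht.1
    rw [this, sub_self, abs_zero]; exact tsum_nonneg he
  have := sp_chain01 (g := fun x => g (a + (b - a) * x)) (by fun_prop) he hs h
    (t := (t - a) / (b - a)) ⟨div_nonneg (by linarith [ht.1]) (by linarith),
      (div_le_one (by linarith)).2 (by linarith [ht.2])⟩
  simp only [mul_zero, add_zero] at this
  have e1 : a + (b - a) * ((t - a) / (b - a)) = t := by
    have : b - a ≠ 0 := by linarith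
    field_simp; ring
  rwa [e1] at this

/-- The chaining ratio. -/
def sp_q : ℝ := 2 ^ (-(1 / 5) : ℝ)

theorem sp_q_pos : 0 < sp_q := by unfold sp_q; positivity

theorem sp_q_lt : sp_q < 1 := by
  unfold sp_q; exact rpow_lt_one_of_one_lt_of_neg (by norm_num) (by norm_num)

theorem sp_q_five : sp_q ^ 5 = 1 / 2 := by
  unfold sp_q
  rw [← rpow_natCast, ← rpow_mul (by norm_num)]
  norm_num

theorem sp_half_rpow {H : ℝ} (hH : H < 1 / 6) (n : ℕ) :
    ((1 / 2 : ℝ) ^ n) ^ (1 - H) ≤ (sp_q ^ 4) ^ n := by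
  have h1 : ((1 / 2 : ℝ) ^ n) ^ (1 - H) ≤ ((1 / 2 : ℝ) ^ n) ^ (4 / 5 : ℝ) :=
    rpow_le_rpow_of_exponent_ge (by positivity) (pow_le_one₀ (by norm_num) (by norm_num))
      (by linarith)
  refine h1.trans (le_of_eq ?_)
  rw [← sp_q_five, ← rpow_natCast, ← rpow_natCast, ← rpow_natCast, ← rpow_natCast,
    ← rpow_mul sp_q_pos.le, ← rpow_mul sp_q_pos.le, ← rpow_mul sp_q_pos.le]
  congr 1; push_cast; ring

theorem sp_chain_lp {Ω : Type*} [MeasurableSpace Ω] {μ : Measure Ω} [IsProbabilityMeasure μ]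
    {D : ℝ → Ω → ℝ} {J : Ω → ℝ} (hD : ∀ ω, Continuous fun t => D t ω)
    {a b T H G : ℝ} (ha : 0 ≤ a) (hab : a ≤ b) (hb : b ≤ T) (hH0 : 0 < H) (hH : H < 1 / 6)
    (hG : 0 ≤ G) {k : ℕ}
    (hm : ∀ u v, a ≤ u → u ≤ v → v ≤ b → Measurable fun ω => J ω * (D v ω - D u ω))
    (h : ∀ u v, a ≤ u → u ≤ v → v ≤ b → eLpNorm (fun ω => J ω * (D v ω - D u ω)) (sp_p k) μ ≤
      ENNReal.ofReal (G * (v - u) ^ (1 - H))) :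
    ∃ S : Ω → ℝ≥0∞, Measurable S ∧ (∀ ω, J ω = 1 → ∀ t ∈ Icc a b,
        ENNReal.ofReal (|D t ω - D a ω| ^ (2 * (k + 1))) ≤ S ω) ∧
      ∫⁻ ω, S ω ∂μ ≤ ENNReal.ofReal ((1 - sp_q)⁻¹ ^ (2 * (k + 1)) *
        ((G * (1 + T)) ^ (2 * (k + 1)) * (1 - sp_q)⁻¹)) := by
  set p := 2 * (k + 1) with hp
  have hpe : Even p := ⟨k + 1, by omega⟩
  have hp0 : p ≠ 0 := by omega
  have hq0 := sp_q_pos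
  have hq1 := sp_q_lt
  have hc0 : 0 < (1 - sp_q)⁻¹ := inv_pos.2 (by linarith)
  set Δ : ℕ → ℕ → Ω → ℝ := fun n i ω => J ω * (D (sp_dy a b n (i + 1)) ω - D (sp_dy a b n i) ω)
    with hΔ
  have hle : ∀ n i, sp_dy a b n i ≤ sp_dy a b n (i + 1) := fun n i => by
    have := sp_dy_sub a b n i
    have h2 : 0 ≤ (b - a) * (1 / 2 : ℝ) ^ n := mul_nonneg (by linarith) (by positivity)
    linarith
  have hΔm : ∀ n i, i < 2 ^ n → Measurable (Δ n i) := fun n i hi =>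
    hm _ _ (sp_dy_mem hab hi.le).1 (hle n i) (sp_dy_mem hab hi).2
  have hΔE : ∀ n i, i < 2 ^ n → ∫⁻ ω, ENNReal.ofReal (Δ n i ω ^ p) ∂μ ≤
      ENNReal.ofReal ((G * (1 + T)) ^ p * ((sp_q ^ 4) ^ n) ^ p) := by
    intro n i hi
    have h1 := h _ _ (sp_dy_mem hab hi.le).1 (hle n i) (sp_dy_mem hab hi).2
    rw [sp_dy_sub] at h1
    have h2 : G * ((b - a) * (1 / 2) ^ n) ^ (1 - H) ≤ G * (1 + T) * (sp_q ^ 4) ^ n := by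
      rw [mul_rpow (by linarith) (by positivity), mul_assoc]
      have h3 : (b - a) ^ (1 - H) ≤ 1 + T := by
        calc (b - a) ^ (1 - H) ≤ (1 + T) ^ (1 - H) :=
              rpow_le_rpow (by linarith) (by linarith) (by linarith)
          _ ≤ (1 + T) ^ (1 : ℝ) := rpow_le_rpow_of_exponent_le (by linarith) (by linarith)
          _ = _ := rpow_one _
      exact mul_le_mul_of_nonneg_left (mul_le_mul h3 (sp_half_rpow hH n) (by positivity)
        (by linarith)) hG
    have h4 := (sp_lp_iff k _ (by have : 0 ≤ T := by linarith
                                  positivity)).1 (h1.trans (ENNReal.ofReal_le_ofReal h2))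
    rw [← mul_pow]
    exact h4
  set S0 : Ω → ℝ≥0∞ := fun ω => ∑' n : ℕ, ENNReal.ofReal ((sp_q⁻¹ ^ n) ^ p) *
    ∑ i ∈ Finset.range (2 ^ n), ENNReal.ofReal (Δ n i ω ^ p) with hS0
  have hSm : ∀ n, Measurable fun ω => ENNReal.ofReal ((sp_q⁻¹ ^ n) ^ p) *
    ∑ i ∈ Finset.range (2 ^ n), ENNReal.ofReal (Δ n i ω ^ p) := fun n => by
    refine Measurable.const_mul ?_ _
    refine Finset.measurable_fun_sum _ fun i hi => ?_
    exact ((hΔm n i (Finset.mem_range.1 hi)).pow_const p).ennreal_ofReal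
  refine ⟨fun ω => ENNReal.ofReal ((1 - sp_q)⁻¹ ^ p) * S0 ω,
    (Measurable.ennreal_tsum hSm).const_mul _, ?_, ?_⟩
  · intro ω hJ t ht
    simp only
    by_cases htop : S0 ω = ∞
    · rw [htop, ENNReal.mul_top (by simpa using by positivity)]; exact le_top
    set lam := (S0 ω).toReal ^ ((p : ℝ)⁻¹) with hlamd
    have hlam : 0 ≤ lam := by positivity
    have hlamp : lam ^ p = (S0 ω).toReal := by
      rw [hlamd]; exact rpow_inv_natCast_pow ENNReal.toReal_nonneg hp0
    have hb1 : ∀ n i : ℕ, i < 2 ^ n → |D (sp_dy a b n (i + 1)) ω - D (sp_dy a b n i) ω| ≤ lam * sp_q ^ n := by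
      intro n i hi
      have h1 : ENNReal.ofReal ((sp_q⁻¹ ^ n) ^ p) * ENNReal.ofReal (Δ n i ω ^ p) ≤ S0 ω := by
        refine le_trans ?_ (ENNReal.le_tsum n)
        refine mul_le_mul_right ?_ _
        exact Finset.single_le_sum (f := fun i => ENNReal.ofReal (Δ n i ω ^ p))
          (fun _ _ => zero_le) (Finset.mem_range.2 hi)
      rw [← ENNReal.ofReal_mul (by positivity), ← mul_pow] at h1
      have h2 := ENNReal.toReal_mono htop h1
      have hΔe : Δ n i ω = D (sp_dy a b n (i + 1)) ω - D (sp_dy a b n i) ω := by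
        simp only [hΔ, hJ, one_mul]
      rw [ENNReal.toReal_ofReal (hpe.pow_nonneg _), ← hlamp, ← hpe.pow_abs] at h2
      have h3 := (pow_le_pow_iff_left₀ (abs_nonneg _) hlam hp0).1 h2
      rw [abs_mul, abs_of_nonneg (by positivity), inv_pow, hΔe] at h3
      have h4 : 0 < sp_q ^ n := by positivity
      rwa [inv_mul_le_iff₀ h4, mul_comm] at h3
    have h2 := sp_chain (hD ω) hab (e := fun n => lam * sp_q ^ n) (fun n => by positivity)
      ((summable_geometric_of_lt_one hq0.le hq1).mul_left _) hb1 ht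
    rw [tsum_mul_left, tsum_geometric_of_lt_one hq0.le hq1] at h2
    calc ENNReal.ofReal (|D t ω - D a ω| ^ p) ≤ ENNReal.ofReal ((lam * (1 - sp_q)⁻¹) ^ p) :=
          ENNReal.ofReal_le_ofReal (pow_le_pow_left₀ (abs_nonneg _) h2 _)
      _ = _ := by
          rw [mul_pow, hlamp, mul_comm, ENNReal.ofReal_mul (by positivity), ENNReal.ofReal_toReal htop]
  · rw [lintegral_const_mul _ (Measurable.ennreal_tsum hSm), ENNReal.ofReal_mul (by positivity)]
    refine mul_le_mul_right ?_ _
    rw [lintegral_tsum fun n => (hSm n).aemeasurable]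
    have hterm : ∀ n : ℕ, ∫⁻ ω, ENNReal.ofReal ((sp_q⁻¹ ^ n) ^ p) *
        ∑ i ∈ Finset.range (2 ^ n), ENNReal.ofReal (Δ n i ω ^ p) ∂μ ≤
        ENNReal.ofReal ((G * (1 + T)) ^ p * sp_q ^ n) := by
      intro n
      rw [lintegral_const_mul' _ _ ENNReal.ofReal_ne_top, lintegral_finsetSum' _ fun i hi =>
        ((hΔm n i (Finset.mem_range.1 hi)).pow_const p).ennreal_ofReal.aemeasurable]
      have h1 : ∑ i ∈ Finset.range (2 ^ n), ∫⁻ ω, ENNReal.ofReal (Δ n i ω ^ p) ∂μ ≤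
          ENNReal.ofReal (2 ^ n * ((G * (1 + T)) ^ p * ((sp_q ^ 4) ^ n) ^ p)) := by
        refine (Finset.sum_le_sum fun i hi => hΔE n i (Finset.mem_range.1 hi)).trans ?_
        rw [Finset.sum_const, Finset.card_range, nsmul_eq_mul,
          ENNReal.ofReal_mul (p := 2 ^ n) (by positivity)]
        refine mul_le_mul_left (le_of_eq ?_) _
        rw [ENNReal.ofReal_pow (by norm_num)]; push_cast; simp
      refine (mul_le_mul_right h1 _).trans ?_
      rw [← ENNReal.ofReal_mul (by positivity)]
      refine ENNReal.ofReal_le_ofReal ?_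
      have hT : 0 ≤ T := by linarith
      have e1 : (sp_q⁻¹ ^ n) ^ p * (2 ^ n * ((G * (1 + T)) ^ p * ((sp_q ^ 4) ^ n) ^ p)) =
          (G * (1 + T)) ^ p * (2 * (sp_q ^ 3) ^ p) ^ n := by
        have : sp_q ^ 3 = sp_q⁻¹ * sp_q ^ 4 := by field_simp
        rw [this]; simp only [mul_pow, ← pow_mul]; ring
      rw [e1]
      refine mul_le_mul_of_nonneg_left (pow_le_pow_left₀ (by positivity) ?_ n) (by positivity)
      calc 2 * (sp_q ^ 3) ^ p ≤ 2 * (sp_q ^ 3) ^ 2 := by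
            refine mul_le_mul_of_nonneg_left ?_ (by norm_num)
            exact pow_le_pow_of_le_one (by positivity) (pow_le_one₀ hq0.le hq1.le) (by omega)
        _ = 2 * sp_q ^ 5 * sp_q := by ring
        _ = sp_q := by rw [sp_q_five]; ring
    refine (ENNReal.tsum_le_tsum hterm).trans (le_of_eq ?_)
    have hT : 0 ≤ T := by linarith
    rw [← ENNReal.ofReal_tsum_of_nonneg (fun n => by positivity)
      ((summable_geometric_of_lt_one hq0.le hq1).mul_left _), tsum_mul_left,
      tsum_geometric_of_lt_one hq0.le hq1]

section
variable {Ω : Type*} [MeasurableSpace Ω] {μ : Measure Ω} [IsProbabilityMeasure μ]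
    {H : ℝ} {B : ℝ → Ω → ℝ}

theorem sp_gauss_tail {f : Ω → ℝ} (hf : Measurable f) {v : ℝ≥0} (h : μ.map f = gaussianReal 0 v)
    {r : ℝ} (hr : 0 ≤ r) : μ {ω | r ≤ |f ω|} ≤ ENNReal.ofReal (2 * exp (-r ^ 2 / (2 * v))) := by
  have hs : HasSubgaussianMGF f v μ := by
    refine ⟨fun t => ?_, fun t => ?_⟩
    · have h1 : Integrable (fun x => exp (t * x)) (μ.map f) := by
        rw [h]; exact integrable_exp_mul_gaussianReal t
      exact h1.comp_measurable hf
    · rw [mgf_gaussianReal h]; simp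
  have h1 := hs.measure_ge_le hr
  have h2 := hs.neg.measure_ge_le hr
  have h3 : {ω | r ≤ |f ω|} ⊆ {ω | r ≤ f ω} ∪ {ω | r ≤ (-f) ω} := by
    intro ω hω
    rcases le_abs.1 (show r ≤ |f ω| from hω) with h | h
    · exact Or.inl h
    · exact Or.inr h
  refine (measure_mono h3).trans ((measure_union_le _ _).trans ?_)
  rw [two_mul, ENNReal.ofReal_add (by positivity) (by positivity)]
  refine add_le_add ?_ ?_
  · rw [← ofReal_measureReal]; exact ENNReal.ofReal_le_ofReal h1
  · rw [← ofReal_measureReal]; exact ENNReal.ofReal_le_ofReal h2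

theorem sp_fbm_inc (hB : IsFBM μ H B) {s t : ℝ} (hs : 0 ≤ s) (ht : 0 ≤ t) (hH : 0 < H) :
    ∃ v : ℝ≥0, μ.map (fun ω => B t ω - B s ω) = gaussianReal 0 v ∧ (v : ℝ) = |t - s| ^ (2 * H) := by
  obtain ⟨v, hv⟩ := hB.gaussian 2 ![t, s] ![1, -1]
  have e : (fun ω => ∑ i, ![(1:ℝ), -1] i * B (![t, s] i) ω) = fun ω => B t ω - B s ω := by
    ext ω; simp [Fin.sum_univ_two]; ring
  rw [e] at hv
  refine ⟨v, hv, ?_⟩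
  rw [← (sp_gauss_second ((hB.meas t).sub (hB.meas s)).aemeasurable hv).1]
  have i1 := (sp_fbm_memLp hB t).integrable_mul (sp_fbm_memLp hB t)
  have i2 := (sp_fbm_memLp hB t).integrable_mul (sp_fbm_memLp hB s)
  have i3 := (sp_fbm_memLp hB s).integrable_mul (sp_fbm_memLp hB s)
  have e2 : (fun ω => (B t ω - B s ω) ^ 2) = fun ω => (B t ω * B t ω - 2 * (B t ω * B s ω)) +
      B s ω * B s ω := by ext ω; ring
  have j1 : Integrable (fun ω => B t ω * B t ω) μ := i1
  have j2 : Integrable (fun ω => 2 * (B t ω * B s ω)) μ := i2.const_mul 2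
  have j3 : Integrable (fun ω => B s ω * B s ω) μ := i3
  have j4 : Integrable (fun ω => B t ω * B t ω - 2 * (B t ω * B s ω)) μ := j1.sub j2
  show ∫ ω, (B t ω - B s ω) ^ 2 ∂μ = _
  rw [e2, integral_add j4 j3, integral_sub j1 j2, integral_const_mul, hB.cov t t ht ht,
    hB.cov s t hs ht, hB.cov s s hs hs]
  simp [zero_rpow (show 2 * H ≠ 0 by positivity)]
  ring

theorem sp_fbm_zero (hB : IsFBM μ H B) (hH : 0 < H) : ∀ᵐ ω ∂μ, B 0 ω = 0 := by
  obtain ⟨v, hv⟩ := sp_fbm_single hB 0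
  have h1 := (sp_gauss_second (hB.meas 0).aemeasurable hv).1
  have h2 := hB.cov 0 0 le_rfl le_rfl
  have h3 : (v : ℝ) = 0 := by
    rw [← h1, ← integral_congr_ae (Filter.Eventually.of_forall fun ω => (sq (B 0 ω)).symm), h2]
    simp [zero_rpow (show 2 * H ≠ 0 by positivity)]
  have h4 : v = 0 := by exact_mod_cast h3
  rw [h4, gaussianReal_zero_var] at hv
  have h5 : ∀ᵐ x ∂(μ.map (B 0)), x = 0 := by rw [hv]; simp [ae_dirac_eq]
  exact ae_of_ae_map (hB.meas 0).aemeasurable h5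

theorem sp_super_summable {g β : ℝ} (hg : 1 < g) (hβ : 0 < β) :
    Summable fun n : ℕ => 2 ^ n * (2 * exp (-(β * g ^ n))) := by
  obtain ⟨m, hm⟩ := pow_unbounded_of_one_lt 4 hg
  have hg0 : 0 < g := by linarith
  have hb : ∀ n : ℕ, 2 ^ n * (2 * exp (-(β * g ^ n))) ≤ (2 * (m.factorial : ℝ) / β ^ m) * (1 / 2) ^ n := by
    intro n
    have h1 := Real.pow_div_factorial_le_exp (β * g ^ n) (by positivity) m
    have hf : (0:ℝ) < m.factorial := by positivity
    have h2 : exp (-(β * g ^ n)) ≤ (m.factorial : ℝ) / (β * g ^ n) ^ m := by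
      rw [exp_neg, inv_le_comm₀ (exp_pos _) (by positivity), inv_div]; exact h1
    have h3 : (4:ℝ) ^ n ≤ (g ^ n) ^ m := by
      rw [← pow_mul, mul_comm, pow_mul]; exact pow_le_pow_left₀ (by norm_num) hm.le n
    calc 2 ^ n * (2 * exp (-(β * g ^ n))) ≤ 2 ^ n * (2 * ((m.factorial : ℝ) / (β * g ^ n) ^ m)) := by
          gcongr
      _ = (2 * (m.factorial : ℝ) / β ^ m) * (2 ^ n / (g ^ n) ^ m) := by
          rw [mul_pow]; field_simp
      _ ≤ (2 * (m.factorial : ℝ) / β ^ m) * (2 ^ n / 4 ^ n) := by gcongr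
      _ = _ := by rw [← div_pow]; norm_num
  exact Summable.of_nonneg_of_le (fun n => by positivity) hb
    ((summable_geometric_of_lt_one (by norm_num) (by norm_num)).mul_left _)

theorem sp_fbm_tail (hB : IsFBM μ H B) (hH : 0 < H) (hc : ∀ ω, Continuous fun t => B t ω)
    {T : ℝ} (hT : 0 < T) : ∃ C c : ℝ, 0 ≤ C ∧ 0 < c ∧ ∀ R : ℝ, 0 ≤ R →
      μ {ω | ¬ ∀ t ∈ Icc 0 T, |B t ω| ≤ R} ≤ ENNReal.ofReal (C * exp (-(c * R ^ 2))) := by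
  set w : ℝ := 2 ^ (-(H / 2)) with hw
  set g : ℝ := 2 ^ H with hg
  have hw0 : 0 < w := by positivity
  have hw1 : w < 1 := rpow_lt_one_of_one_lt_of_neg (by norm_num) (by linarith)
  have hg1 : 1 < g := one_lt_rpow (by norm_num) hH
  have hTH : 0 < T ^ (2 * H) := by positivity
  set β : ℝ := (1 - w) ^ 2 / (2 * T ^ (2 * H)) with hβ
  have hw2 : 0 < 1 - w := by linarith
  have hβ0 : 0 < β := by positivity
  have hsum := sp_super_summable hg1 (half_pos hβ0)
  set C1 := ∑' n : ℕ, (2:ℝ) ^ n * (2 * exp (-(β / 2 * g ^ n))) with hC1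
  have hC10 : 0 ≤ C1 := tsum_nonneg fun n => by positivity
  refine ⟨C1 + exp (β / 2), β / 2, by positivity, by positivity, fun R hR => ?_⟩
  rcases lt_or_ge R 1 with hR1 | hR1
  · refine prob_le_one.trans ?_
    rw [← ENNReal.ofReal_one]
    refine ENNReal.ofReal_le_ofReal ?_
    have h1 : exp (-(β / 2)) ≤ exp (-(β / 2 * R ^ 2)) := by
      apply exp_le_exp.2
      have : R ^ 2 ≤ 1 := by nlinarith
      nlinarith
    calc 1 = exp (β / 2) * exp (-(β / 2)) := by rw [← exp_add]; simp
      _ ≤ (C1 + exp (β / 2)) * exp (-(β / 2 * R ^ 2)) := by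
        gcongr; linarith
  set e : ℕ → ℝ := fun n => R * (1 - w) * w ^ n with he
  have hes : Summable e := (summable_geometric_of_lt_one hw0.le hw1).mul_left _
  have het : ∑' n, e n = R := by
    rw [he, tsum_mul_left, tsum_geometric_of_lt_one hw0.le hw1]; field_simp
  have he0 : ∀ n, 0 ≤ e n := fun n => by positivity
  have hsub : {ω | ¬ ∀ t ∈ Icc 0 T, |B t ω| ≤ R} ⊆ {ω | ¬ B 0 ω = 0} ∪
      ⋃ n : ℕ, ⋃ i ∈ Finset.range (2 ^ n), {ω | e n ≤ |B (sp_dy 0 T n (i + 1)) ω - B (sp_dy 0 T n i) ω|} := by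
    intro ω hω
    by_contra hcon
    simp only [mem_union, mem_iUnion, not_or, not_exists, mem_ofPred_eq, not_not, not_le,
      Finset.mem_range] at hcon
    refine hω fun t ht => ?_
    have := sp_chain (hc ω) hT.le he0 hes (fun n k hk => (hcon.2 n k hk).le) ht
    rwa [hcon.1, sub_zero, het] at this
  refine (measure_mono hsub).trans ((measure_union_le _ _).trans ?_)
  rw [show μ {ω | ¬ B 0 ω = 0} = 0 from sp_fbm_zero hB hH, zero_add]
  refine (measure_iUnion_le _).trans ?_
  have hterm : ∀ n : ℕ, μ (⋃ i ∈ Finset.range (2 ^ n),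
      {ω | e n ≤ |B (sp_dy 0 T n (i + 1)) ω - B (sp_dy 0 T n i) ω|}) ≤
      ENNReal.ofReal (2 ^ n * (2 * exp (-(β / 2 * g ^ n))) * exp (-(β / 2 * R ^ 2))) := by
    intro n
    refine (measure_biUnion_finset_le _ _).trans ?_
    have h1 : ∀ i ∈ Finset.range (2 ^ n),
        μ {ω | e n ≤ |B (sp_dy 0 T n (i + 1)) ω - B (sp_dy 0 T n i) ω|} ≤
        ENNReal.ofReal (2 * exp (-(β / 2 * g ^ n)) * exp (-(β / 2 * R ^ 2))) := by
      intro i hi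
      have hi' := Finset.mem_range.1 hi
      obtain ⟨v, hv, hv2⟩ := sp_fbm_inc hB (sp_dy_mem hT.le hi'.le).1
        (sp_dy_mem hT.le (Nat.succ_le_of_lt hi')).1 hH
      refine (sp_gauss_tail ((hB.meas _).sub (hB.meas _)) hv (he0 n)).trans
        (ENNReal.ofReal_le_ofReal ?_)
      rw [mul_assoc, ← exp_add]
      refine mul_le_mul_of_nonneg_left (exp_le_exp.2 ?_) (by norm_num)
      have e1 : (v : ℝ) = T ^ (2 * H) * (g ^ n)⁻¹ ^ 2 := by
        rw [hv2, sp_dy_sub, sub_zero, abs_of_nonneg (by positivity),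
          mul_rpow hT.le (by positivity), hg]
        congr 1
        have two : (0:ℝ) ≤ 2 := by norm_num
        rw [one_div, ← rpow_neg_one, ← rpow_mul_natCast two, ← rpow_mul_natCast two,
          ← rpow_neg two, ← rpow_mul_natCast two, ← rpow_mul two]
        congr 1; push_cast; ring
      have e2 : (w ^ n) ^ 2 = (g ^ n)⁻¹ := by
        have two : (0:ℝ) ≤ 2 := by norm_num
        rw [hw, hg, ← rpow_mul_natCast two, ← rpow_mul_natCast two, ← rpow_mul_natCast two,
          ← rpow_neg two]
        congr 1; push_cast; ring
      have hgn : 1 ≤ g ^ n := one_le_pow₀ hg1.le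
      have hgn0 : 0 < g ^ n := by linarith
      have e3 : -e n ^ 2 / (2 * (v : ℝ)) = -(β * (R ^ 2 * g ^ n)) := by
        rw [e1, he]; simp only
        rw [mul_pow, e2, hβ]; field_simp
      rw [e3]
      have h2 : R ^ 2 ≤ R ^ 2 * g ^ n := le_mul_of_one_le_right (by positivity) hgn
      have h3 : g ^ n ≤ R ^ 2 * g ^ n := le_mul_of_one_le_left hgn0.le (by nlinarith)
      nlinarith
    refine (Finset.sum_le_sum h1).trans (le_of_eq ?_)
    rw [Finset.sum_const, Finset.card_range, nsmul_eq_mul, mul_assoc ((2:ℝ) ^ n),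
      ENNReal.ofReal_mul (p := 2 ^ n) (by positivity), ENNReal.ofReal_pow (by norm_num)]
    push_cast; simp
  refine (ENNReal.tsum_le_tsum hterm).trans ?_
  rw [← ENNReal.ofReal_tsum_of_nonneg (fun n => by positivity) (hsum.mul_right _), tsum_mul_right]
  refine ENNReal.ofReal_le_ofReal (mul_le_mul_of_nonneg_right ?_ (exp_pos _).le)
  have := exp_pos (β / 2)
  linarith

end

/-- The localised moment constant. -/
def sp_Gam (k : ℕ) (L κ T : ℝ) : ℝ :=
  2 ^ (2 * (k + 1)) * ((1 - sp_q)⁻¹ ^ (2 * (k + 1)) *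
    ((2 * sp_Ac k L κ ^ 2 * 2 ^ (sp_Nw k L κ T) * (1 + T)) ^ (2 * (k + 1)) * (1 - sp_q)⁻¹) + 1)

theorem sp_Ac_one {k : ℕ} {L κ : ℝ} (hL : 0 ≤ L) (hκ : 0 < κ) : 1 ≤ sp_Ac k L κ := by
  have := sp_Cb_one k
  unfold sp_Ac
  have : 0 ≤ 200 * sp_Cb k * (L * κ⁻¹) := by positivity
  linarith

theorem sp_exp_summable {c' : ℝ} (hc : 0 < c') (E0 E1 : ℝ) :
    Summable fun n : ℕ => exp (E0 + E1 * n - c' * (n:ℝ) ^ 2) := by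
  have hs : Summable fun n : ℕ => exp (E0 + (E1 + 1) ^ 2 / (4 * c')) * exp (-1) ^ n :=
    (summable_geometric_of_lt_one (exp_pos _).le (by simp)).mul_left _
  refine Summable.of_nonneg_of_le (fun n => (exp_pos _).le) (fun n => ?_) hs
  rw [← exp_nat_mul, ← exp_add]
  apply exp_le_exp.2
  have h1 : 0 ≤ c' * ((n:ℝ) - (E1 + 1) / (2 * c')) ^ 2 := by positivity
  have h2 : c' * ((n:ℝ) - (E1 + 1) / (2 * c')) ^ 2 = c' * (n:ℝ) ^ 2 - (E1 + 1) * n +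
      (E1 + 1) ^ 2 / (4 * c') := by field_simp; ring
  linarith

theorem sp_Gam_bound (k : ℕ) {κ T c a : ℝ} (hκ : 0 < κ) (hT : 0 < T) (hc : 0 < c) (ha : 0 < a) :
    ∃ K1 E0 E1 : ℝ, 0 ≤ K1 ∧ ∀ (L : ℝ) (n : ℕ), 0 ≤ L → sp_Ac k L κ ≤ a * (1 + n) →
      sp_Gam k L κ T ≤ K1 * exp (E0 + E1 * n + c * (n:ℝ) ^ 2) := by
  set p := 2 * (k + 1) with hp
  have hp0 : (0:ℝ) < p := by rw [hp]; positivity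
  have hc0 : 0 < (1 - sp_q)⁻¹ := inv_pos.2 (by linarith [sp_q_lt])
  set K0 := (1 - sp_q)⁻¹ ^ p * ((2 * (1 + T)) ^ p * (1 - sp_q)⁻¹) with hK0
  have hK00 : 0 ≤ K0 := by positivity
  set δ := c / (2 * p * T * a ^ 2) with hδ
  have hδ0 : 0 < δ := by positivity
  refine ⟨2 ^ p * (K0 + 1), p * (2 * a + T * (δ * (a ^ 2 * 2) + a / δ) + 1),
    p * (2 * a + T * (a / δ)), by positivity, fun L n hL hA => ?_⟩
  have hA1 := sp_Ac_one (k := k) hL hκ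
  unfold sp_Gam
  rw [← hp, sp_Nw]
  set A := sp_Ac k L κ with hAd
  have hA0 : 0 < A := by linarith
  set N := ⌈T * A ^ (3 / 2 : ℝ)⌉₊ with hN
  have hN1 : (N : ℝ) ≤ T * A ^ (3 / 2 : ℝ) + 1 := (Nat.ceil_lt_add_one (by positivity)).le
  have hA32 : A ^ (3 / 2 : ℝ) ≤ δ * A ^ 2 + A / δ := by
    have e : A ^ (3 / 2 : ℝ) = A * √A := by
      rw [sqrt_eq_rpow, ← rpow_one_add' hA0.le (by norm_num)]; norm_num
    have h2 : √A ≤ δ * A + 1 / δ := by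
      have h3 := sq_sqrt hA0.le
      have h4 : 0 ≤ (δ * √A - 1) ^ 2 := sq_nonneg _
      have h5 : 0 ≤ √A := sqrt_nonneg A
      have h6 : √A * δ ≤ δ * A * δ + 1 := by
        have h7 : δ * A * δ = (δ * √A) ^ 2 := by rw [mul_pow, h3]; ring
        rw [h7]
        nlinarith [mul_nonneg hδ0.le h5]
      calc √A = √A * δ / δ := by field_simp
        _ ≤ (δ * A * δ + 1) / δ := by gcongr
        _ = _ := by field_simp
    rw [e]
    calc A * √A ≤ A * (δ * A + 1 / δ) := by gcongr
      _ = _ := by ring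
  have hQ : A ^ 2 * 2 ^ N ≤ exp (2 * A + (T * (δ * A ^ 2 + A / δ) + 1)) := by
    rw [exp_add]
    have h1 : A ≤ exp A := by linarith [add_one_le_exp A]
    have h2 : A ^ 2 ≤ exp (2 * A) := by
      rw [two_mul, exp_add, sq]; gcongr
    have h3 : (2:ℝ) ^ N ≤ exp (T * (δ * A ^ 2 + A / δ) + 1) := by
      have : (2:ℝ) ≤ exp 1 := by linarith [add_one_le_exp (1:ℝ)]
      calc (2:ℝ) ^ N ≤ exp 1 ^ N := by gcongr
        _ = exp N := by rw [← exp_nat_mul, mul_one]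
        _ ≤ _ := by
          apply exp_le_exp.2
          have : T * A ^ (3 / 2 : ℝ) ≤ T * (δ * A ^ 2 + A / δ) := by gcongr
          linarith
    gcongr
  have hQ1 : 1 ≤ (A ^ 2 * 2 ^ N) ^ p := by
    apply one_le_pow₀
    have : (1:ℝ) ≤ 2 ^ N := one_le_pow₀ (by norm_num)
    have : (1:ℝ) ≤ A ^ 2 := one_le_pow₀ hA1
    nlinarith
  have hQ2 : (A ^ 2 * 2 ^ N) ^ p ≤ exp (p * (2 * a + T * (δ * (a ^ 2 * 2) + a / δ) + 1) +
      p * (2 * a + T * (a / δ)) * n + c * (n:ℝ) ^ 2) := by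
    refine (pow_le_pow_left₀ (by positivity) hQ p).trans ?_
    rw [← exp_nat_mul]
    apply exp_le_exp.2
    have hA2 : A ^ 2 ≤ a ^ 2 * (2 + 2 * (n:ℝ) ^ 2) := by
      calc A ^ 2 ≤ (a * (1 + n)) ^ 2 := by gcongr
        _ ≤ _ := by rw [mul_pow]; gcongr; nlinarith [sq_nonneg ((n:ℝ) - 1)]
    have e1 : c * (n:ℝ) ^ 2 = p * (T * (δ * (a ^ 2 * (2 * (n:ℝ) ^ 2)))) := by
      rw [hδ]; field_simp
    have h1 : T * (δ * A ^ 2 + A / δ) ≤ T * (δ * (a ^ 2 * (2 + 2 * (n:ℝ) ^ 2)) + (a * (1 + n)) / δ) := by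
      gcongr
    calc (p:ℝ) * (2 * A + (T * (δ * A ^ 2 + A / δ) + 1)) ≤
        p * (2 * (a * (1 + n)) + (T * (δ * (a ^ 2 * (2 + 2 * (n:ℝ) ^ 2)) + (a * (1 + n)) / δ) + 1)) := by
          gcongr
      _ = _ := by rw [e1]; ring
  have e3 : (1 - sp_q)⁻¹ ^ p * ((2 * A ^ 2 * 2 ^ N * (1 + T)) ^ p * (1 - sp_q)⁻¹) =
      K0 * (A ^ 2 * 2 ^ N) ^ p := by
    rw [hK0, show 2 * A ^ 2 * 2 ^ N * (1 + T) = (2 * (1 + T)) * (A ^ 2 * 2 ^ N) by ring,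
      mul_pow (2 * (1 + T))]
    ring
  rw [e3]
  calc 2 ^ p * (K0 * (A ^ 2 * 2 ^ N) ^ p + 1) ≤ 2 ^ p * ((K0 + 1) * (A ^ 2 * 2 ^ N) ^ p) := by
        gcongr; linarith
    _ = 2 ^ p * (K0 + 1) * (A ^ 2 * 2 ^ N) ^ p := by ring
    _ ≤ _ := by gcongr

theorem sp_Gam_summable (k : ℕ) {κ T c : ℝ} (hκ : 0 < κ) (hT : 0 < T) (hc : 0 < c) {C0 CK : ℝ}
    (hC0 : 0 ≤ C0) (hCK : 0 ≤ CK) :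
    Summable fun n : ℕ => sp_Gam k (C0 * ((1 + CK + 2 * n) * exp (C0 * T))) κ T *
      exp (-(c * (n:ℝ) ^ 2)) := by
  have hCb := sp_Cb_one k
  set a := 1 + 200 * sp_Cb k * (C0 * ((1 + CK + 2) * exp (C0 * T)) * κ⁻¹) with ha
  have ha0 : 0 < a := by positivity
  obtain ⟨K1, E0, E1, hK1, h⟩ := sp_Gam_bound k hκ hT (half_pos hc) ha0
  have hc0 : 0 < (1 - sp_q)⁻¹ := inv_pos.2 (by linarith [sp_q_lt])
  refine Summable.of_nonneg_of_le (fun n => ?_) (fun n => ?_)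
    ((sp_exp_summable (half_pos hc) E0 E1).mul_left K1)
  · have hA := sp_Ac_one (k := k) (L := C0 * ((1 + CK + 2 * n) * exp (C0 * T))) (by positivity) hκ
    unfold sp_Gam
    positivity
  · have h1 := h (C0 * ((1 + CK + 2 * n) * exp (C0 * T))) n (by positivity) (by
      unfold sp_Ac
      have hn : (0:ℝ) ≤ n := n.cast_nonneg
      have h2 : (1 + CK + 2 * (n:ℝ)) ≤ (1 + CK + 2) * (1 + n) := by nlinarith
      have h3 : 200 * sp_Cb k * (C0 * ((1 + CK + 2 * n) * exp (C0 * T)) * κ⁻¹) ≤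
        200 * sp_Cb k * (C0 * (((1 + CK + 2) * (1 + n)) * exp (C0 * T)) * κ⁻¹) := by gcongr
      have h4 : a * (1 + n) = 1 + n + 200 * sp_Cb k * (C0 * (((1 + CK + 2) * (1 + n)) * exp (C0 * T)) * κ⁻¹) := by
        rw [ha]; ring
      linarith)
    calc _ ≤ K1 * exp (E0 + E1 * n + c / 2 * (n:ℝ) ^ 2) * exp (-(c * (n:ℝ) ^ 2)) := by gcongr
      _ = _ := by
        rw [mul_assoc, ← exp_add]; congr 2; ring

theorem sp_iSup_le {A : Set ℝ} {g : ℝ → ℝ} {Φ : ℝ≥0∞}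
    (h : ∀ t ∈ A, ENNReal.ofReal (g t) ≤ Φ) : ENNReal.ofReal (⨆ t ∈ A, g t) ≤ Φ := by
  by_cases hΦ : Φ = ∞
  · rw [hΦ]; exact le_top
  · rw [ENNReal.ofReal_le_iff_le_toReal hΦ]
    refine Real.iSup_le (fun t => Real.iSup_le (fun ht => ?_) ENNReal.toReal_nonneg)
      ENNReal.toReal_nonneg
    exact (ENNReal.ofReal_le_iff_le_toReal hΦ).1 (h t ht)

section
variable {Ω : Type*} [MeasurableSpace Ω] {μ : Measure Ω}
    {F : ℝ → MeasurableSpace Ω} {Z : ℝ → Ω → ℝ} {H κ : ℝ} {G : Set Ω} {s T R : ℝ}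
variable [IsProbabilityMeasure μ] {b : ℝ → ℝ → ℝ} {C0 x y CK : ℝ} {X Y : ℝ → Ω → ℝ}

theorem sp_sup_R (hN : SPNoise μ F Z H κ) (hbm : Measurable fun p : ℝ × ℝ => b p.1 p.2)
    (hC0 : 0 ≤ C0) (hb : ∀ t ∈ Icc (0:ℝ) T, ∀ x, |b t x| ≤ C0 * (1 + |x|)) (hs : 0 ≤ s)
    (hsT : s ≤ T)
    (hG : ∀ u, MeasurableSet[F u] G) (hR : 0 ≤ R)
    (hx : |x| ≤ CK) (hy : |y| ≤ CK)
    (hXc : ∀ ω, Continuous fun t => X t ω) (hYc : ∀ ω, Continuous fun t => Y t ω)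
    (hXm : ∀ u, s ≤ u → Measurable[F u] (X u)) (hYm : ∀ u, s ≤ u → Measurable[F u] (Y u))
    (hXe : ∀ ω ∈ G, ∀ t ∈ Icc s T, X t ω = x + (∫ r in Ioc s t, b r (X r ω)) + (Z t ω - Z s ω))
    (hYe : ∀ ω ∈ G, ∀ t ∈ Icc s T, Y t ω = y + (∫ r in Ioc s t, b r (Y r ω)) + (Z t ω - Z s ω))
    (k : ℕ) :
    ∃ S : Ω → ℝ≥0∞, Measurable S ∧ (∀ ω, sp_J Z G s T R T ω = 1 → ∀ t ∈ Icc s T,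
        ENNReal.ofReal (|X t ω - Y t ω| ^ (2 * (k + 1))) ≤ S ω) ∧
      ∫⁻ ω, S ω ∂μ ≤ ENNReal.ofReal (sp_Gam k (C0 * ((1 + CK + 2 * R) * exp (C0 * T))) κ T *
        |x - y| ^ (2 * (k + 1))) := by
  set L := C0 * ((1 + CK + 2 * R) * exp (C0 * T)) with hL
  have hCK : 0 ≤ CK := (abs_nonneg x).trans hx
  have hL0 : 0 ≤ L := by rw [hL]; positivity
  have hA := sp_Ac_one (k := k) hL0 hN.kpos
  have hT0 : 0 ≤ T := hs.trans hsT
  have hc0 : 0 < (1 - sp_q)⁻¹ := inv_pos.2 (by linarith [sp_q_lt])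
  obtain ⟨S, hSm, hS1, hS2⟩ := sp_chain_lp (μ := μ) (D := fun t ω => X t ω - Y t ω)
    (J := sp_J Z G s T R T) (fun ω => (hXc ω).sub (hYc ω)) hs hsT le_rfl hN.Hpos hN.Hlt
    (G := 2 * sp_Ac k L κ ^ 2 * 2 ^ (sp_Nw k L κ T) * |x - y|) (by positivity) (k := k)
    (fun u v hu huv hv => by
      have mX : ∀ u, s ≤ u → Measurable (X u) := fun u hu => (hXm u hu).mono (hN.le u) le_rfl
      have mY : ∀ u, s ≤ u → Measurable (Y u) := fun u hu => (hYm u hu).mono (hN.le u) le_rfl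
      have mJ : Measurable (sp_J Z G s T R T) := (sp_J_meas hN hs hG hsT).mono (hN.le T) le_rfl
      exact mJ.mul (((mX v (hu.trans huv)).sub (mY v (hu.trans huv))).sub
        ((mX u hu).sub (mY u hu))))
    (fun u v hu huv hv => sp_loc hN hbm hC0 hb hs hG hR hx hy hXc hYc hXm hYm hXe hYe hL k u v hu huv hv)
  set p := 2 * (k + 1) with hp
  refine ⟨fun ω => ENNReal.ofReal (2 ^ p) * (S ω + ENNReal.ofReal (|x - y| ^ p)),
    (hSm.add_const _).const_mul _, ?_, ?_⟩
  · intro ω hJ t ht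
    have h1 := hS1 ω hJ t ht
    have hGω := (sp_J_one.1 hJ).1
    have e1 := hXe ω hGω s ⟨le_rfl, hsT⟩
    have e2 := hYe ω hGω s ⟨le_rfl, hsT⟩
    simp only [Ioc_self, Measure.restrict_empty, integral_zero_measure, sub_self, add_zero] at e1 e2
    rw [e1, e2] at h1
    have h2 : |X t ω - Y t ω| ^ p ≤ 2 ^ p * (|X t ω - Y t ω - (x - y)| ^ p + |x - y| ^ p) := by
      set α := |X t ω - Y t ω - (x - y)|
      set β := |x - y|
      have hα : 0 ≤ α := abs_nonneg _
      have hβ : 0 ≤ β := abs_nonneg _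
      have h3 : |X t ω - Y t ω| ≤ α + β := by
        have := abs_add_le (X t ω - Y t ω - (x - y)) (x - y)
        rwa [sub_add_cancel] at this
      have h4 : α + β ≤ 2 * max α β := by linarith [le_max_left α β, le_max_right α β]
      calc |X t ω - Y t ω| ^ p ≤ (2 * max α β) ^ p :=
            pow_le_pow_left₀ (abs_nonneg _) (h3.trans h4) _
        _ = 2 ^ p * (max α β) ^ p := mul_pow _ _ _
        _ ≤ 2 ^ p * (α ^ p + β ^ p) := by
          gcongr
          rcases max_choice α β with h | h <;> rw [h]
          · linarith [pow_nonneg hβ p]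
          · linarith [pow_nonneg hα p]
    refine (ENNReal.ofReal_le_ofReal h2).trans ?_
    rw [ENNReal.ofReal_mul (by positivity), ENNReal.ofReal_add (by positivity) (by positivity)]
    exact mul_le_mul_right (add_le_add_left h1 _) _
  · rw [lintegral_const_mul _ (hSm.add_const _), lintegral_add_right _ measurable_const,
      lintegral_const, measure_univ, mul_one]
    refine (mul_le_mul_right (add_le_add_left hS2 _) _).trans ?_
    rw [← ENNReal.ofReal_add (by positivity) (by positivity), ← ENNReal.ofReal_mul (by positivity)]
    refine ENNReal.ofReal_le_ofReal (le_of_eq ?_)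
    unfold sp_Gam
    rw [← hp, show 2 * sp_Ac k L κ ^ 2 * 2 ^ sp_Nw k L κ T * |x - y| * (1 + T) =
      (2 * sp_Ac k L κ ^ 2 * 2 ^ sp_Nw k L κ T * (1 + T)) * |x - y| by ring, mul_pow _ (|x - y|)]
    ring

/-- Summing over the localisation levels. -/
theorem sp_concl (hN : SPNoise μ F Z H κ) (hbm : Measurable fun p : ℝ × ℝ => b p.1 p.2)
    (hC0 : 0 ≤ C0) (hb : ∀ t ∈ Icc (0:ℝ) T, ∀ x, |b t x| ≤ C0 * (1 + |x|)) (hs : 0 ≤ s)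
    (hsT : s < T) (hGμ : μ Gᶜ = 0) {C c : ℝ} (hC : 0 ≤ C) (hc : 0 < c)
    (htail : ∀ R : ℝ, 0 ≤ R → μ {ω | ¬ ∀ t ∈ Icc 0 T, |Z t ω| ≤ R} ≤
      ENNReal.ofReal (C * exp (-(c * R ^ 2))))
    (hG : ∀ u, MeasurableSet[F u] G)
    (hx : |x| ≤ CK) (hy : |y| ≤ CK) (hxy : x ≠ y)
    (hXc : ∀ ω, Continuous fun t => X t ω) (hYc : ∀ ω, Continuous fun t => Y t ω)
    (hXm : ∀ u, s ≤ u → Measurable[F u] (X u)) (hYm : ∀ u, s ≤ u → Measurable[F u] (Y u))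
    (hXe : ∀ ω ∈ G, ∀ t ∈ Icc s T, X t ω = x + (∫ r in Ioc s t, b r (X r ω)) + (Z t ω - Z s ω))
    (hYe : ∀ ω ∈ G, ∀ t ∈ Icc s T, Y t ω = y + (∫ r in Ioc s t, b r (Y r ω)) + (Z t ω - Z s ω))
    (k : ℕ) :
    ∫⁻ ω, ENNReal.ofReal (⨆ t ∈ Icc s T, |X t ω - Y t ω| ^ (k + 1)) ∂μ ≤
      ENNReal.ofReal ((∑' n : ℕ, ((C + 1) * exp c * exp (0 + 0 * n - c / 4 * (n:ℝ) ^ 2) +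
        sp_Gam k (C0 * ((1 + CK + 2 * n) * exp (C0 * T))) κ T * exp (-(c / 4 * (n:ℝ) ^ 2))))
        * |x - y| ^ (k + 1)) := by
  have hT : 0 < T := by linarith
  have hCK : 0 ≤ CK := (abs_nonneg x).trans hx
  have hκ := hN.kpos
  have hd : 0 < |x - y| := abs_pos.2 (sub_ne_zero.2 hxy)
  set d := |x - y| with hdd
  have ex : ∀ n : ℕ, ∃ S : Ω → ℝ≥0∞, Measurable S ∧ (∀ ω, sp_J Z G s T n T ω = 1 → ∀ t ∈ Icc s T,
        ENNReal.ofReal (|X t ω - Y t ω| ^ (2 * (k + 1))) ≤ S ω) ∧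
      ∫⁻ ω, S ω ∂μ ≤ ENNReal.ofReal (sp_Gam k (C0 * ((1 + CK + 2 * n) * exp (C0 * T))) κ T *
        d ^ (2 * (k + 1))) := fun n =>
    sp_sup_R hN hbm hC0 hb hs hsT.le hG n.cast_nonneg hx hy hXc hYc hXm hYm hXe hYe k
  choose S hSm hS1 hS2 using ex
  set Γ : ℕ → ℝ := fun n => sp_Gam k (C0 * ((1 + CK + 2 * n) * exp (C0 * T))) κ T with hΓ
  have hΓ0 : ∀ n, 0 ≤ Γ n := fun n => by
    have hA := sp_Ac_one (k := k) (L := C0 * ((1 + CK + 2 * n) * exp (C0 * T))) (by positivity) hκ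
    have hc0 : 0 < (1 - sp_q)⁻¹ := inv_pos.2 (by linarith [sp_q_lt])
    simp only [hΓ]
    unfold sp_Gam
    positivity
  set A : ℕ → Set Ω := fun n => {ω | ∀ m : ℕ, m < n → ω ∉ sp_Ev Z G s T m T} with hA
  have hEm : ∀ m : ℕ, MeasurableSet (sp_Ev Z G s T m T) := fun m =>
    hN.le T _ (sp_Ev_meas hN hs hG hsT.le)
  have hAm : ∀ n, MeasurableSet (A n) := fun n => by
    have : A n = ⋂ m : ℕ, ⋂ _ : m < n, (sp_Ev Z G s T m T)ᶜ := by
      ext ω; simp [hA]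
    rw [this]
    exact MeasurableSet.iInter fun m => MeasurableSet.iInter fun _ => (hEm m).compl
  have hAμ : ∀ n : ℕ, μ (A n) ≤ ENNReal.ofReal ((C + 1) * exp c * exp (-(c / 2 * (n:ℝ) ^ 2))) := by
    intro n
    cases n with
    | zero =>
      refine prob_le_one.trans ?_
      rw [← ENNReal.ofReal_one]
      refine ENNReal.ofReal_le_ofReal ?_
      have : 1 ≤ exp c := one_le_exp hc.le
      simp; nlinarith
    | succ m =>
      have hsub : A (m + 1) ⊆ Gᶜ ∪ {ω | ¬ ∀ t ∈ Icc 0 T, |Z t ω| ≤ m} := by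
        intro ω hω
        by_contra hcon
        simp only [mem_union, mem_compl_iff, mem_ofPred_eq, not_or, not_not] at hcon
        exact hω m (Nat.lt_succ_self m) ⟨hcon.1, hsT.le, le_rfl,
          fun r hr => hcon.2 r ⟨hs.trans hr.1, hr.2⟩⟩
      refine (measure_mono hsub).trans ((measure_union_le _ _).trans ?_)
      rw [hGμ, zero_add]
      refine (htail m m.cast_nonneg).trans (ENNReal.ofReal_le_ofReal ?_)
      rw [mul_assoc, ← exp_add]
      have h1 : -(c * (m:ℝ) ^ 2) ≤ c + -(c / 2 * ((m + 1 : ℕ) : ℝ) ^ 2) := by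
        push_cast
        nlinarith [mul_nonneg hc.le (sq_nonneg ((m:ℝ) - 1))]
      have := exp_le_exp.2 h1
      exact mul_le_mul (by linarith) this (exp_pos _).le (by linarith)
  set a : ℕ → ℝ := fun n => d ^ (k + 1) * exp (c / 4 * (n:ℝ) ^ 2) with ha
  have ha0 : ∀ n, 0 < a n := fun n => by positivity
  have hmaj : ∀ᵐ ω ∂μ, ENNReal.ofReal (⨆ t ∈ Icc s T, |X t ω - Y t ω| ^ (k + 1)) ≤
      ∑' n : ℕ, (ENNReal.ofReal (a n) * (A n).indicator (fun _ => 1) ω +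
        ENNReal.ofReal ((a n)⁻¹) * S n ω) := by
    have hGae : ∀ᵐ ω ∂μ, ω ∈ G := hGμ
    filter_upwards [hGae] with ω hω
    have hex : ∃ n : ℕ, ω ∈ sp_Ev Z G s T n T := by
      obtain ⟨B0, hB0⟩ := isCompact_Icc.exists_bound_of_continuousOn (s := Icc s T)
        (hN.cont ω).continuousOn
      obtain ⟨n, hn⟩ := exists_nat_ge B0
      exact ⟨n, hω, hsT.le, le_rfl, fun r hr => (hB0 r hr).trans hn⟩
    classical
    set n := Nat.find hex with hn
    have h1 : ω ∈ sp_Ev Z G s T n T := Nat.find_spec hex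
    have h2 : ω ∈ A n := fun m hm => Nat.find_min hex hm
    refine sp_iSup_le fun t ht => ?_
    refine le_trans ?_ (ENNReal.le_tsum n)
    rw [indicator_of_mem h2, mul_one]
    have h3 := hS1 n ω (sp_J_one.2 h1) t ht
    set z := |X t ω - Y t ω| ^ (k + 1) with hz
    have hz0 : 0 ≤ z := by positivity
    have h4 : z ≤ a n + (a n)⁻¹ * z ^ 2 := by
      rcases le_total z (a n) with h | h
      · have : 0 ≤ (a n)⁻¹ * z ^ 2 := by have := ha0 n; positivity
        linarith
      · have h5 : z ≤ (a n)⁻¹ * z ^ 2 := by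
          rw [inv_mul_eq_div, le_div_iff₀ (ha0 n)]; nlinarith
        linarith [ha0 n]
    refine (ENNReal.ofReal_le_ofReal h4).trans ?_
    have hi : 0 < (a n)⁻¹ := inv_pos.2 (ha0 n)
    rw [ENNReal.ofReal_add (ha0 n).le (by positivity), ENNReal.ofReal_mul hi.le]
    refine add_le_add le_rfl (mul_le_mul_right ?_ _)
    rw [hz, ← pow_mul, mul_comm]; exact h3
  refine (lintegral_mono_ae hmaj).trans ?_
  have hm1 : ∀ n, Measurable fun ω => ENNReal.ofReal (a n) * (A n).indicator (fun _ => (1:ℝ≥0∞)) ω :=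
    fun n => (measurable_const.indicator (hAm n)).const_mul _
  have hm2 : ∀ n, Measurable fun ω => ENNReal.ofReal (a n) * (A n).indicator (fun _ => (1:ℝ≥0∞)) ω
      + ENNReal.ofReal ((a n)⁻¹) * S n ω := fun n => (hm1 n).add ((hSm n).const_mul _)
  rw [lintegral_tsum fun n => (hm2 n).aemeasurable]
  have hterm : ∀ n : ℕ, ∫⁻ ω, (ENNReal.ofReal (a n) * (A n).indicator (fun _ => 1) ω +
        ENNReal.ofReal ((a n)⁻¹) * S n ω) ∂μ ≤ ENNReal.ofReal
        (((C + 1) * exp c * exp (0 + 0 * n - c / 4 * (n:ℝ) ^ 2) +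
          Γ n * exp (-(c / 4 * (n:ℝ) ^ 2))) * d ^ (k + 1)) := by
    intro n
    rw [lintegral_add_left (hm1 n), lintegral_const_mul _ (hSm n),
      lintegral_const_mul _ (measurable_const.indicator (hAm n)), lintegral_indicator (hAm n),
      lintegral_const, Measure.restrict_apply_univ, one_mul]
    refine (add_le_add (mul_le_mul_right (hAμ n) _) (mul_le_mul_right (hS2 n) _)).trans ?_
    have hi : 0 < (a n)⁻¹ := inv_pos.2 (ha0 n)
    have hg := hΓ0 n
    rw [← ENNReal.ofReal_mul (ha0 n).le, ← ENNReal.ofReal_mul hi.le, ← ENNReal.ofReal_add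
      (by have := ha0 n; positivity) (mul_nonneg hi.le (mul_nonneg hg (by positivity)))]
    refine ENNReal.ofReal_le_ofReal (le_of_eq ?_)
    have e1 : exp (c / 4 * (n:ℝ) ^ 2) * exp (-(c / 2 * (n:ℝ) ^ 2)) =
        exp (0 + 0 * n - c / 4 * (n:ℝ) ^ 2) := by
      rw [← exp_add]; congr 1; ring
    have q1 : a n * ((C + 1) * exp c * exp (-(c / 2 * (n:ℝ) ^ 2))) =
        (C + 1) * exp c * exp (0 + 0 * n - c / 4 * (n:ℝ) ^ 2) * d ^ (k + 1) := by
      rw [← e1]; simp only [ha]; ring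
    have q2 : (a n)⁻¹ * (Γ n * d ^ (2 * (k + 1))) =
        Γ n * exp (-(c / 4 * (n:ℝ) ^ 2)) * d ^ (k + 1) := by
      have h1 : d ^ (2 * (k + 1)) = d ^ (k + 1) * d ^ (k + 1) := by ring
      have h2 : exp (-(c / 4 * (n:ℝ) ^ 2)) * exp (c / 4 * (n:ℝ) ^ 2) = 1 := by
        rw [← exp_add]; simp
      rw [inv_mul_eq_div, div_eq_iff (ha0 n).ne', h1]
      simp only [ha]
      linear_combination (-(Γ n * d ^ (k + 1) * d ^ (k + 1))) * h2
    exact (congrArg₂ (· + ·) q1 q2).trans (add_mul _ _ _).symm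
  refine (ENNReal.tsum_le_tsum hterm).trans (le_of_eq ?_)
  have hsm : Summable fun n : ℕ => ((C + 1) * exp c * exp (0 + 0 * n - c / 4 * (n:ℝ) ^ 2) +
        Γ n * exp (-(c / 4 * (n:ℝ) ^ 2))) :=
    ((sp_exp_summable (by positivity) 0 0).mul_left _).add
      (sp_Gam_summable k hκ hT (by positivity) hC0 hCK)
  rw [← ENNReal.ofReal_tsum_of_nonneg (fun n => by have := hΓ0 n; positivity) (hsm.mul_right _),
    tsum_mul_right]

end

theorem sp_noise {Ω : Type*} [MeasurableSpace Ω] {μ : Measure Ω} [IsProbabilityMeasure μ]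
    (hμc : μ.IsComplete) {H : ℝ} (hH0 : 0 < H) (hH : H < 1 / 6)
    {ρ₁ ρ₂ : ℝ} (hρ₁ : ρ₁ ≠ 0)
    {B W : ℝ → Ω → ℝ} (hB : IsFBM μ H B) (hBcont : ∀ ω, Continuous fun t => B t ω)
    (hW : IsFBM μ (1 / 2) W) (hWcont : ∀ ω, Continuous fun t => W t ω)
    (hindep : IndepFun (fun ω => fun t : ℝ => B t ω) (fun ω => fun t : ℝ => W t ω) μ) :
    SPNoise μ (sp_F μ B W) (fun t ω => ρ₁ * B t ω + ρ₂ * W t ω) H (|ρ₁| / √2) where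
  le := sp_F_le hμc hB.meas hW.meas
  mono := fun s t h => sp_F_mono h
  meas := fun t => ((hB.meas t).const_mul _).add ((hW.meas t).const_mul _)
  adapt := fun t ht => by
    have h1 := sp_F_B (μ := μ) (B := B) (W := W) t (r := t) ⟨ht, le_rfl⟩
    have h2 := sp_F_W (μ := μ) (B := B) (W := W) t t
    exact (@Measurable.const_mul _ _ _ _ _ (_) _ h1 _).add (@Measurable.const_mul _ _ _ _ _ (_) _ h2 _)
  cont := fun ω => ((hBcont ω).const_mul _).add ((hWcont ω).const_mul _)
  kpos := by have := abs_pos.2 hρ₁; positivity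
  Hpos := hH0
  Hlt := hH
  dec := fun s u hs hsu => by
    obtain ⟨Y, R, v, h1, h2, h3, h4, h5, h6⟩ :=
      sp_dec hH0 (by linarith) hB hW.meas hindep ρ₁ ρ₂ hs hsu.le
    refine ⟨Y, R, v, h1, h2, h3, h4, h5, ?_⟩
    rwa [div_pow, sq_abs, Real.sq_sqrt (by norm_num)]

theorem sp_tail2 {Ω : Type*} [MeasurableSpace Ω] {μ : Measure Ω}
    {B W : ℝ → Ω → ℝ} {T : ℝ} (ρ₁ ρ₂ : ℝ)
    (hB : ∃ C c : ℝ, 0 ≤ C ∧ 0 < c ∧ ∀ R : ℝ, 0 ≤ R →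
      μ {ω | ¬ ∀ t ∈ Icc 0 T, |B t ω| ≤ R} ≤ ENNReal.ofReal (C * exp (-(c * R ^ 2))))
    (hW : ∃ C c : ℝ, 0 ≤ C ∧ 0 < c ∧ ∀ R : ℝ, 0 ≤ R →
      μ {ω | ¬ ∀ t ∈ Icc 0 T, |W t ω| ≤ R} ≤ ENNReal.ofReal (C * exp (-(c * R ^ 2)))) :
    ∃ C c : ℝ, 0 ≤ C ∧ 0 < c ∧ ∀ R : ℝ, 0 ≤ R →
      μ {ω | ¬ ∀ t ∈ Icc 0 T, |ρ₁ * B t ω + ρ₂ * W t ω| ≤ R} ≤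
        ENNReal.ofReal (C * exp (-(c * R ^ 2))) := by
  obtain ⟨C1, c1, hC1, hc1, h1⟩ := hB
  obtain ⟨C2, c2, hC2, hc2, h2⟩ := hW
  set θ : ℝ := (2 * (|ρ₁| + |ρ₂| + 1))⁻¹ with hθ
  have hθ0 : 0 < θ := by positivity
  have hθ1 : θ * (2 * (|ρ₁| + |ρ₂| + 1)) = 1 := inv_mul_cancel₀ (by positivity)
  have hmin : 0 < min c1 c2 := lt_min hc1 hc2
  refine ⟨C1 + C2, min c1 c2 * θ ^ 2, by linarith, by positivity, fun R hR => ?_⟩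
  have hsub : {ω | ¬ ∀ t ∈ Icc 0 T, |ρ₁ * B t ω + ρ₂ * W t ω| ≤ R} ⊆
      {ω | ¬ ∀ t ∈ Icc 0 T, |B t ω| ≤ θ * R} ∪ {ω | ¬ ∀ t ∈ Icc 0 T, |W t ω| ≤ θ * R} := by
    intro ω hω
    by_contra hcon
    simp only [mem_union, mem_ofPred_eq, not_or, not_not] at hcon
    refine hω fun t ht => ?_
    have e1 := hcon.1 t ht
    have e2 := hcon.2 t ht
    calc |ρ₁ * B t ω + ρ₂ * W t ω| ≤ |ρ₁| * |B t ω| + |ρ₂| * |W t ω| := by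
          rw [← abs_mul, ← abs_mul]; exact abs_add_le _ _
      _ ≤ |ρ₁| * (θ * R) + |ρ₂| * (θ * R) := by gcongr
      _ ≤ R := by
          have : 0 ≤ θ * R := by positivity
          nlinarith [abs_nonneg ρ₁, abs_nonneg ρ₂, mul_nonneg (abs_nonneg ρ₁) this, mul_nonneg (abs_nonneg ρ₂) this, congrArg (· * R) hθ1]
  refine (measure_mono hsub).trans ((measure_union_le _ _).trans ?_)
  have hR' : 0 ≤ θ * R := by positivity
  refine (add_le_add (h1 _ hR') (h2 _ hR')).trans ?_
  rw [← ENNReal.ofReal_add (by positivity) (by positivity)]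
  refine ENNReal.ofReal_le_ofReal ?_
  rw [add_mul]
  have k0 : 0 ≤ (θ * R) ^ 2 := sq_nonneg _
  refine add_le_add (mul_le_mul_of_nonneg_left (exp_le_exp.2 ?_) hC1)
    (mul_le_mul_of_nonneg_left (exp_le_exp.2 ?_) hC2)
  · nlinarith [mul_le_mul_of_nonneg_right (min_le_left c1 c2) k0]
  · nlinarith [mul_le_mul_of_nonneg_right (min_le_right c1 c2) k0]

/-- Proposition `Stability`: a stability estimate
`E[sup_{t∈[s,T]} |X^{s,x}_t − X^{s,y}_t|^{2^r}] ≤ C_{r,H,T}(K)|x − y|^{2^r}`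
for the strong solutions of `dX_t = b(t,X_t)dt + ρ₁dB^H_t + ρ₂dW_t`, `X_s = x`, with
`H < 1/6` and `b` the sum of a bounded measurable function and a Lipschitz function of
linear growth. -/
theorem stmt8 {Ω : Type*} [MeasurableSpace Ω] (μ : Measure Ω) [IsProbabilityMeasure μ]
    (hμc : μ.IsComplete) (H T : ℝ) (hH0 : 0 < H) (hH : H < 1 / 6) (hT : 0 < T)
    (ρ₁ ρ₂ : ℝ) (hρ₁ : ρ₁ ≠ 0)
    (B W : ℝ → Ω → ℝ) (hB : IsFBM μ H B) (hBcont : ∀ ω, Continuous fun t => B t ω)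
    (hW : IsFBM μ (1 / 2) W) (hWcont : ∀ ω, Continuous fun t => W t ω)
    (hindep : IndepFun (fun ω => fun t : ℝ => B t ω) (fun ω => fun t : ℝ => W t ω) μ)
    (b btilde bhat : ℝ → ℝ → ℝ)
    (hdecomp : ∀ t x, b t x = btilde t x + bhat t x)
    (htmeas : Measurable fun p : ℝ × ℝ => btilde p.1 p.2)
    (htbdd : ∃ M : ℝ, ∀ t x, |btilde t x| ≤ M)
    (hhmeas : Measurable fun p : ℝ × ℝ => bhat p.1 p.2)
    (Klip Cgr : ℝ)
    (hhlip : ∀ t ∈ Set.Icc (0 : ℝ) T, ∀ x y : ℝ, |bhat t x - bhat t y| ≤ Klip * |x - y|)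
    (hhgrowth : ∀ t ∈ Set.Icc (0 : ℝ) T, ∀ x : ℝ, |bhat t x| ≤ Cgr * (1 + |x|))
    (X : ℝ → ℝ → ℝ → Ω → ℝ)
    (hXsol : ∀ s ∈ Set.Ico (0 : ℝ) T, ∀ x : ℝ,
      (∀ ω, ContinuousOn (fun t => X s x t ω) (Set.Icc s T)) ∧
      (∀ t ∈ Set.Icc s T, Measurable[augPairFiltration μ B W t] (X s x t)) ∧
      (∀ᵐ ω ∂μ, ∀ t ∈ Set.Icc s T,
          X s x t ω = x + (∫ u in Set.Ioc s t, b u (X s x u ω)) +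
            ρ₁ * (B t ω - B s ω) + ρ₂ * (W t ω - W s ω)))
    (K : Set ℝ) (hK : IsCompact K) (r : ℕ) :
    ∃ C : ℝ, 0 ≤ C ∧
      ∀ s ∈ Set.Ico (0 : ℝ) T, ∀ x ∈ K, ∀ y ∈ K,
        ∫⁻ ω, ENNReal.ofReal
            (⨆ t ∈ Set.Icc s T, |X s x t ω - X s y t ω| ^ (2 ^ r)) ∂μ
          ≤ ENNReal.ofReal (C * |x - y| ^ (2 ^ r)) := by
  have hN := sp_noise hμc hH0 hH (ρ₂ := ρ₂) hρ₁ hB hBcont hW hWcont hindep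
  obtain ⟨C, c, hC, hc, htail⟩ := sp_tail2 (T := T) ρ₁ ρ₂ (sp_fbm_tail hB hH0 hBcont hT)
    (sp_fbm_tail hW (by norm_num) hWcont hT)
  obtain ⟨M, hM⟩ := htbdd
  have hM0 : 0 ≤ M := (abs_nonneg _).trans (hM 0 0)
  have hg0 : 0 ≤ Cgr := by
    have := (abs_nonneg _).trans (hhgrowth 0 ⟨le_rfl, hT.le⟩ 0)
    simpa using this
  have hbm : Measurable fun p : ℝ × ℝ => b p.1 p.2 := by
    have : (fun p : ℝ × ℝ => b p.1 p.2) = fun p => btilde p.1 p.2 + bhat p.1 p.2 := by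
      ext p; exact hdecomp _ _
    rw [this]; exact htmeas.add hhmeas
  have hC0 : 0 ≤ M + Cgr := by linarith
  have hb : ∀ t ∈ Icc (0:ℝ) T, ∀ x, |b t x| ≤ (M + Cgr) * (1 + |x|) := fun t ht x => by
    rw [hdecomp]
    have h1 := abs_add_le (btilde t x) (bhat t x)
    have h2 := hM t x
    have h3 := hhgrowth t ht x
    nlinarith [mul_nonneg hM0 (abs_nonneg x)]
  obtain ⟨CK, hCK⟩ := hK.exists_bound_of_continuousOn (f := fun x : ℝ => x) continuousOn_id
  obtain ⟨k, hk⟩ : ∃ k, 2 ^ r = k + 1 := ⟨2 ^ r - 1, (Nat.sub_add_cancel Nat.one_le_two_pow).symm⟩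
  rw [hk]
  set S0 : ℝ := ∑' n : ℕ, ((C + 1) * exp c * exp (0 + 0 * n - c / 4 * (n:ℝ) ^ 2) +
        sp_Gam k ((M + Cgr) * ((1 + CK + 2 * n) * exp ((M + Cgr) * T))) (|ρ₁| / √2) T
          * exp (-(c / 4 * (n:ℝ) ^ 2))) with hS0
  refine ⟨max 0 S0, le_max_left _ _, fun s hs x hx y hy => ?_⟩
  by_cases hxy : x = y
  · subst hxy
    simp
  set cl : ℝ → ℝ := fun t => max s (min t T) with hcl
  have hclc : Continuous cl := continuous_const.max (continuous_id.min continuous_const)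
  have hclm : ∀ t, cl t ∈ Icc s T := fun t => ⟨le_max_left _ _, max_le hs.2.le (min_le_right _ _)⟩
  have hcle : ∀ t ∈ Icc s T, cl t = t := fun t ht => by
    simp only [hcl]; rw [min_eq_left ht.2, max_eq_right ht.1]
  have hclu : ∀ u, s ≤ u → cl u ≤ u := fun u hu => max_le hu (min_le_left _ _)
  set G : Set Ω := {ω | (∀ t ∈ Set.Icc s T,
          X s x t ω = x + (∫ u in Set.Ioc s t, b u (X s x u ω)) +
            ρ₁ * (B t ω - B s ω) + ρ₂ * (W t ω - W s ω)) ∧ ∀ t ∈ Set.Icc s T,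
          X s y t ω = y + (∫ u in Set.Ioc s t, b u (X s y u ω)) +
            ρ₁ * (B t ω - B s ω) + ρ₂ * (W t ω - W s ω)} with hG
  have hGμ : μ Gᶜ = 0 := (hXsol s hs x).2.2.and (hXsol s hs y).2.2
  have hGm : ∀ u, MeasurableSet[sp_F μ B W u] G := fun u => by
    have := @MeasurableSet.compl _ _ (sp_F μ B W u) (sp_F_null u hGμ)
    rwa [compl_compl] at this
  have hXc : ∀ z, ∀ ω, Continuous fun t => X s z (cl t) ω := fun z ω =>
    ((hXsol s hs z).1 ω).comp_continuous hclc hclm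
  have hXm : ∀ z, ∀ u, s ≤ u → Measurable[sp_F μ B W u] (X s z (cl u)) := fun z u hu =>
    ((hXsol s hs z).2.1 _ (hclm u)).mono ((sp_aug_le _).trans (sp_F_mono (hclu u hu))) le_rfl
  have hXe : ∀ z ω, (∀ t ∈ Set.Icc s T,
          X s z t ω = z + (∫ u in Set.Ioc s t, b u (X s z u ω)) +
            ρ₁ * (B t ω - B s ω) + ρ₂ * (W t ω - W s ω)) → ∀ t ∈ Icc s T,
      X s z (cl t) ω = z + (∫ r in Ioc s t, b r (X s z (cl r) ω)) +
        ((ρ₁ * B t ω + ρ₂ * W t ω) - (ρ₁ * B s ω + ρ₂ * W s ω)) := by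
    intro z ω h t ht
    have e : ∫ r in Ioc s t, b r (X s z (cl r) ω) = ∫ r in Ioc s t, b r (X s z r ω) := by
      refine setIntegral_congr_fun measurableSet_Ioc fun q hq => ?_
      simp only [hcle q ⟨hq.1.le, hq.2.trans ht.2⟩]
    rw [e, hcle t ht, h t ht]
    ring
  have main := sp_concl (X := fun t => X s x (cl t)) (Y := fun t => X s y (cl t)) hN hbm hC0 hb
    hs.1 hs.2 hGμ hC hc htail hGm (hCK x hx) (hCK y hy) hxy (hXc x) (hXc y) (hXm x) (hXm y)
    (fun ω hω => hXe x ω hω.1) (fun ω hω => hXe y ω hω.2) k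
  have e2 : ∀ ω, (⨆ t ∈ Set.Icc s T, |X s x t ω - X s y t ω| ^ (k + 1)) =
      ⨆ t ∈ Set.Icc s T, |X s x (cl t) ω - X s y (cl t) ω| ^ (k + 1) := fun ω =>
    iSup_congr fun t => iSup_congr fun ht => by rw [hcle t ht]
  simp only [e2]
  refine main.trans (ENNReal.ofReal_le_ofReal ?_)
  exact mul_le_mul_of_nonneg_right (le_max_right _ _) (by positivity)
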